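/- Assume the Riemann Hypothesis, let λ > 0 and let r ∈ A(λ). Then for every ε > 0 and all sufficiently large T, Σ_{0<γ_d≤T} m(γ_d)(m(γ_d) − 1) + #{ordered pairs (γ,γ') of ordinates in (0,T], counted with multiplicity, with 0 < |γ − γ'| ≤ 2πλ/log T} ≥ (c(λ;r) − ε) · N(T). -/

import Mathlib

open Filter MeasureTheory
open scoped Real

noncomputable section

/-- The multiplicity (order of vanishing) of the Riemann zeta function at a point `z`:
the least `n` such that the `n`-th derivative of `ζ` at `z` is nonzero. -/
def zetaMult (z : ℂ) : ℕ := sInf {n : ℕ | iteratedDeriv n riemannZeta z ≠ 0}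

/-- Under RH, the set of ordinates `γ` with `0 < γ ≤ T` of nontrivial zeros `1/2 + iγ` of `ζ`. -/
def zetaOrds (T : ℝ) : Set ℝ :=
  {γ : ℝ | 0 < γ ∧ γ ≤ T ∧ riemannZeta (1 / 2 + γ * Complex.I) = 0}

/-- The multiplicity of the zero of `ζ` at `1/2 + iγ`. -/
def ordMult (γ : ℝ) : ℕ := zetaMult (1 / 2 + γ * Complex.I)

/-- `N(T)`: the number of ordinates of nontrivial zeros in `(0, T]`, counted with multiplicity. -/
def zetaN (T : ℝ) : ℕ := ∑ᶠ γ ∈ zetaOrds T, ordMult γ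

/-- The next ordinate of a nontrivial zero strictly above `γ`. -/
def nextOrd (γ : ℝ) : ℝ :=
  sInf {γ' : ℝ | γ < γ' ∧ riemannZeta (1 / 2 + γ' * Complex.I) = 0}

/-- The Fourier transform of an (even, real-valued) function `r`, written as a cosine
transform: `r̂(α) = ∫ r(u) cos(2παu) du`, which agrees with
`∫ r(u) e^{-2πiαu} du` for even real-valued `r`. -/
def fourierCos (r : ℝ → ℝ) (α : ℝ) : ℝ := ∫ u : ℝ, r u * Real.cos (2 * π * α * u)

/-- The class `𝒜(λ)` of even, continuous, real-valued `r ∈ L¹(ℝ)` with `r(0) = 1`,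
`r(u) ≤ 0` for `|u| > λ`, and nonnegative Fourier transform. -/
def memA (lam : ℝ) (r : ℝ → ℝ) : Prop :=
  Continuous r ∧ (∀ u : ℝ, r (-u) = r u) ∧ Integrable r ∧ r 0 = 1 ∧
    (∀ u : ℝ, lam < |u| → r u ≤ 0) ∧ ∀ α : ℝ, 0 ≤ fourierCos r α

/-- `c(λ; r) = r̂(0) - 1 + 2∫₀¹ α r̂(α) dα`. -/
def cOf (r : ℝ → ℝ) : ℝ :=
  fourierCos r 0 - 1 + 2 * ∫ α in (0:ℝ)..1, α * fourierCos r α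

/-- The number of ordered pairs `(γ, γ')` of ordinates in `(0, T]`, counted with multiplicity,
with `0 < |γ - γ'| ≤ δ`; i.e. the sum of `m(γ_d) * m(γ_d')` over pairs of distinct
ordinates `γ_d ≠ γ_d'` in `(0, T]` with `0 < |γ_d - γ_d'| ≤ δ`. -/
def pairCount (T δ : ℝ) : ℕ :=
  ∑ᶠ p ∈ {p : ℝ × ℝ | p.1 ∈ zetaOrds T ∧ p.2 ∈ zetaOrds T ∧
      0 < |p.1 - p.2| ∧ |p.1 - p.2| ≤ δ}, ordMult p.1 * ordMult p.2


section
/-- Gaussian test function. -/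
def Gt (u W y : ℝ) (z : ℂ) : ℂ :=
  Complex.exp (-(z - u) ^ 2 / (2 * (W:ℂ) ^ 2) + Complex.I * y * z)

lemma Gt_mul_exp (u W y x : ℝ) (z : ℂ) :
    Gt u W y z * Complex.exp (-(Complex.I * x * z)) = Gt u W (y - x) z := by
  unfold Gt
  rw [← Complex.exp_add]
  congr 1
  push_cast
  ring

lemma Gt_norm (u W y : ℝ) (t c : ℝ) :
    ‖Gt u W y (t + c * Complex.I)‖ =
      Real.exp (-(t - u) ^ 2 / (2 * W ^ 2)) * Real.exp (c ^ 2 / (2 * W ^ 2)) * Real.exp (-(y * c)) := by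
  unfold Gt
  rw [Complex.norm_exp, ← Real.exp_add, ← Real.exp_add]
  congr 1
  have : -((t:ℂ) + c * Complex.I - u) ^ 2 / (2 * (W:ℂ) ^ 2) + Complex.I * y * (t + c * Complex.I)
    = ((-(t - u) ^ 2 / (2 * W ^ 2) + (c ^ 2 / (2 * W ^ 2)) + (-(y * c)) : ℝ) : ℂ)
      + ((-(t - u) * c / W ^ 2 + y * t : ℝ) : ℂ) * Complex.I := by
    push_cast
    have h : ((t:ℂ) + c * Complex.I - u) ^ 2 = (t - u) ^ 2 - c ^ 2 + 2 * (t - u) * c * Complex.I := by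
      ring_nf; simp only [Complex.I_sq]; ring
    have h2 : Complex.I * y * (t + c * Complex.I) = y * t * Complex.I - y * c := by
      ring_nf; simp only [Complex.I_sq]; ring
    rw [h, h2]
    ring
  rw [this, Complex.add_re, Complex.ofReal_re, Complex.re_ofReal_mul, Complex.I_re]
  ring

lemma Gt_quad (u W y : ℝ) (c : ℝ) (t : ℝ) : Gt u W y (t + c * Complex.I) =
    Complex.exp ((-1 / (2 * (W:ℂ) ^ 2)) * (t:ℂ) ^ 2
      + ((u - c * Complex.I) / (W:ℂ) ^ 2 + Complex.I * y) * t
      + (-(c * Complex.I - u) ^ 2 / (2 * (W:ℂ) ^ 2) + Complex.I * y * (c * Complex.I))) := by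
  unfold Gt
  congr 1
  ring

lemma bre_neg {W : ℝ} (hW : 0 < W) : (-1 / (2 * (W:ℂ) ^ 2)).re < 0 := by
  have : (-1 / (2 * (W:ℂ) ^ 2)) = ((-1 / (2 * W ^ 2) : ℝ) : ℂ) := by push_cast; ring
  rw [this, Complex.ofReal_re]
  apply div_neg_of_neg_of_pos <;> [norm_num; positivity]

lemma Gt_integrable (u y c : ℝ) {W : ℝ} (hW : 0 < W) :
    Integrable (fun t : ℝ => Gt u W y (t + c * Complex.I)) := by
  simp_rw [Gt_quad]
  exact integrable_cexp_quadratic' (bre_neg hW) _ _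

lemma Gt_integral (u y c : ℝ) {W : ℝ} (hW : 0 < W) :
    ∫ t : ℝ, Gt u W y (t + c * Complex.I) =
      (W * √(2 * π) : ℝ) * Complex.exp (Complex.I * u * y - W ^ 2 * y ^ 2 / 2) := by
  simp_rw [Gt_quad]
  rw [integral_cexp_quadratic (bre_neg hW)]
  have hWc : (W:ℂ) ≠ 0 := by exact_mod_cast hW.ne'
  congr 1
  · have : (π:ℂ) / -(-1 / (2 * (W:ℂ) ^ 2)) = ((W ^ 2 * (2 * π) : ℝ) : ℂ) := by
      push_cast; field_simp
    rw [this]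
    have h2 : ((1:ℂ) / 2) = ((1 / 2 : ℝ) : ℂ) := by push_cast; rfl
    rw [h2, ← Complex.ofReal_cpow (by positivity), ← Real.sqrt_eq_rpow, Real.sqrt_mul (by positivity),
      Real.sqrt_sq hW.le]
  · congr 1
    field_simp
    ring_nf
    simp only [Complex.I_sq]
    ring
lemma gauss_integral (u : ℝ) {W : ℝ} (hW : 0 < W) :
    ∫ t : ℝ, Real.exp (-(t - u) ^ 2 / (2 * W ^ 2)) = W * √(2 * π) := by
  have h := integral_sub_right_eq_self (fun t : ℝ => Real.exp (-t ^ 2 / (2 * W ^ 2))) u (μ := volume)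
  rw [h]
  have h2 := integral_gaussian (1 / (2 * W ^ 2))
  have : (fun t : ℝ => Real.exp (-t ^ 2 / (2 * W ^ 2))) = fun t : ℝ => Real.exp (-(1 / (2 * W ^ 2)) * t ^ 2) := by
    ext t; congr 1; ring
  rw [this, h2]
  have h3 : π / (1 / (2 * W ^ 2)) = W ^ 2 * (2 * π) := by field_simp
  rw [h3, Real.sqrt_mul (by positivity), Real.sqrt_sq hW.le]

lemma gauss_integrable (u : ℝ) {W : ℝ} (hW : 0 < W) :
    Integrable (fun t : ℝ => Real.exp (-(t - u) ^ 2 / (2 * W ^ 2))) := by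
  have h := (integrable_exp_neg_mul_sq (b := 1 / (2 * W ^ 2)) (by positivity)).comp_sub_right u
  refine h.congr (Eventually.of_forall fun t => ?_)
  simp only
  congr 1
  ring

end

section

/-- Fourier side function. -/
def Gh (u W y g : ℝ) (x : ℝ) : ℂ :=
  Complex.exp (Complex.I * g * x) *
    ((W * √(2 * π) : ℝ) * Complex.exp (Complex.I * u * (y - x : ℝ) - W ^ 2 * (y - x : ℝ) ^ 2 / 2))

lemma Gh_eq (u y g : ℝ) {W : ℝ} (hW : 0 < W) (x : ℝ) :
    Gh u W y g x = ((W * √(2 * π) : ℝ) * Complex.exp (Complex.I * u * y)) * Gt y W⁻¹ (g - u) (x + (0:ℝ) * Complex.I) := by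
  have hWc : (W:ℂ) ≠ 0 := by exact_mod_cast hW.ne'
  unfold Gh Gt
  rw [mul_left_comm, mul_assoc _ (Complex.exp _), ← Complex.exp_add, ← Complex.exp_add]
  congr 2
  push_cast
  field_simp
  ring

lemma Gh_integrable (u y g : ℝ) {W : ℝ} (hW : 0 < W) : Integrable (Gh u W y g) := by
  have : Gh u W y g = fun x : ℝ => ((W * √(2 * π) : ℝ) * Complex.exp (Complex.I * u * y)) * Gt y W⁻¹ (g - u) (x + (0:ℝ) * Complex.I) := by
    ext x; exact Gh_eq u y g hW x
  rw [this]
  exact (Gt_integrable _ _ _ (inv_pos.2 hW)).const_mul _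

lemma Gh_integral (u y g : ℝ) {W : ℝ} (hW : 0 < W) : ∫ x, Gh u W y g x = 2 * π * Gt u W y g := by
  have hWc : (W:ℂ) ≠ 0 := by exact_mod_cast hW.ne'
  simp_rw [Gh_eq u y g hW]
  rw [integral_const_mul, Gt_integral _ _ _ (inv_pos.2 hW)]
  have h1 : ((W * √(2 * π) : ℝ) : ℂ) * ((W⁻¹ * √(2 * π) : ℝ) : ℂ) = 2 * π := by
    rw [← Complex.ofReal_mul]
    have : W * √(2 * π) * (W⁻¹ * √(2 * π)) = 2 * π := by
      have := Real.mul_self_sqrt (show (0:ℝ) ≤ 2 * π by positivity)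
      field_simp
      linarith
    rw [this]; push_cast; rfl
  rw [mul_mul_mul_comm, h1, ← Complex.exp_add]
  unfold Gt
  congr 2
  push_cast
  field_simp
  ring

lemma cauchy_half (u y g c : ℝ) {W : ℝ} (hW : 0 < W) (s : Set ℝ)
    (hint : IntegrableOn (fun x : ℝ => Real.exp (c * x)) s) (k : ℂ)
    (hk : ∀ t : ℝ, k * ∫ x in s, Complex.exp (-(Complex.I * ((t:ℂ) + c * Complex.I - g)) * x) =
      1 / ((t:ℂ) + c * Complex.I - g)) :
    ∫ t : ℝ, Gt u W y (t + c * Complex.I) / ((t:ℂ) + c * Complex.I - g) = k * ∫ x in s, Gh u W y g x := by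
  have h1 : ∀ t : ℝ, Gt u W y (t + c * Complex.I) / ((t:ℂ) + c * Complex.I - g) =
     k * ∫ x in s, Gt u W y (t + c * Complex.I) * Complex.exp (-(Complex.I * ((t:ℂ) + c * Complex.I - g)) * x) := by
    intro t
    rw [integral_const_mul, div_eq_mul_one_div, ← hk t]; ring
  simp_rw [h1]
  rw [integral_const_mul, integral_integral_swap]
  · congr 1
    apply integral_congr_ae
    refine Eventually.of_forall fun x => ?_
    simp only
    have h2 : ∀ t : ℝ, Gt u W y (t + c * Complex.I) * Complex.exp (-(Complex.I * ((t:ℂ) + c * Complex.I - g)) * x)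
        = Complex.exp (Complex.I * g * x) * Gt u W (y - x) (t + c * Complex.I) := by
      intro t
      rw [← Gt_mul_exp, mul_left_comm, ← Complex.exp_add]
      congr 2
      ring
    simp_rw [h2]
    rw [integral_const_mul, Gt_integral _ _ _ hW]
    rfl
  · have := (Gt_integrable u y c hW).norm.mul_prod hint
    refine this.mono' ?_ ?_
    · apply Continuous.aestronglyMeasurable
      unfold Gt Function.uncurry
      fun_prop
    · refine Eventually.of_forall fun p => ?_
      rcases p with ⟨t, x⟩
      simp only [Function.uncurry, norm_mul, Complex.norm_exp]
      apply le_of_eq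
      congr 2
      simp

lemma cauchy_gauss (u y g : ℝ) {c W : ℝ} (hc : 0 < c) (hW : 0 < W) :
    (∫ t : ℝ, Gt u W y (t + (-c : ℝ) * Complex.I) / ((t:ℂ) + (-c : ℝ) * Complex.I - g))
     - (∫ t : ℝ, Gt u W y (t + c * Complex.I) / ((t:ℂ) + c * Complex.I - g))
     = 2 * π * Complex.I * Gt u W y g := by
  rw [cauchy_half u y g (-c) hW (Set.Ioi 0) _ Complex.I,
    cauchy_half u y g c hW (Set.Iic 0) _ (-Complex.I)]
  · have := integral_add_compl (measurableSet_Iic (a := (0:ℝ))) (Gh_integrable u y g hW)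
    rw [Gh_integral u y g hW, Set.compl_Iic] at this
    linear_combination Complex.I * this
  · intro t
    rw [integral_exp_mul_complex_Iic (by simp [hc])]
    have : (t:ℂ) + c * Complex.I - g ≠ 0 := by
      intro h; have := congrArg Complex.im h; simp at this; exact hc.ne' this
    generalize (t:ℂ) + c * Complex.I - g = w at *
    simp only [Complex.ofReal_zero, mul_zero, Complex.exp_zero]
    field_simp
  · exact integrableOn_exp_mul_Iic hc 0
  · intro t
    rw [integral_exp_mul_complex_Ioi (by simp [hc])]
    have : (t:ℂ) + (-c:ℝ) * Complex.I - g ≠ 0 := by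
      intro h; have := congrArg Complex.im h; simp at this; exact hc.ne' this
    generalize (t:ℂ) + (-c:ℝ) * Complex.I - g = w at *
    simp only [Complex.ofReal_zero, mul_zero, Complex.exp_zero]
    field_simp
  · exact integrableOn_exp_mul_Ioi (by linarith) 0

end

section

lemma extract_one (g : ℂ → ℂ) (hg : Differentiable ℂ g) (a : ℂ) (n : ℕ) (hn : analyticOrderAt g a = n) :
    ∃ h : ℂ → ℂ, Differentiable ℂ h ∧ h a ≠ 0 ∧ ∀ z, g z = (z - a) ^ n * h z := by
  obtain ⟨h, hh, hha, heq⟩ := (hg.analyticAt a).analyticOrderAt_eq_natCast.1 hn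
  have key : ∀ᶠ z in nhds a, Function.update (fun z => g z / (z - a) ^ n) a (h a) z = h z := by
    filter_upwards [heq] with z hz
    by_cases hza : z = a
    · subst hza; simp
    · rw [Function.update_of_ne hza, hz, smul_eq_mul, mul_div_cancel_left₀]
      exact pow_ne_zero _ (sub_ne_zero.2 hza)
  refine ⟨Function.update (fun z => g z / (z - a) ^ n) a (h a), ?_, by simpa using hha, ?_⟩
  · intro z
    by_cases hza : z = a
    · subst hza
      exact (hh.differentiableAt).congr_of_eventuallyEq key
    · have h1 : DifferentiableAt ℂ (fun z => g z / (z - a) ^ n) z := by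
        apply DifferentiableAt.div (hg z) (by fun_prop)
        exact pow_ne_zero _ (sub_ne_zero.2 hza)
      refine h1.congr_of_eventuallyEq ?_
      filter_upwards [isOpen_ne.mem_nhds hza] with w hw
      rw [Function.update_of_ne hw]
  · intro z
    by_cases hza : z = a
    · subst hza
      have := heq.self_of_nhds
      simpa using this
    · rw [Function.update_of_ne hza, mul_div_cancel₀]
      exact pow_ne_zero _ (sub_ne_zero.2 hza)

lemma extract_fin (f : ℂ → ℂ) (hf : Differentiable ℂ f) (hfin : ∀ a, analyticOrderAt f a ≠ ⊤)
    (s : Finset ℂ) : ∃ g : ℂ → ℂ, Differentiable ℂ g ∧ (∀ a ∈ s, g a ≠ 0) ∧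
      ∀ z, f z = (∏ a ∈ s, (z - a) ^ (analyticOrderNatAt f a)) * g z := by
  classical
  induction s using Finset.induction_on with
  | empty => exact ⟨f, hf, by simp, by simp⟩
  | insert a s ha ih =>
    obtain ⟨g, hg, hgs, hfg⟩ := ih
    have hord : analyticOrderAt g a = (analyticOrderNatAt f a : ℕ) := by
      rw [Nat.cast_analyticOrderNatAt (hfin a)]
      have hfe : f = (fun z => ∏ a ∈ s, (z - a) ^ (analyticOrderNatAt f a)) * g := by
        ext z; exact hfg z
      have hP : Differentiable ℂ (fun z => ∏ a ∈ s, (z - a) ^ (analyticOrderNatAt f a)) := by fun_prop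
      conv_rhs => rw [hfe]
      rw [analyticOrderAt_mul (hP.analyticAt a) (hg.analyticAt a)]
      rw [(hP.analyticAt a).analyticOrderAt_eq_zero.2, zero_add]
      refine Finset.prod_ne_zero_iff.2 fun b hb => pow_ne_zero _ (sub_ne_zero.2 ?_)
      rintro rfl; exact ha hb
    obtain ⟨h, hh, hha, hgh⟩ := extract_one g hg a _ hord
    refine ⟨h, hh, ?_, ?_⟩
    · intro b hb
      rcases Finset.mem_insert.1 hb with rfl | hb
      · exact hha
      · intro h0
        exact hgs b hb (by rw [hgh, h0, mul_zero])
    · intro z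
      rw [Finset.prod_insert ha, hfg z, hgh z]; ring

lemma logDeriv_extract (f g : ℂ → ℂ) (m : ℂ → ℕ) (hg : Differentiable ℂ g) (s : Finset ℂ)
    (h : ∀ z, f z = (∏ a ∈ s, (z - a) ^ (m a)) * g z) (z : ℂ) (hz : f z ≠ 0) :
    (∀ a ∈ s, m a ≠ 0 → z ≠ a) → z ∉ s →
    logDeriv f z = ∑ a ∈ s, (m a : ℂ) / (z - a) + logDeriv g z := by
  intro _ hzs
  have hfe : f = fun z => (∏ a ∈ s, (z - a) ^ (m a)) * g z := by ext z; exact h z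
  have hz2 := hz
  rw [h z] at hz2
  rw [hfe, logDeriv_mul z (left_ne_zero_of_mul hz2) (right_ne_zero_of_mul hz2) (by fun_prop) (hg z)]
  congr 1
  rw [logDeriv_prod]
  · refine Finset.sum_congr rfl fun a ha => ?_
    rw [logDeriv_fun_pow (by fun_prop)]
    simp only [logDeriv_apply]
    rw [deriv_sub_const, deriv_id'']
    ring
  · intro a ha
    exact pow_ne_zero _ (sub_ne_zero.2 (by rintro rfl; exact hzs ha))
  · intro a ha; fun_prop

lemma logDeriv_lip (g : ℂ → ℂ) (hg : Differentiable ℂ g) (z0 : ℂ) {R M : ℝ} (hR : 0 < R) (hM : 0 < M)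
    (hnz : ∀ z ∈ Metric.ball z0 (2 * R), g z ≠ 0)
    (hb : ∀ z ∈ Metric.ball z0 (2 * R), ‖g z‖ ≤ ‖g z0‖ * Real.exp M) :
    ∀ z ∈ Metric.ball z0 (R / 2), ∀ w ∈ Metric.ball z0 (R / 2),
      ‖logDeriv g z - logDeriv g w‖ ≤ 32 * M / R ^ 2 * ‖z - w‖ := by
  have hz0 : z0 ∈ Metric.ball z0 (2 * R) := Metric.mem_ball_self (by linarith)
  have hld : DifferentiableOn ℂ (logDeriv g) (Metric.ball z0 (2 * R)) := by
    have : DifferentiableOn ℂ (fun z => deriv g z / g z) (Metric.ball z0 (2 * R)) :=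
      hg.deriv.differentiableOn.div hg.differentiableOn hnz
    exact this
  obtain ⟨k, hk0, hk⟩ := hld.isExactOn_ball.with_val_at z0 0
  have hkd : DifferentiableOn ℂ k (Metric.ball z0 (2 * R)) := fun z hz => (hk z hz).differentiableAt.differentiableWithinAt
  -- g = g z0 * exp k
  have hgk : ∀ z ∈ Metric.ball z0 (2 * R), g z = g z0 * Complex.exp (k z) := by
    intro z hz
    have hconst : ∀ w ∈ Metric.ball z0 (2 * R), HasDerivAt (fun w => g w * Complex.exp (-k w)) 0 w := by
      intro w hw
      have h1 := (hg w).hasDerivAt.mul ((hk w hw).neg.cexp)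
      have hne := hnz w hw
      have h2 : deriv g w * Complex.exp ((-k) w) + g w * (Complex.exp ((-k) w) * -logDeriv g w) = 0 := by
        rw [logDeriv_apply]
        field_simp
        simp
      rw [h2] at h1
      exact h1
    have := (convex_ball z0 (2 * R)).is_const_of_fderivWithin_eq_zero (𝕜 := ℂ)
      (f := fun w => g w * Complex.exp (-k w))
      (fun w hw => (hconst w hw).differentiableAt.differentiableWithinAt) (fun w hw => by
        rw [fderivWithin_of_isOpen Metric.isOpen_ball hw]
        rw [(hconst w hw).hasFDerivAt.fderiv]
        ext; simp) hz hz0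
    simp only [hk0, neg_zero, Complex.exp_zero, mul_one, Complex.exp_neg] at this
    rw [← this]; field_simp
  have hre : ∀ z ∈ Metric.ball z0 (2 * R), (k z).re ≤ M := by
    intro z hz
    have h1 := hb z hz
    rw [hgk z hz, norm_mul, Complex.norm_exp] at h1
    have h2 : 0 < ‖g z0‖ := norm_pos_iff.2 (hnz z0 hz0)
    have h3 := le_of_mul_le_mul_left h1 h2
    exact Real.exp_le_exp.1 h3
  have hkb : ∀ z ∈ Metric.closedBall z0 R, ‖k z‖ ≤ 2 * M := by
    intro z hz
    have hz' : ‖z - z0‖ ≤ R := by simpa [dist_eq_norm] using hz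
    have h1 := Complex.borelCaratheodory_zero (f := fun w => k (z0 + w)) (R := 2 * R) (z := z - z0) hM
      (by
        refine hkd.comp (by fun_prop) ?_
        intro w hw
        simpa [dist_eq_norm] using hw)
      (by
        intro w hw
        exact hre _ (by simpa [dist_eq_norm] using hw))
      (by linarith) (by simpa [dist_eq_norm] using lt_of_le_of_lt hz' (by linarith)) (by simpa using hk0)
    simp only [add_sub_cancel] at h1
    refine h1.trans ?_
    rw [div_le_iff₀ (by linarith)]
    nlinarith
  have hsub : ∀ r : ℝ, r ≤ 2 * R → ∀ z ∈ Metric.ball z0 r, z ∈ Metric.ball z0 (2 * R) :=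
    fun r hr z hz => Metric.ball_subset_ball hr hz
  have hd1 : ∀ z ∈ Metric.closedBall z0 (3 * R / 4), ‖logDeriv g z‖ ≤ 8 * M / R := by
    intro z hz
    have hz' : z ∈ Metric.ball z0 (2 * R) := Metric.closedBall_subset_ball (by linarith) hz
    rw [← (hk z hz').deriv]
    have := Complex.norm_deriv_le_of_forall_mem_sphere_norm_le (f := k) (c := z) (R := R / 4) (C := 2 * M) (by linarith)
      (by
        apply DifferentiableOn.diffContOnCl
        refine hkd.mono ?_
        intro w hw
        have hw2 : w ∈ Metric.closedBall z (R / 4) := Metric.closure_ball_subset_closedBall hw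
        rw [Metric.mem_closedBall] at hw2 hz
        rw [Metric.mem_ball]
        linarith [dist_triangle w z z0])
      (by
        intro w hw
        apply hkb
        rw [Metric.mem_sphere] at hw
        rw [Metric.mem_closedBall] at hz ⊢
        linarith [dist_triangle w z z0])
    refine this.trans (le_of_eq ?_)
    field_simp
    norm_num
  intro z hz w hw
  refine (convex_ball z0 (R / 2)).norm_image_sub_le_of_norm_deriv_le (𝕜 := ℂ) (f := logDeriv g) (C := 32 * M / R ^ 2)
    ?_ ?_ hw hz
  · intro x hx
    exact hld.differentiableAt (Metric.isOpen_ball.mem_nhds (hsub _ (by linarith) x hx))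
  · intro x hx
    have := Complex.norm_deriv_le_of_forall_mem_sphere_norm_le (f := logDeriv g) (c := x) (R := R / 4) (C := 8 * M / R) (by linarith)
      (by
        apply DifferentiableOn.diffContOnCl
        refine hld.mono ?_
        intro w hw
        have hw2 : w ∈ Metric.closedBall x (R / 4) := Metric.closure_ball_subset_closedBall hw
        rw [Metric.mem_closedBall] at hw2
        rw [Metric.mem_ball] at hx ⊢
        linarith [dist_triangle w x z0])
      (by
        intro w hw
        apply hd1
        rw [Metric.mem_sphere] at hw
        rw [Metric.mem_ball] at hx
        rw [Metric.mem_closedBall]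
        linarith [dist_triangle w x z0])
    refine this.trans (le_of_eq ?_)
    field_simp
    norm_num

end

section

structure GoodF (f : ℂ → ℂ) : Prop where
  diff : Differentiable ℂ f
  even : ∀ z, f (-z) = f z
  rz : ∀ z, f z = 0 → z.im = 0
  growth : ∀ ε : ℝ, 0 < ε → ∀ᶠ R : ℝ in atTop, ∀ z : ℂ, ‖z‖ ≤ R → ‖f z‖ ≤ Real.exp (ε * R ^ 2)

abbrev Zt (f : ℂ → ℂ) := {γ : ℝ // f (γ : ℂ) = 0}

def zm (f : ℂ → ℂ) (γ : ℝ) : ℕ := analyticOrderNatAt f (γ : ℂ)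

lemma GoodF.ne_I {f : ℂ → ℂ} (h : GoodF f) : f Complex.I ≠ 0 := by
  intro h0
  have := h.rz _ h0
  simp at this

lemma GoodF.ord {f : ℂ → ℂ} (h : GoodF f) (a : ℂ) : analyticOrderAt f a ≠ ⊤ := by
  rw [Ne, AnalyticOnNhd.analyticOrderAt_eq_top_iff_eq_zero a (fun z => h.diff.analyticAt z)]
  intro h0
  exact h.ne_I (by simp [h0])

lemma GoodF.cod {f : ℂ → ℂ} (h : GoodF f) : f ⁻¹' {0}ᶜ ∈ codiscrete ℂ :=
  AnalyticOnNhd.preimage_zero_mem_codiscrete (fun z _ => h.diff.analyticAt z) h.ne_I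

lemma GoodF.fin {f : ℂ → ℂ} (h : GoodF f) (R : ℝ) : {γ : Zt f | |(γ : ℝ)| ≤ R}.Finite := by
  have hc : IsClosed (f ⁻¹' {0}) := by simpa using (mem_codiscrete'.mp h.cod).1
  have hd : IsDiscrete (f ⁻¹' {0}) := by simpa using (mem_codiscrete'.mp h.cod).2
  have h1 : (Metric.closedBall (0 : ℂ) R ∩ f ⁻¹' {0}).Finite := by
    apply ((isCompact_closedBall 0 R).inter_right hc).finite
    exact hd.mono Set.inter_subset_right
  have hinj : Function.Injective (fun γ : Zt f => ((γ : ℝ) : ℂ)) := by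
    intro a b hab
    exact Subtype.ext (by simpa using hab)
  refine (h1.preimage (hinj.injOn)).subset ?_
  intro γ hγ
  simp only [Set.mem_preimage, Set.mem_inter_iff, Metric.mem_closedBall, dist_zero_right,
    Complex.norm_real, Real.norm_eq_abs, Set.mem_singleton_iff]
  exact ⟨hγ, γ.2⟩

lemma GoodF.ctbl {f : ℂ → ℂ} (h : GoodF f) : Countable (Zt f) := by
  have : (Set.univ : Set (Zt f)) ⊆ ⋃ n : ℕ, {γ : Zt f | |(γ : ℝ)| ≤ n} := by
    intro γ _
    obtain ⟨n, hn⟩ := exists_nat_ge |(γ : ℝ)|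
    exact Set.mem_iUnion.2 ⟨n, hn⟩
  exact Set.countable_univ_iff.1 ((Set.countable_iUnion fun n : ℕ => (h.fin n).countable).mono this)

def ZF {f : ℂ → ℂ} (h : GoodF f) (R : ℝ) : Finset (Zt f) := (h.fin R).toFinset

lemma mem_ZF {f : ℂ → ℂ} (h : GoodF f) (R : ℝ) (γ : Zt f) : γ ∈ ZF h R ↔ |(γ : ℝ)| ≤ R := by
  simp [ZF]

lemma ZF_tendsto {f : ℂ → ℂ} (h : GoodF f) : Tendsto (ZF h) atTop atTop := by
  apply tendsto_atTop_finset_of_monotone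
  · intro a b hab γ hγ
    rw [mem_ZF] at *
    linarith
  · intro γ
    exact ⟨|(γ : ℝ)|, by simp [mem_ZF]⟩

def zneg {f : ℂ → ℂ} (h : GoodF f) : Zt f ≃ Zt f where
  toFun γ := ⟨-γ, by have := h.even (γ : ℝ); push_cast; rw [this]; exact γ.2⟩
  invFun γ := ⟨-γ, by have := h.even (γ : ℝ); push_cast; rw [this]; exact γ.2⟩
  left_inv γ := by ext; simp
  right_inv γ := by ext; simp

lemma zm_neg {f : ℂ → ℂ} (h : GoodF f) (γ : ℝ) : zm f (-γ) = zm f γ := by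
  unfold zm analyticOrderNatAt
  congr 1
  have h1 : f ∘ (fun z => -z) = f := by ext z; exact h.even z
  have := analyticOrderAt_comp_of_deriv_ne_zero (f := f) (g := fun z : ℂ => -z) (z₀ := (γ : ℂ))
    (by fun_prop) (by simp)
  rw [h1] at this
  rw [this]; simp

lemma sum_ZF_neg {f : ℂ → ℂ} (h : GoodF f) (R : ℝ) (F : ℝ → ℂ) :
    ∑ γ ∈ ZF h R, F (-γ) = ∑ γ ∈ ZF h R, F γ := by
  refine Finset.sum_equiv (zneg h) ?_ ?_
  · intro i; simp [mem_ZF, zneg]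
  · intro i _; simp [zneg]

lemma pf_lip {f : ℂ → ℂ} (h : GoodF f) {R M : ℝ} (hR : 1 ≤ R) (hM : 0 < M)
    (hb : ∀ z, ‖z‖ ≤ 8 * R + 1 → ‖f z‖ ≤ ‖f Complex.I‖ * Real.exp M)
    (z w : ℂ) (hz : z.im ≠ 0) (hw : w.im ≠ 0) (hzR : ‖z‖ + 1 < R / 2) (hwR : ‖w‖ + 1 < R / 2) :
    ‖(logDeriv f z - ∑ γ ∈ ZF h (3 * R), (zm f γ : ℂ) / (z - (γ : ℝ))) -
      (logDeriv f w - ∑ γ ∈ ZF h (3 * R), (zm f γ : ℂ) / (w - (γ : ℝ)))‖ ≤ 32 * M / R ^ 2 * ‖z - w‖ := by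
  classical
  have hinj : Function.Injective (fun γ : Zt f => ((γ : ℝ) : ℂ)) := by
    intro a b hab
    exact Subtype.ext (by simpa using hab)
  obtain ⟨g, hg, hgs, hfg⟩ := extract_fin f h.diff h.ord ((ZF h (3 * R)).image (fun γ : Zt f => ((γ : ℝ) : ℂ)))
  set s := (ZF h (3 * R)).image (fun γ : Zt f => ((γ : ℝ) : ℂ)) with hs
  have hsum : ∀ v : ℂ, ∑ a ∈ s, ((analyticOrderNatAt f a : ℕ) : ℂ) / (v - a)
      = ∑ γ ∈ ZF h (3 * R), (zm f γ : ℂ) / (v - (γ : ℝ)) := by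
    intro v
    rw [hs, Finset.sum_image (fun a _ b _ hab => hinj hab)]
    rfl
  have hE : ∀ v : ℂ, v.im ≠ 0 → logDeriv f v - ∑ γ ∈ ZF h (3 * R), (zm f γ : ℂ) / (v - (γ : ℝ)) = logDeriv g v := by
    intro v hv
    have hfv : f v ≠ 0 := fun h0 => hv (h.rz _ h0)
    have hvs : v ∉ s := by
      intro hvs
      rw [hs, Finset.mem_image] at hvs
      obtain ⟨a, _, ha⟩ := hvs
      apply hv; rw [← ha]; simp
    rw [logDeriv_extract f g (analyticOrderNatAt f) hg s hfg v hfv (fun a ha _ hva => hvs (hva ▸ ha)) hvs, hsum]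
    ring
  rw [hE z hz, hE w hw]
  have hnI : ∀ v : ℂ, ‖v‖ + 1 < R / 2 → v ∈ Metric.ball Complex.I (R / 2) := by
    intro v hv
    rw [Metric.mem_ball, dist_eq_norm]
    calc ‖v - Complex.I‖ ≤ ‖v‖ + ‖Complex.I‖ := norm_sub_le _ _
      _ < R / 2 := by simpa using hv
  refine logDeriv_lip g hg Complex.I (by linarith) hM ?_ ?_ z (hnI z hzR) w (hnI w hwR)
  · intro v hv hgv
    have hfv : f v = 0 := by rw [hfg, hgv, mul_zero]
    have him := h.rz v hfv
    have hvr : ((v.re : ℝ) : ℂ) = v := by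
      apply Complex.ext <;> simp [him]
    refine hgs v ?_ hgv
    rw [hs, Finset.mem_image]
    refine ⟨⟨v.re, by rw [hvr]; exact hfv⟩, ?_, hvr⟩
    rw [mem_ZF]
    have h1 : ‖v‖ ≤ ‖v - Complex.I‖ + ‖Complex.I‖ := by
      simpa using norm_add_le (v - Complex.I) Complex.I
    rw [Metric.mem_ball, dist_eq_norm] at hv
    have := Complex.abs_re_le_norm v
    simp at h1
    simp only
    linarith
  · intro v hv
    have hfr : ∀ v ∈ frontier (Metric.ball Complex.I (8 * R)), ‖g v‖ ≤ ‖g Complex.I‖ * Real.exp M := by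
      intro v hv
      rw [frontier_ball _ (by linarith), mem_sphere_iff_norm] at hv
      have hprod : ∏ a ∈ s, ‖(Complex.I - a) ^ analyticOrderNatAt f a‖ ≤ ∏ a ∈ s, ‖(v - a) ^ analyticOrderNatAt f a‖ := by
        refine Finset.prod_le_prod (fun a _ => norm_nonneg _) ?_
        intro a ha
        rw [norm_pow, norm_pow]
        refine pow_le_pow_left₀ (norm_nonneg _) ?_ _
        rw [hs, Finset.mem_image] at ha
        obtain ⟨b, hb1, rfl⟩ := ha
        rw [mem_ZF] at hb1
        have h2 : ‖Complex.I - ((b : ℝ) : ℂ)‖ ≤ 1 + 3 * R := by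
          refine (norm_sub_le _ _).trans ?_
          simp
          linarith
        have h3 : ‖v - Complex.I‖ ≤ ‖v - ((b : ℝ) : ℂ)‖ + ‖Complex.I - ((b : ℝ) : ℂ)‖ := by
          have := norm_sub_le (v - ((b : ℝ) : ℂ)) (Complex.I - ((b : ℝ) : ℂ))
          simpa using this
        linarith
      have hfI : ‖f Complex.I‖ = (∏ a ∈ s, ‖(Complex.I - a) ^ analyticOrderNatAt f a‖) * ‖g Complex.I‖ := by
        rw [hfg, norm_mul, norm_prod]
      have hfv : ‖f v‖ = (∏ a ∈ s, ‖(v - a) ^ analyticOrderNatAt f a‖) * ‖g v‖ := by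
        rw [hfg, norm_mul, norm_prod]
      have hpos : 0 < ∏ a ∈ s, ‖(Complex.I - a) ^ analyticOrderNatAt f a‖ := by
        have h0 : 0 < ‖f Complex.I‖ := norm_pos_iff.2 h.ne_I
        rw [hfI] at h0
        exact pos_of_mul_pos_left h0 (norm_nonneg _)
      have h4 : ‖v‖ ≤ 8 * R + 1 := by
        have : ‖v‖ ≤ ‖v - Complex.I‖ + ‖Complex.I‖ := by
          simpa using norm_add_le (v - Complex.I) Complex.I
        simp at this
        linarith
      have h5 := hb v h4
      rw [hfI, hfv] at h5
      have h6 := (mul_le_mul_of_nonneg_right hprod (norm_nonneg (g v))).trans h5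
      rw [mul_assoc] at h6
      exact le_of_mul_le_mul_left h6 hpos
    have hcl : v ∈ closure (Metric.ball Complex.I (8 * R)) := by
      apply subset_closure
      exact Metric.ball_subset_ball (by linarith) hv
    exact Complex.norm_le_of_forall_mem_frontier_norm_le Metric.isBounded_ball hg.diffContOnCl hfr hcl

lemma pf_tendsto {f : ℂ → ℂ} (h : GoodF f) (z : ℂ) (hz : z.im ≠ 0) :
    Tendsto (fun R : ℝ => ∑ γ ∈ ZF h R, (zm f γ : ℂ) / (z - (γ : ℝ))) atTop (nhds (logDeriv f z)) := by
  have hodd : logDeriv f (-z) = - logDeriv f z := by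
    have h1 : deriv f (-z) = - deriv f z := by
      have h2 : f = fun z => f (-z) := by ext z; exact (h.even z).symm
      have h3 : deriv (fun z => f (-z)) z = - deriv f (-z) := deriv_comp_neg f z
      rw [← h2] at h3
      rw [h3]; simp
    rw [logDeriv_apply, logDeriv_apply, h1, h.even, neg_div]
  have hsodd : ∀ R, ∑ γ ∈ ZF h R, (zm f γ : ℂ) / (-z - (γ : ℝ)) = - ∑ γ ∈ ZF h R, (zm f γ : ℂ) / (z - (γ : ℝ)) := by
    intro R
    rw [← sum_ZF_neg h R (fun γ => (zm f γ : ℂ) / (z - (γ : ℝ))), ← Finset.sum_neg_distrib]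
    refine Finset.sum_congr rfl fun γ _ => ?_
    rw [zm_neg h, ← div_neg]
    push_cast
    congr 1
    ring
  have hsmall : ∀ ε : ℝ, 0 < ε → ∀ᶠ R : ℝ in atTop,
      ‖logDeriv f z - ∑ γ ∈ ZF h (3 * R), (zm f γ : ℂ) / (z - (γ : ℝ))‖ ≤ ε * (64 * 101) * ‖z‖ := by
    intro ε hε
    have hgr := h.growth ε hε
    have ht : Tendsto (fun R : ℝ => 8 * R + 1) atTop atTop :=
      tendsto_atTop_add_const_right _ _ (Filter.tendsto_id.const_mul_atTop (by norm_num))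
    have hlog : ∀ᶠ R : ℝ in atTop, -Real.log ‖f Complex.I‖ ≤ ε * R ^ 2 := by
      have : Tendsto (fun R : ℝ => ε * R ^ 2) atTop atTop :=
        (tendsto_pow_atTop (by norm_num)).const_mul_atTop hε
      exact this.eventually_ge_atTop _
    filter_upwards [ht.eventually hgr, hlog, eventually_ge_atTop (1 : ℝ), eventually_gt_atTop (2 * (‖z‖ + 1))]
      with R h1 h2 h3 h4
    have h0 : 0 < ‖f Complex.I‖ := norm_pos_iff.2 h.ne_I
    have hb : ∀ z, ‖z‖ ≤ 8 * R + 1 → ‖f z‖ ≤ ‖f Complex.I‖ * Real.exp (ε * 101 * R ^ 2) := by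
      intro z hz
      refine (h1 z hz).trans ?_
      rw [← Real.exp_log h0, ← Real.exp_add]
      apply Real.exp_le_exp.2
      nlinarith [mul_nonneg hε.le (mul_nonneg (sub_nonneg.2 h3) (sub_nonneg.2 h3)), mul_nonneg hε.le (sub_nonneg.2 h3)]
    have := pf_lip h h3 (by positivity) hb z (-z) hz (by simpa using hz) (by linarith) (by rw [norm_neg]; linarith)
    rw [hodd, hsodd] at this
    have e1 : (logDeriv f z - ∑ γ ∈ ZF h (3 * R), (zm f γ : ℂ) / (z - (γ : ℝ))) -
      (-logDeriv f z - - ∑ γ ∈ ZF h (3 * R), (zm f γ : ℂ) / (z - (γ : ℝ))) =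
      2 * (logDeriv f z - ∑ γ ∈ ZF h (3 * R), (zm f γ : ℂ) / (z - (γ : ℝ))) := by ring
    have e2 : ‖z - -z‖ = 2 * ‖z‖ := by
      rw [sub_neg_eq_add, ← two_mul, norm_mul]; simp
    rw [e1, norm_mul, e2] at this
    have e3 : 32 * (ε * 101 * R ^ 2) / R ^ 2 = 32 * (ε * 101) := by
      field_simp
    rw [e3] at this
    simp only [Complex.norm_ofNat] at this
    nlinarith [norm_nonneg z, hε]
  rw [Metric.tendsto_nhds]
  intro ε hε
  have := hsmall (ε / (2 * (64 * 101) * (‖z‖ + 1))) (by positivity)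
  have ht : Tendsto (fun R : ℝ => R / 3) atTop atTop := Filter.tendsto_id.atTop_div_const (by norm_num)
  filter_upwards [ht.eventually this] with R hR
  rw [dist_comm, dist_eq_norm]
  rw [show 3 * (R / 3) = R by ring] at hR
  refine lt_of_le_of_lt hR ?_
  rw [div_mul_eq_mul_div, div_mul_eq_mul_div, div_lt_iff₀ (by positivity)]
  nlinarith [norm_nonneg z]

lemma GoodF.summ {f : ℂ → ℂ} (h : GoodF f) : Summable (fun γ : Zt f => (zm f γ : ℝ) / (1 + (γ : ℝ) ^ 2)) := by
  have h1 := pf_tendsto h Complex.I (by simp)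
  have h2 : Tendsto (fun R : ℝ => ∑ γ ∈ ZF h R, (zm f γ : ℝ) / (1 + (γ : ℝ) ^ 2)) atTop
      (nhds (-(logDeriv f Complex.I).im)) := by
    have := ((Complex.continuous_im.tendsto _).comp h1).neg
    refine this.congr fun R => ?_
    simp only [Function.comp, Complex.im_sum]
    rw [← Finset.sum_neg_distrib]
    refine Finset.sum_congr rfl fun γ _ => ?_
    have : ((zm f γ : ℂ) / (Complex.I - ((γ : ℝ) : ℂ))).im = (zm f γ : ℝ) * ((Complex.I - ((γ : ℝ) : ℂ))⁻¹).im := by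
      rw [div_eq_mul_inv, ← Complex.ofReal_natCast, Complex.im_ofReal_mul]
    rw [this, Complex.inv_im, Complex.normSq_apply]
    simp
    ring
  refine summable_of_sum_le (c := -(logDeriv f Complex.I).im) (fun γ => by positivity) ?_
  intro u
  refine ge_of_tendsto h2 ?_
  filter_upwards [(ZF_tendsto h).eventually_ge_atTop u] with R hR
  exact Finset.sum_le_sum_of_subset_of_nonneg hR (fun γ _ _ => by positivity)

lemma pf_bound (x c g : ℝ) (hc : c ≠ 0) :
    ‖((x : ℂ) + c * Complex.I) / (((x : ℂ) + c * Complex.I) ^ 2 - (g : ℂ) ^ 2)‖ ≤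
      2 * (1 + 1 / c ^ 2) * (1 + |c|) * (1 + x ^ 2) ^ 2 / (1 + g ^ 2) := by
  have key : ∀ a : ℝ, 1 + a ^ 2 ≤ 2 * (1 + 1 / c ^ 2) * (1 + x ^ 2) * ‖((x : ℂ) + c * Complex.I) - (a : ℂ)‖ ^ 2 := by
    intro a
    have e : ‖((x : ℂ) + c * Complex.I) - (a : ℂ)‖ ^ 2 = (x - a) ^ 2 + c ^ 2 := by
      rw [← Complex.normSq_eq_norm_sq, Complex.normSq_apply]
      simp
      ring
    rw [e]
    have hc2 : 0 < c ^ 2 := by positivity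
    have h1 : 1 + (x - a) ^ 2 ≤ (1 + 1 / c ^ 2) * ((x - a) ^ 2 + c ^ 2) := by
      have : (1 + 1 / c ^ 2) * ((x - a) ^ 2 + c ^ 2) = 1 + (x - a) ^ 2 + ((x - a) ^ 2 / c ^ 2 + c ^ 2) := by
        field_simp; ring
      rw [this]
      have : 0 ≤ (x - a) ^ 2 / c ^ 2 + c ^ 2 := by positivity
      linarith
    have h2 : 1 + a ^ 2 ≤ 2 * (1 + x ^ 2) * (1 + (x - a) ^ 2) := by
      nlinarith [sq_nonneg (x + (a - x)), sq_nonneg (x - (a - x)), sq_nonneg (x * (x - a)), sq_nonneg (2 * x - a)]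
    calc 1 + a ^ 2 ≤ 2 * (1 + x ^ 2) * (1 + (x - a) ^ 2) := h2
      _ ≤ 2 * (1 + x ^ 2) * ((1 + 1 / c ^ 2) * ((x - a) ^ 2 + c ^ 2)) := by gcongr
      _ = _ := by ring
  set z : ℂ := (x : ℂ) + c * Complex.I with hz
  have e2 : z ^ 2 - (g : ℂ) ^ 2 = (z - (g : ℂ)) * (z - ((-g : ℝ) : ℂ)) := by push_cast; ring
  have k1 := key g
  have k2 := key (-g)
  rw [neg_sq] at k2
  set K := 2 * (1 + 1 / c ^ 2) * (1 + x ^ 2) with hK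
  have hKpos : 0 < K := by positivity
  have hzn : ‖z‖ ≤ (1 + |c|) * (1 + x ^ 2) := by
    have h1 : ‖z‖ ≤ |x| + |c| := by
      refine (norm_add_le _ _).trans ?_
      simp
    nlinarith [abs_nonneg c, abs_nonneg x, sq_abs x, sq_nonneg (|x| - 1), mul_nonneg (abs_nonneg c) (sq_nonneg x)]
  rw [e2, norm_div, norm_mul]
  set p := ‖z - (g : ℂ)‖ with hp
  set q := ‖z - ((-g : ℝ) : ℂ)‖ with hq
  have hp0 : 0 ≤ p := norm_nonneg _
  have hq0 : 0 ≤ q := norm_nonneg _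
  have hg : 0 < 1 + g ^ 2 := by positivity
  have hpq : 1 + g ^ 2 ≤ K * (p * q) := by
    refine (pow_le_pow_iff_left₀ (by positivity) (by positivity) two_ne_zero).1 ?_
    calc (1 + g ^ 2) ^ 2 = (1 + g ^ 2) * (1 + g ^ 2) := by ring
      _ ≤ (K * p ^ 2) * (K * q ^ 2) := by gcongr
      _ = _ := by ring
  have hpqpos : 0 < p * q := by
    by_contra hcon
    have : p * q = 0 := le_antisymm (not_lt.1 hcon) (by positivity)
    rw [this] at hpq
    linarith
  rw [div_le_div_iff₀ hpqpos hg]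
  calc ‖z‖ * (1 + g ^ 2) ≤ ((1 + |c|) * (1 + x ^ 2)) * (K * (p * q)) := by gcongr
    _ = _ := by rw [hK]; ring

lemma pf_hasSum {f : ℂ → ℂ} (h : GoodF f) (z : ℂ) (hz : z.im ≠ 0) :
    HasSum (fun γ : Zt f => (zm f γ : ℂ) * (z / (z ^ 2 - ((γ : ℝ) : ℂ) ^ 2))) (logDeriv f z) := by
  have hs : Summable (fun γ : Zt f => (zm f γ : ℂ) * (z / (z ^ 2 - ((γ : ℝ) : ℂ) ^ 2))) := by
    refine Summable.of_norm_bounded (h.summ.mul_left (2 * (1 + 1 / z.im ^ 2) * (1 + |z.im|) * (1 + z.re ^ 2) ^ 2)) ?_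
    intro γ
    have := pf_bound z.re z.im γ hz
    rw [Complex.re_add_im] at this
    rw [norm_mul, Complex.norm_natCast]
    calc _ ≤ (zm f γ : ℝ) * (2 * (1 + 1 / z.im ^ 2) * (1 + |z.im|) * (1 + z.re ^ 2) ^ 2 / (1 + (γ : ℝ) ^ 2)) := by gcongr
      _ = _ := by ring
  have h1 := hs.hasSum.comp (ZF_tendsto h)
  have h2 := pf_tendsto h z hz
  have h3 : ∀ R, ∑ γ ∈ ZF h R, (zm f γ : ℂ) / (z - (γ : ℝ)) = ∑ γ ∈ ZF h R, (zm f γ : ℂ) * (z / (z ^ 2 - ((γ : ℝ) : ℂ) ^ 2)) := by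
    intro R
    have e1 := sum_ZF_neg h R (fun γ => (zm f γ : ℂ) / (z - (γ : ℝ)))
    have e2 : ∑ γ ∈ ZF h R, (zm f γ : ℂ) / (z - (γ : ℝ)) = (∑ γ ∈ ZF h R, (zm f γ : ℂ) / (z - (γ : ℝ)) + ∑ γ ∈ ZF h R, (zm f (-γ) : ℂ) / (z - ((-γ : ℝ)))) / 2 := by
      rw [e1]; ring
    rw [e2, ← Finset.sum_add_distrib, Finset.sum_div]
    refine Finset.sum_congr rfl fun γ _ => ?_
    rw [zm_neg h]
    have n1 : z - ((γ : ℝ) : ℂ) ≠ 0 := by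
      intro h0; apply hz
      rw [sub_eq_zero.1 h0]; simp
    have n2 : z + ((γ : ℝ) : ℂ) ≠ 0 := by
      intro h0; apply hz
      rw [eq_neg_of_add_eq_zero_left h0]; simp
    have e3 : z ^ 2 - ((γ : ℝ) : ℂ) ^ 2 = (z - ((γ : ℝ) : ℂ)) * (z + ((γ : ℝ) : ℂ)) := by ring
    rw [e3]
    push_cast
    rw [sub_neg_eq_add]
    field_simp
    ring
  rw [tendsto_nhds_unique h2 (h1.congr fun R => (h3 R).symm)]
  exact hs.hasSum

end

section

lemma gauss_poly1 (u : ℝ) {W : ℝ} (hW : 0 < W) (t : ℝ) :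
    (1 + t ^ 2) ≤ (1 + 2 * u ^ 2 + 16 * W ^ 2) * Real.exp ((t - u) ^ 2 / (8 * W ^ 2)) := by
  have h1 : 1 + t ^ 2 ≤ (1 + 2 * u ^ 2) + 16 * W ^ 2 * ((t - u) ^ 2 / (8 * W ^ 2)) := by
    have : 16 * W ^ 2 * ((t - u) ^ 2 / (8 * W ^ 2)) = 2 * (t - u) ^ 2 := by field_simp; ring
    rw [this]; nlinarith [sq_nonneg (t - 2 * u)]
  have h2 := Real.add_one_le_exp ((t - u) ^ 2 / (8 * W ^ 2))
  have h3 : 0 ≤ (t - u) ^ 2 / (8 * W ^ 2) := by positivity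
  nlinarith [sq_nonneg u, sq_nonneg W]

lemma gauss_poly (u : ℝ) {W : ℝ} (hW : 0 < W) (t : ℝ) :
    (1 + t ^ 2) ^ 2 * Real.exp (-(t - u) ^ 2 / (2 * W ^ 2)) ≤
      (1 + 2 * u ^ 2 + 16 * W ^ 2) ^ 2 * Real.exp (-(t - u) ^ 2 / (2 * (√2 * W) ^ 2)) := by
  have h1 := gauss_poly1 u hW t
  have h2 : (1 + t ^ 2) ^ 2 ≤ ((1 + 2 * u ^ 2 + 16 * W ^ 2) * Real.exp ((t - u) ^ 2 / (8 * W ^ 2))) ^ 2 := by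
    gcongr
  have h3 : (√2 * W) ^ 2 = 2 * W ^ 2 := by rw [mul_pow, Real.sq_sqrt (by norm_num)]
  calc _ ≤ ((1 + 2 * u ^ 2 + 16 * W ^ 2) * Real.exp ((t - u) ^ 2 / (8 * W ^ 2))) ^ 2 * Real.exp (-(t - u) ^ 2 / (2 * W ^ 2)) := by
        gcongr
    _ = _ := by
      rw [mul_pow, mul_assoc, ← Real.exp_nat_mul, ← Real.exp_add, h3]
      congr 2
      push_cast
      field_simp
      ring

lemma gauss_poly_int (u : ℝ) {W : ℝ} (hW : 0 < W) :
    Integrable (fun t : ℝ => (1 + t ^ 2) ^ 2 * Real.exp (-(t - u) ^ 2 / (2 * W ^ 2))) := by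
  refine ((gauss_integrable u (W := √2 * W) (by positivity)).const_mul ((1 + 2 * u ^ 2 + 16 * W ^ 2) ^ 2)).mono' ?_ ?_
  · exact Continuous.aestronglyMeasurable (by fun_prop)
  · refine Eventually.of_forall fun t => ?_
    rw [Real.norm_of_nonneg (by positivity)]
    exact gauss_poly u hW t

lemma Gt_cont (u W y : ℝ) : Continuous (Gt u W y) := by
  unfold Gt; fun_prop

lemma Gt_real_norm (u W y γ : ℝ) : ‖Gt u W y γ‖ = Real.exp (-(γ - u) ^ 2 / (2 * W ^ 2)) := by
  have := Gt_norm u W y γ 0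
  simpa using this

lemma gauss_le (u : ℝ) {W : ℝ} (hW : 0 < W) (γ : ℝ) : Real.exp (-(γ - u) ^ 2 / (2 * W ^ 2)) ≤
    (1 + 2 * u ^ 2 + 16 * W ^ 2) * (1 / (1 + γ ^ 2)) := by
  rw [mul_one_div, le_div_iff₀ (by positivity)]
  have h1 := gauss_poly1 u hW γ
  calc _ ≤ Real.exp (-(γ - u) ^ 2 / (2 * W ^ 2)) * ((1 + 2 * u ^ 2 + 16 * W ^ 2) * Real.exp ((γ - u) ^ 2 / (8 * W ^ 2))) := by gcongr
    _ = (1 + 2 * u ^ 2 + 16 * W ^ 2) * Real.exp (-(3 * (γ - u) ^ 2 / (8 * W ^ 2))) := by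
      rw [mul_left_comm, ← Real.exp_add]; congr 2; field_simp; ring
    _ ≤ (1 + 2 * u ^ 2 + 16 * W ^ 2) * 1 := by
      gcongr
      apply Real.exp_le_one_iff.2
      have : 0 ≤ 3 * (γ - u) ^ 2 / (8 * W ^ 2) := by positivity
      linarith
    _ = _ := by ring

lemma K_summable {f : ℂ → ℂ} (h : GoodF f) (u : ℝ) {W : ℝ} (hW : 0 < W) :
    Summable (fun γ : Zt f => (zm f γ : ℝ) * Real.exp (-((γ : ℝ) - u) ^ 2 / (2 * W ^ 2))) := by
  refine Summable.of_nonneg_of_le (fun γ => by positivity) (fun γ => ?_) (h.summ.mul_left (1 + 2 * u ^ 2 + 16 * W ^ 2))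
  calc _ ≤ (zm f γ : ℝ) * ((1 + 2 * u ^ 2 + 16 * W ^ 2) * (1 / (1 + (γ : ℝ) ^ 2))) := by
        gcongr; exact gauss_le u hW γ
    _ = _ := by ring

lemma Gt_summable {f : ℂ → ℂ} (h : GoodF f) (u y : ℝ) {W : ℝ} (hW : 0 < W) :
    Summable (fun γ : Zt f => (zm f γ : ℂ) * Gt u W y (γ : ℝ)) := by
  refine Summable.of_norm_bounded (K_summable h u hW) fun γ => ?_
  rw [norm_mul, Gt_real_norm, Complex.norm_natCast]

/-- the test function on the line -/
def wl (c t : ℝ) : ℂ := (t : ℂ) + (-c : ℝ) * Complex.I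

def Hl (u W y c t : ℝ) : ℂ := Gt u W y (wl c t) + Gt u W y (-(wl c t))

lemma wl_neg (c t : ℝ) : -(wl c t) = ((-t : ℝ) : ℂ) + (c : ℝ) * Complex.I := by
  unfold wl; push_cast; ring

lemma wl_im (c t : ℝ) : (wl c t).im = -c := by simp [wl]

lemma wl_cont (c : ℝ) : Continuous (wl c) := by unfold wl; fun_prop

lemma Gt_wl_norm (u W y c t : ℝ) : ‖Gt u W y (wl c t)‖ =
    Real.exp (-(t - u) ^ 2 / (2 * W ^ 2)) * Real.exp (c ^ 2 / (2 * W ^ 2)) * Real.exp (y * c) := by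
  unfold wl; rw [Gt_norm]; simp

lemma Gt_wl_neg_norm (u W y c t : ℝ) : ‖Gt u W y (-(wl c t))‖ =
    Real.exp (-(t + u) ^ 2 / (2 * W ^ 2)) * Real.exp (c ^ 2 / (2 * W ^ 2)) * Real.exp (-(y * c)) := by
  rw [wl_neg, Gt_norm]
  congr 4
  ring

lemma Gt_wl_int (u y c : ℝ) {W : ℝ} (hW : 0 < W) : Integrable (fun t => Gt u W y (wl c t)) :=
  Gt_integrable u y (-c) hW

lemma Gt_wl_neg_int (u y c : ℝ) {W : ℝ} (hW : 0 < W) : Integrable (fun t => Gt u W y (-(wl c t))) := by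
  simp_rw [wl_neg]
  exact (Gt_integrable u y c hW).comp_neg

lemma Hl_poly_int (u y c : ℝ) {W : ℝ} (hW : 0 < W) :
    Integrable (fun t : ℝ => (1 + t ^ 2) ^ 2 * ‖Hl u W y c t‖) := by
  have h1 := (gauss_poly_int u hW).mul_const (Real.exp (c ^ 2 / (2 * W ^ 2)) * Real.exp (y * c))
  have h2 := (gauss_poly_int (-u) hW).mul_const (Real.exp (c ^ 2 / (2 * W ^ 2)) * Real.exp (-(y * c)))
  refine (h1.add h2).mono' ?_ ?_
  · have := Gt_cont u W y
    have := wl_cont c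
    refine Continuous.aestronglyMeasurable ?_
    unfold Hl
    fun_prop
  · refine Eventually.of_forall fun t => ?_
    rw [Real.norm_of_nonneg (by positivity)]
    have : ‖Hl u W y c t‖ ≤ ‖Gt u W y (wl c t)‖ + ‖Gt u W y (-(wl c t))‖ := norm_add_le _ _
    rw [Gt_wl_norm, Gt_wl_neg_norm] at this
    calc _ ≤ (1 + t ^ 2) ^ 2 * (Real.exp (-(t - u) ^ 2 / (2 * W ^ 2)) * Real.exp (c ^ 2 / (2 * W ^ 2)) * Real.exp (y * c) + Real.exp (-(t + u) ^ 2 / (2 * W ^ 2)) * Real.exp (c ^ 2 / (2 * W ^ 2)) * Real.exp (-(y * c))) := by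
          gcongr
      _ = _ := by
        simp only [Pi.add_apply, sub_neg_eq_add]; ring

lemma wl_sub_ne (c t g : ℝ) (hc : 0 < c) : wl c t - (g : ℂ) ≠ 0 := by
  intro h0
  have := congrArg Complex.im h0
  simp [wl] at this
  linarith

lemma wl_sub_norm (c t g : ℝ) (hc : 0 < c) : c ≤ ‖wl c t - (g : ℂ)‖ := by
  have := Complex.abs_im_le_norm (wl c t - (g : ℂ))
  simp [wl_im] at this
  rwa [abs_of_pos hc] at this

lemma div_int (c g : ℝ) (hc : 0 < c) (F : ℝ → ℂ) (hF : Integrable F) :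
    Integrable (fun t => F t / (wl c t - (g : ℂ))) := by
  simp_rw [div_eq_mul_inv]
  refine hF.mul_bdd (c := c⁻¹) ?_ ?_
  · refine Continuous.aestronglyMeasurable ?_
    have := wl_cont c
    exact Continuous.inv₀ (by fun_prop) (fun t => wl_sub_ne c t g hc)
  · refine Eventually.of_forall fun t => ?_
    rw [norm_inv]
    exact inv_anti₀ hc (wl_sub_norm c t g hc)

lemma P_int (u y g : ℝ) {c W : ℝ} (hc : 0 < c) (hW : 0 < W) :
    (∫ t : ℝ, (Gt u W y (wl c t) / (wl c t - (g : ℂ)) + Gt u W y (-(wl c t)) / (wl c t - ((-g : ℝ) : ℂ))))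
      = 2 * π * Complex.I * Gt u W y g := by
  rw [integral_add (div_int c g hc _ (Gt_wl_int u y c hW)) (div_int c (-g) hc _ (Gt_wl_neg_int u y c hW))]
  rw [← cauchy_gauss u y g hc hW, sub_eq_add_neg]
  congr 1
  rw [← integral_neg_eq_self, ← integral_neg]
  refine integral_congr_ae (Eventually.of_forall fun t => ?_)
  have hw := wl_neg c t
  simp only
  rw [← div_neg]
  congr 1
  · rw [← neg_neg (wl c (-t)), wl_neg]
    simp
  · simp [wl]
    ring

lemma explicit_gen {f : ℂ → ℂ} (h : GoodF f) (u y : ℝ) {c W : ℝ} (hc : 0 < c) (hW : 0 < W) :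
    ∫ t : ℝ, Hl u W y c t * logDeriv f (wl c t) =
      2 * π * Complex.I * ∑' γ : Zt f, (zm f γ : ℂ) * Gt u W y (γ : ℝ) := by
  have hctbl := h.ctbl
  set F : Zt f → ℝ → ℂ := fun γ t => (zm f γ : ℂ) * (Hl u W y c t * (wl c t / ((wl c t) ^ 2 - ((γ : ℝ) : ℂ) ^ 2))) with hF
  have hfac : ∀ (t g : ℝ), (wl c t) ^ 2 - (g : ℂ) ^ 2 = (wl c t - (g : ℂ)) * (wl c t - ((-g : ℝ) : ℂ)) := by
    intro t g; push_cast; ring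
  have hFdec : ∀ γ t, F γ t = (zm f γ : ℂ) / 2 * ((Gt u W y (wl c t) / (wl c t - ((γ : ℝ) : ℂ)) + Gt u W y (-(wl c t)) / (wl c t - ((-(γ : ℝ) : ℝ) : ℂ))) + (Gt u W y (wl c t) / (wl c t - ((-(γ : ℝ) : ℝ) : ℂ)) + Gt u W y (-(wl c t)) / (wl c t - ((- -(γ : ℝ) : ℝ) : ℂ)))) := by
    intro γ t
    have n1 := wl_sub_ne c t γ hc
    have n2 := wl_sub_ne c t (-γ) hc
    simp only [hF, Hl, hfac, neg_neg]
    have e : wl c t = ((wl c t - ((γ : ℝ) : ℂ)) + (wl c t - ((-(γ : ℝ) : ℝ) : ℂ))) / 2 := by push_cast; ring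
    have e2 : wl c t / ((wl c t - ((γ : ℝ) : ℂ)) * (wl c t - ((-(γ : ℝ) : ℝ) : ℂ))) = (1 / (wl c t - ((-(γ : ℝ) : ℝ) : ℂ)) + 1 / (wl c t - ((γ : ℝ) : ℂ))) / 2 := by
      rw [div_add_div _ _ n2 n1, div_div, div_eq_div_iff (mul_ne_zero n1 n2) (mul_ne_zero (mul_ne_zero n2 n1) two_ne_zero)]
      push_cast
      ring
    rw [e2]
    ring
  have hPi : ∀ g : ℝ, Integrable (fun t : ℝ => (Gt u W y (wl c t) / (wl c t - (g : ℂ)) + Gt u W y (-(wl c t)) / (wl c t - ((-g : ℝ) : ℂ)))) :=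
    fun g => (div_int c g hc _ (Gt_wl_int u y c hW)).add (div_int c (-g) hc _ (Gt_wl_neg_int u y c hW))
  have hFint : ∀ γ, Integrable (F γ) := by
    intro γ
    have : F γ = _ := funext (hFdec γ)
    rw [this]
    exact ((hPi γ).add (hPi (-γ))).const_mul _
  have hFval : ∀ γ, ∫ t, F γ t = π * Complex.I * ((zm f γ : ℂ) * Gt u W y (γ : ℝ)) + π * Complex.I * ((zm f (-γ) : ℂ) * Gt u W y ((-γ : ℝ) : ℂ)) := by
    intro γ
    rw [integral_congr_ae (Eventually.of_forall (hFdec γ)), integral_const_mul, integral_add (hPi γ) (hPi (-γ)), P_int u y γ hc hW, P_int u y (-γ) hc hW, zm_neg h]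
    ring
  set K := 2 * (1 + 1 / c ^ 2) * (1 + |c|) with hK
  have hFb : ∀ γ t, ‖F γ t‖ ≤ K * (zm f γ / (1 + (γ : ℝ) ^ 2)) * ((1 + t ^ 2) ^ 2 * ‖Hl u W y c t‖) := by
    intro γ t
    have := pf_bound t (-c) γ (by linarith)
    rw [neg_sq, abs_neg] at this
    have e : wl c t = (t : ℂ) + ((-c : ℝ) : ℂ) * Complex.I := rfl
    simp only [hF]
    rw [norm_mul, norm_mul, Complex.norm_natCast, e]
    rw [← hK] at this
    calc _ ≤ (zm f γ : ℝ) * (‖Hl u W y c t‖ * (K * (1 + t ^ 2) ^ 2 / (1 + (γ : ℝ) ^ 2))) := by gcongr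
      _ = _ := by ring
  have hsum : Summable (fun γ => ∫ t, ‖F γ t‖) := by
    refine Summable.of_nonneg_of_le (fun γ => integral_nonneg fun t => norm_nonneg _) (fun γ => ?_) ((h.summ.mul_left K).mul_right (∫ t, (1 + t ^ 2) ^ 2 * ‖Hl u W y c t‖))
    rw [← integral_const_mul]
    exact integral_mono (hFint γ).norm ((Hl_poly_int u y c hW).const_mul _) (hFb γ)
  have key := hasSum_integral_of_summable_integral_norm hFint hsum
  have h1 : ∀ t, ∑' γ, F γ t = Hl u W y c t * logDeriv f (wl c t) := by
    intro t
    have := (pf_hasSum h (wl c t) (by rw [wl_im]; linarith)).mul_left (Hl u W y c t)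
    rw [← this.tsum_eq]
    refine tsum_congr fun γ => ?_
    simp only [hF]; ring
  simp_rw [h1, hFval] at key
  have hs := Gt_summable h u y hW
  have h2 : HasSum (fun γ : Zt f => π * Complex.I * ((zm f γ : ℂ) * Gt u W y (γ : ℝ)) + π * Complex.I * ((zm f (-γ) : ℂ) * Gt u W y ((-γ : ℝ) : ℂ)))
      (π * Complex.I * (∑' γ : Zt f, (zm f γ : ℂ) * Gt u W y (γ : ℝ)) + π * Complex.I * ∑' γ : Zt f, (zm f γ : ℂ) * Gt u W y (γ : ℝ)) := by
    refine (hs.hasSum.mul_left _).add (HasSum.mul_left _ ?_)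
    exact (zneg h).hasSum_iff.2 hs.hasSum
  rw [key.unique h2]
  ring

end

section

def xi (s : ℂ) : ℂ := 1 + s * (s - 1) * completedRiemannZeta₀ s
def Xi (z : ℂ) : ℂ := xi (1 / 2 + Complex.I * z)

lemma xi_diff : Differentiable ℂ xi := by
  have := differentiable_completedZeta₀
  unfold xi; fun_prop

lemma xi_one_sub (s : ℂ) : xi (1 - s) = xi s := by
  unfold xi; rw [completedRiemannZeta₀_one_sub]; ring

lemma xi_eq {s : ℂ} (h0 : s ≠ 0) (h1 : s ≠ 1) : xi s = s * (s - 1) * completedRiemannZeta s := by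
  have h2 : 1 - s ≠ 0 := sub_ne_zero.2 h1.symm
  rw [completedRiemannZeta_eq, xi]
  field_simp
  ring

lemma xi_eq_zeta {s : ℂ} (h0 : 0 < s.re) (h1 : s ≠ 1) : xi s = s * (s - 1) * Complex.Gammaℝ s * riemannZeta s := by
  have hs : s ≠ 0 := by rintro rfl; simp at h0
  have hG := Complex.Gammaℝ_ne_zero_of_re_pos h0
  rw [xi_eq hs h1, riemannZeta_def_of_ne_zero hs]
  field_simp

lemma xi_zero_re (hRH : RiemannHypothesis) {s : ℂ} (h : xi s = 0) : s.re = 1 / 2 := by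
  have h0 : s ≠ 0 := by rintro rfl; simp [xi] at h
  have h1 : s ≠ 1 := by rintro rfl; simp [xi] at h
  have hL : completedRiemannZeta s = 0 := by
    rw [xi_eq h0 h1] at h
    have : s * (s - 1) ≠ 0 := mul_ne_zero h0 (sub_ne_zero.2 h1)
    exact (mul_eq_zero.1 h).resolve_left this
  refine hRH s ?_ ?_ h1
  · rw [riemannZeta_def_of_ne_zero h0, hL, zero_div]
  · rintro ⟨n, rfl⟩
    have hre : 1 ≤ (1 - (-2 * ((n : ℂ) + 1))).re := by
      simp
      positivity
    have hne : (1 - (-2 * ((n : ℂ) + 1))) ≠ 0 := by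
      intro h; rw [h] at hre; simp at hre; linarith
    have := riemannZeta_ne_zero_of_one_le_re hre
    apply this
    rw [riemannZeta_def_of_ne_zero hne, completedRiemannZeta_one_sub, hL, zero_div]

lemma norm_cGamma_le {w : ℂ} (hw : 0 < w.re) : ‖Complex.Gamma w‖ ≤ Real.Gamma w.re := by
  rw [Complex.Gamma_eq_integral hw, Real.Gamma_eq_integral hw, Complex.GammaIntegral]
  refine (norm_integral_le_integral_norm _).trans (le_of_eq ?_)
  refine setIntegral_congr_fun measurableSet_Ioi fun x hx => ?_
  have hx' : (0 : ℝ) < x := hx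
  rw [norm_mul, Complex.norm_cpow_eq_rpow_re_of_pos hx']
  simp [Complex.norm_exp]

lemma zeta_bound : ∃ C : ℝ, ∀ s : ℂ, 2 ≤ s.re → ‖riemannZeta s‖ ≤ C := by
  refine ⟨∑' n : ℕ, 1 / (n : ℝ) ^ (2 : ℝ), fun s hs => ?_⟩
  rw [zeta_eq_tsum_one_div_nat_cpow (by linarith)]
  have hsum : Summable (fun n : ℕ => 1 / (n : ℝ) ^ (2 : ℝ)) := Real.summable_one_div_nat_rpow.2 (by norm_num)
  refine tsum_of_norm_bounded hsum.hasSum fun n => ?_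
  rcases Nat.eq_zero_or_pos n with rfl | hn
  · have : s ≠ 0 := by rintro rfl; simp at hs; linarith
    simp [this]
  · rw [norm_div, Complex.norm_natCast_cpow_of_pos hn, norm_one]
    have : (1 : ℝ) ≤ n := by exact_mod_cast hn
    gcongr

lemma Lambda0_bound : ∃ C : ℝ, ∀ s : ℂ, 0 ≤ s.re → s.re ≤ 4 → ‖completedRiemannZeta₀ s‖ ≤ C := by
  set P := HurwitzZeta.hurwitzEvenFEPair 0 with hP
  have hconv : ∀ s : ℂ, MellinConvergent P.f_modif s := fun s => (P.isStrongFEPair_toStrongFEPair.hasMellin s).1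
  have hint : ∀ s : ℂ, IntegrableOn (fun t : ℝ => t ^ (s.re - 1) * ‖P.f_modif t‖) (Set.Ioi 0) := by
    intro s
    refine (hconv s).norm.congr ?_
    refine (ae_restrict_iff' measurableSet_Ioi).2 (Eventually.of_forall fun t ht => ?_)
    have ht' : (0 : ℝ) < t := ht
    simp only
    rw [norm_smul, Complex.norm_cpow_eq_rpow_re_of_pos ht']
    simp
  refine ⟨(∫ t in Set.Ioi (0 : ℝ), (t ^ ((0 : ℂ).re - 1) * ‖P.f_modif t‖ + t ^ ((2 : ℂ).re - 1) * ‖P.f_modif t‖)) / 2, fun s h0 h4 => ?_⟩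
  have e : completedRiemannZeta₀ s = mellin P.f_modif (s / 2) / 2 := rfl
  rw [e, norm_div, Complex.norm_ofNat]
  gcongr
  rw [mellin]
  refine norm_integral_le_of_norm_le ((hint 0).add (hint 2)) ?_
  refine (ae_restrict_iff' measurableSet_Ioi).2 (Eventually.of_forall fun t ht => ?_)
  have ht' : (0 : ℝ) < t := ht
  rw [norm_smul, Complex.norm_cpow_eq_rpow_re_of_pos ht', ← add_mul]
  gcongr
  have e2 : (s / 2 - 1).re = s.re / 2 - 1 := by simp
  rw [e2]
  simp only [Complex.zero_re, Complex.re_ofNat]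
  rcases le_total t 1 with h | h
  · have := Real.rpow_le_rpow_of_exponent_ge ht' h (show 0 - 1 ≤ s.re / 2 - 1 by linarith)
    exact le_add_of_le_of_nonneg this (by positivity)
  · have := Real.rpow_le_rpow_of_exponent_le h (show s.re / 2 - 1 ≤ 2 - 1 by linarith)
    exact le_add_of_nonneg_of_le (by positivity) this

lemma Gammaℝ_bound {s : ℂ} {ρ : ℝ} (h4 : 4 ≤ s.re) (hρ : ‖s‖ ≤ ρ) : ‖Complex.Gammaℝ s‖ ≤ Real.exp (ρ * Real.log ρ) := by
  have hre : s.re ≤ ρ := (Complex.re_le_norm s).trans hρ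
  rw [Complex.Gammaℝ_def, norm_mul, Complex.norm_cpow_eq_rpow_re_of_pos Real.pi_pos]
  have e : (s / 2).re = s.re / 2 := by simp
  have e2 : (-s / 2).re = -(s.re / 2) := by simp; ring
  have h1 : ‖Complex.Gamma (s / 2)‖ ≤ Real.Gamma (s.re / 2) := by
    rw [← e]; exact norm_cGamma_le (by rw [e]; linarith)
  have h2 : π ^ (-s / 2).re ≤ 1 := by
    rw [e2]
    exact Real.rpow_le_one_of_one_le_of_nonpos (by linarith [Real.pi_gt_three]) (by linarith)
  set n := ⌈s.re / 2⌉₊ with hn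
  have hn1 : s.re / 2 ≤ n := Nat.le_ceil _
  have hn2 : (n : ℝ) < s.re / 2 + 1 := Nat.ceil_lt_add_one (by linarith)
  have h3 : Real.Gamma (s.re / 2) ≤ (n.factorial : ℝ) := by
    rw [← Real.Gamma_nat_eq_factorial]
    exact Real.Gamma_strictMonoOn_Ici.monotoneOn (by simp; linarith) (by simp; linarith) (by linarith)
  have h5 : (n.factorial : ℝ) ≤ (n : ℝ) ^ n := by exact_mod_cast Nat.factorial_le_pow n
  have hn0 : (2 : ℝ) ≤ n := by linarith
  have h6 : (n : ℝ) ^ n ≤ Real.exp (ρ * Real.log ρ) := by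
    rw [← Real.rpow_natCast, Real.rpow_def_of_pos (by linarith), mul_comm]
    apply Real.exp_le_exp.2
    have : Real.log n ≤ Real.log ρ := Real.log_le_log (by linarith) (by linarith)
    have h0 : 0 ≤ Real.log n := Real.log_nonneg (by linarith)
    have h1 : (n : ℝ) ≤ ρ := by linarith
    gcongr
    linarith
  calc _ ≤ 1 * Real.Gamma (s.re / 2) := by
        gcongr
    _ ≤ _ := by linarith

lemma xi_bound : ∃ C : ℝ, 0 < C ∧ ∀ ρ : ℝ, 4 ≤ ρ → ∀ s : ℂ, ‖s‖ ≤ ρ → 1 / 2 ≤ s.re → ‖xi s‖ ≤ C * ρ ^ 2 * Real.exp (ρ * Real.log ρ) := by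
  obtain ⟨C1, h1⟩ := zeta_bound
  obtain ⟨C2, h2⟩ := Lambda0_bound
  have C1n : 0 ≤ C1 := (norm_nonneg _).trans (h1 2 (by simp))
  have C2n : 0 ≤ C2 := (norm_nonneg _).trans (h2 2 (by simp) (by simp; norm_num))
  refine ⟨1 + 2 * C1 + 2 * C2, by linarith, fun ρ hρ s hs hre => ?_⟩
  have hE : 1 ≤ Real.exp (ρ * Real.log ρ) := by
    apply Real.one_le_exp
    have := Real.log_nonneg (show 1 ≤ ρ by linarith)
    positivity
  have hss : ‖s * (s - 1)‖ ≤ 2 * ρ ^ 2 := by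
    rw [norm_mul]
    have : ‖s - 1‖ ≤ 2 * ρ := by
      refine (norm_sub_le _ _).trans ?_
      simp; linarith
    calc _ ≤ ρ * (2 * ρ) := by gcongr
      _ = _ := by ring
  have hρ2 : 1 ≤ ρ ^ 2 := by nlinarith
  rcases le_total s.re 4 with h | h
  · have h3 := h2 s (by linarith) h
    calc ‖xi s‖ ≤ ‖(1 : ℂ)‖ + ‖s * (s - 1) * completedRiemannZeta₀ s‖ := norm_add_le _ _
      _ ≤ 1 + 2 * ρ ^ 2 * C2 := by
        rw [norm_mul, norm_one]; gcongr
      _ ≤ (1 + 2 * C1 + 2 * C2) * ρ ^ 2 * 1 := by nlinarith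
      _ ≤ _ := by gcongr
  · have hs1 : s ≠ 1 := by rintro rfl; norm_num at h
    rw [xi_eq_zeta (by linarith) hs1, norm_mul, norm_mul]
    have h3 := h1 s (by linarith)
    have h4 := Gammaℝ_bound h hs
    calc _ ≤ 2 * ρ ^ 2 * Real.exp (ρ * Real.log ρ) * C1 := by gcongr
      _ = (2 * C1) * ρ ^ 2 * Real.exp (ρ * Real.log ρ) := by ring
      _ ≤ _ := by gcongr; linarith

lemma Xi_even (z : ℂ) : Xi (-z) = Xi z := by
  unfold Xi
  rw [← xi_one_sub]
  congr 1; ring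

lemma growth_aux (C ε : ℝ) (hC : 0 < C) (hε : 0 < ε) : ∀ᶠ R : ℝ in atTop,
    C * (R + 1) ^ 2 * Real.exp ((R + 1) * Real.log (R + 1)) ≤ Real.exp (ε * R ^ 2) := by
  have h1 : Tendsto (fun R : ℝ => R + 1) atTop atTop := tendsto_atTop_add_const_right _ _ tendsto_id
  have h2 : ∀ᶠ x : ℝ in atTop, ‖Real.log x‖ ≤ (ε / 16) * ‖x‖ :=
    Real.isLittleO_log_id_atTop.def (by positivity)
  have h3 : ∀ᶠ x : ℝ in atTop, Real.log C ≤ ε / 4 * x := by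
    exact (tendsto_id.const_mul_atTop (show 0 < ε / 4 by positivity)).eventually_ge_atTop _
  filter_upwards [h1.eventually h2, h1.eventually h3, eventually_ge_atTop 3] with R h2 h3 h4
  rw [Real.norm_of_nonneg (Real.log_nonneg (by linarith)), Real.norm_of_nonneg (by linarith)] at h2
  set x := R + 1 with hx
  have hx0 : 0 < x := by linarith
  rw [← Real.exp_log (show 0 < C * x ^ 2 by positivity), ← Real.exp_add, Real.log_mul hC.ne' (by positivity), Real.log_pow]
  apply Real.exp_le_exp.2
  have h5 : x * Real.log x ≤ x * (ε / 16 * x) := by gcongr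
  have h6 : R ^ 2 ≥ 9 / 16 * x ^ 2 := by rw [hx]; nlinarith
  push_cast
  nlinarith [mul_le_mul_of_nonneg_left h6 hε.le, mul_nonneg hε.le (mul_nonneg hx0.le (show 0 ≤ x - 4 by linarith))]

lemma Xi_good (hRH : RiemannHypothesis) : GoodF Xi where
  diff := by
    have := xi_diff
    unfold Xi; fun_prop
  even := Xi_even
  rz := by
    intro z hz
    have := xi_zero_re hRH hz
    simpa using this
  growth := by
    intro ε hε
    obtain ⟨C, hC, hb⟩ := xi_bound
    filter_upwards [growth_aux C ε hC hε, eventually_ge_atTop 3] with R h1 h2 z hz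
    refine le_trans ?_ h1
    have key : ∀ z : ℂ, ‖z‖ ≤ R → z.im ≤ 0 → ‖Xi z‖ ≤ C * (R + 1) ^ 2 * Real.exp ((R + 1) * Real.log (R + 1)) := by
      intro z hz him
      refine hb (R + 1) (by linarith) _ ?_ ?_
      · refine (norm_add_le _ _).trans ?_
        rw [norm_mul]
        norm_num
        linarith
      · simp; linarith
    rcases le_total z.im 0 with h | h
    · exact key z hz h
    · rw [← Xi_even]
      exact key (-z) (by rwa [norm_neg]) (by simpa using h)

lemma half_ne_one (γ : ℝ) : (1 / 2 + (γ : ℂ) * Complex.I) ≠ 1 := by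
  intro h
  have := congrArg Complex.re h
  norm_num at this

lemma Xi_zero_iff (γ : ℝ) : Xi γ = 0 ↔ riemannZeta (1 / 2 + γ * Complex.I) = 0 := by
  unfold Xi
  rw [mul_comm Complex.I]
  have hre : 0 < (1 / 2 + (γ : ℂ) * Complex.I).re := by norm_num
  have h0 : (1 / 2 + (γ : ℂ) * Complex.I) ≠ 0 := by intro h; rw [h] at hre; simp at hre
  rw [xi_eq_zeta hre (half_ne_one γ)]
  have : (1 / 2 + (γ : ℂ) * Complex.I) * ((1 / 2 + (γ : ℂ) * Complex.I) - 1) * Complex.Gammaℝ (1 / 2 + (γ : ℂ) * Complex.I) ≠ 0 :=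
    mul_ne_zero (mul_ne_zero h0 (sub_ne_zero.2 (half_ne_one γ))) (Complex.Gammaℝ_ne_zero_of_re_pos hre)
  simp only [mul_eq_zero, this, false_or]

lemma zm_eq_ordMult (hRH : RiemannHypothesis) (γ : ℝ) : ordMult γ = zm Xi γ := by
  set s0 : ℂ := 1 / 2 + (γ : ℂ) * Complex.I with hs0
  have hre : 0 < s0.re := by rw [hs0]; norm_num
  have h0 : s0 ≠ 0 := by intro h; rw [h] at hre; simp at hre
  have h1 : s0 ≠ 1 := half_ne_one γ
  have hord1 : analyticOrderAt Xi (γ : ℂ) = analyticOrderAt xi s0 := by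
    have := analyticOrderAt_comp_of_deriv_ne_zero (f := xi) (g := fun z : ℂ => 1 / 2 + Complex.I * z) (z₀ := (γ : ℂ))
      (by fun_prop) (by simp)
    rw [show s0 = 1 / 2 + Complex.I * (γ : ℂ) by rw [hs0]; ring]
    exact this
  have hza : AnalyticAt ℂ riemannZeta s0 := analyticOn_riemannZeta s0 h1
  set q : ℂ → ℂ := fun s => (Complex.Gammaℝ s)⁻¹ / (s * (s - 1)) with hq
  have hqa : AnalyticAt ℂ q s0 := by
    refine AnalyticAt.div (Complex.differentiable_Gammaℝ_inv.analyticAt s0) (by fun_prop) ?_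
    exact mul_ne_zero h0 (sub_ne_zero.2 h1)
  have hq0 : q s0 ≠ 0 := div_ne_zero (inv_ne_zero (Complex.Gammaℝ_ne_zero_of_re_pos hre)) (mul_ne_zero h0 (sub_ne_zero.2 h1))
  have heq : riemannZeta =ᶠ[nhds s0] xi * q := by
    have e1 : ∀ᶠ s : ℂ in nhds s0, 0 < s.re := Complex.continuous_re.continuousAt.eventually (lt_mem_nhds hre)
    filter_upwards [e1, isOpen_ne.mem_nhds h1] with s h2 h3
    have h4 : s ≠ 0 := by rintro rfl; simp at h2
    have h5 : s - 1 ≠ 0 := sub_ne_zero.2 h3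
    have h6 := Complex.Gammaℝ_ne_zero_of_re_pos h2
    simp only [Pi.mul_apply, hq]
    rw [xi_eq_zeta h2 h3]
    field_simp
  have hord2 : analyticOrderAt riemannZeta s0 = analyticOrderAt xi s0 := by
    rw [analyticOrderAt_congr heq, analyticOrderAt_mul (xi_diff.analyticAt _) hqa, hqa.analyticOrderAt_eq_zero.2 hq0, add_zero]
  have hfin := (Xi_good hRH).ord γ
  have hn : analyticOrderAt riemannZeta s0 = (zm Xi γ : ℕ) := by
    rw [hord2, ← hord1]
    exact (Nat.cast_analyticOrderNatAt hfin).symm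
  obtain ⟨hlt, hne⟩ := (analyticOrderAt_eq_nat_iff_iteratedDeriv_eq_zero hza).1 hn
  unfold ordMult zetaMult
  rw [← hs0]
  apply le_antisymm
  · exact Nat.sInf_le hne
  · by_contra hcon
    have hmem := Nat.sInf_mem (s := {n : ℕ | iteratedDeriv n riemannZeta s0 ≠ 0}) ⟨_, hne⟩
    exact hmem (hlt _ (not_le.1 hcon))

end

section

lemma deriv_circ {R : ℝ} {c : ℂ} {f : ℂ → ℂ} (hR : 0 < R) (hf : DiffContOnCl ℂ f (Metric.ball c R)) :
    deriv f c = (2 * π * Complex.I : ℂ)⁻¹ • ∮ z in C(c, R), (z - c) ^ (-2:ℤ) • f z := by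
  have h := DiffContOnCl.circleIntegral_one_div_sub_center_pow_smul hR 1 hf
  simp only [one_div, iteratedDeriv_one, Nat.factorial_one, Nat.cast_one, div_one] at h
  have h2 : (∮ z in C(c, R), (z - c) ^ (-2:ℤ) • f z) = (2 * π * Complex.I : ℂ) • deriv f c := by
    rw [← h]; rfl
  rw [h2, inv_smul_smul₀ Complex.two_pi_I_ne_zero]

lemma GammaSeq_bound {s : ℂ} (hs : 0 < s.re) {n : ℕ} (hn : n ≠ 0) :
    ‖Complex.GammaSeq s n‖ ≤ Real.Gamma s.re := by
  rw [Complex.GammaSeq_eq_approx_Gamma_integral hs hn, Real.Gamma_eq_integral hs]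
  have hI := Real.GammaIntegral_convergent hs
  have h0 : (0:ℝ) ≤ n := by positivity
  calc _ ≤ ∫ x in (0:ℝ)..n, Real.exp (-x) * x ^ (s.re - 1) := by
        apply intervalIntegral.norm_integral_le_of_norm_le h0
        · refine ae_of_all _ fun x hx => ?_
          have h2 : 0 ≤ 1 - x / n := sub_nonneg.mpr (div_le_one_of_le₀ hx.2 h0)
          rw [norm_mul, Complex.norm_of_nonneg (pow_nonneg h2 _),
            Complex.norm_cpow_eq_rpow_re_of_pos hx.1, Complex.sub_re, Complex.one_re]
          gcongr
          · exact Real.rpow_nonneg hx.1.le _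
          · exact Real.one_sub_div_pow_le_exp_neg hx.2
        · rw [intervalIntegrable_iff_integrableOn_Ioc_of_le h0]
          exact hI.mono_set Set.Ioc_subset_Ioi_self
    _ = ∫ x in Set.Ioc (0:ℝ) n, Real.exp (-x) * x ^ (s.re - 1) :=
        intervalIntegral.integral_of_le h0
    _ ≤ _ := by
        apply setIntegral_mono_set hI
        · filter_upwards [ae_restrict_mem measurableSet_Ioi] with x hx
          have : (0:ℝ) < x := hx
          simp only [Pi.zero_apply]
          positivity
        · exact Set.Ioc_subset_Ioi_self.eventuallyLE

lemma add_nat_ne {s : ℂ} (hs : 0 < s.re) (j : ℕ) : s + j ≠ 0 := by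
  intro h
  have := congrArg Complex.re h
  simp at this
  have : (0:ℝ) ≤ j := by positivity
  linarith

lemma GammaSeq_hasDerivAt {s : ℂ} (hs : 0 < s.re) {n : ℕ} (hn : n ≠ 0) :
    HasDerivAt (fun s => Complex.GammaSeq s n)
      (Complex.GammaSeq s n * (Complex.log n - ∑ j ∈ Finset.range (n+1), 1 / (s + j))) s := by
  unfold Complex.GammaSeq
  have hp : ∏ j ∈ Finset.range (n + 1), (s + j) ≠ 0 :=
    Finset.prod_ne_zero_iff.mpr fun j _ => add_nat_ne hs j
  have h1 : HasDerivAt (fun s : ℂ => (n:ℂ) ^ s) ((n:ℂ) ^ s * Complex.log n * 1) s :=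
    (hasDerivAt_id s).const_cpow (Or.inl (by exact_mod_cast hn))
  have h2 : HasDerivAt (fun s : ℂ => ∏ j ∈ Finset.range (n + 1), (s + j))
      ((∏ j ∈ Finset.range (n + 1), (s + j)) * ∑ j ∈ Finset.range (n+1), 1 / (s + j)) s := by
    have := HasDerivAt.fun_finsetProd (u := Finset.range (n+1)) (f := fun (j:ℕ) (s:ℂ) => s + j)
      (f' := fun _ => 1) (x := s) (fun j _ => (hasDerivAt_id s).add_const _)
    convert! this using 1
    rw [Finset.mul_sum]
    refine Finset.sum_congr rfl fun j hj => ?_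
    rw [← Finset.mul_prod_erase _ _ hj]
    have := add_nat_ne hs j
    field_simp
    simp
  convert! (h1.mul_const _).div h2 hp using 1
  field_simp

lemma deriv_GammaSeq_tendsto {s : ℂ} (hs : 0 < s.re) :
    Tendsto (fun n : ℕ => deriv (fun s => Complex.GammaSeq s n) s) atTop
      (nhds (deriv Complex.Gamma s)) := by
  set R := s.re / 2 with hR
  have hRp : 0 < R := by positivity
  have hre : ∀ z ∈ Metric.closedBall s R, R ≤ z.re ∧ z.re ≤ 3 * R := by
    intro z hz
    have h := Complex.abs_re_le_norm (z - s)
    rw [mem_closedBall_iff_norm] at hz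
    have h1 := abs_le.1 (h.trans hz)
    simp at h1
    constructor <;> linarith [h1.1, h1.2]
  have hball : closure (Metric.ball s R) ⊆ Metric.closedBall s R := Metric.closure_ball_subset_closedBall
  have e1 : deriv Complex.Gamma s = (2 * π * Complex.I : ℂ)⁻¹ •
      ∮ z in C(s, R), (z - s) ^ (-2:ℤ) • Complex.Gamma z := by
    apply deriv_circ hRp
    apply DifferentiableOn.diffContOnCl
    intro z hz
    apply DifferentiableAt.differentiableWithinAt
    apply Complex.differentiableAt_Gamma
    intro m h
    have := (hre z (hball hz)).1
    rw [h] at this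
    simp at this
    have : (0:ℝ) ≤ m := by positivity
    linarith
  have e2 : ∀ᶠ n : ℕ in atTop, deriv (fun s => Complex.GammaSeq s n) s = (2 * π * Complex.I : ℂ)⁻¹ •
      ∮ z in C(s, R), (z - s) ^ (-2:ℤ) • Complex.GammaSeq z n := by
    filter_upwards [eventually_ne_atTop 0] with n hn
    apply deriv_circ hRp
    apply DifferentiableOn.diffContOnCl
    intro z hz
    apply DifferentiableAt.differentiableWithinAt
    exact (GammaSeq_hasDerivAt (hRp.trans_le (hre z (hball hz)).1) hn).differentiableAt
  rw [e1, tendsto_congr' e2]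
  apply Tendsto.const_smul
  have hcm : ∀ θ, circleMap s R θ ∈ Metric.closedBall s R := fun θ =>
    circleMap_mem_closedBall s hRp.le θ
  have hGc : ContinuousOn Real.Gamma (Set.Icc R (3*R)) := by
    intro x hx
    apply ContinuousAt.continuousWithinAt
    apply DifferentiableAt.continuousAt (𝕜 := ℝ)
    apply Real.differentiableAt_Gamma
    intro m h
    have : (0:ℝ) ≤ m := by positivity
    linarith [hx.1]
  obtain ⟨M, hM⟩ := isCompact_Icc.exists_bound_of_continuousOn hGc
  unfold circleIntegral
  apply intervalIntegral.tendsto_integral_filter_of_dominated_convergence (fun _ => R * (R^(-2:ℤ) * M))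
  · filter_upwards [eventually_ne_atTop 0] with n hn
    apply Continuous.aestronglyMeasurable
    have : Continuous fun θ => Complex.GammaSeq (circleMap s R θ) n := by
      rw [continuous_iff_continuousAt]
      intro θ
      exact ContinuousAt.comp (f := circleMap s R) (g := fun z => Complex.GammaSeq z n)
        (GammaSeq_hasDerivAt (hRp.trans_le (hre _ (hcm θ)).1) hn).continuousAt
        (continuous_circleMap s R).continuousAt
    have h3 : Continuous fun θ => (circleMap s R θ - s) ^ (-2:ℤ) := by
      apply Continuous.zpow₀ (by fun_prop)
      intro θ
      left
      simp [hRp.ne']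
    have h4 : Continuous (deriv (circleMap s R)) := by
      have : deriv (circleMap s R) = fun θ => circleMap 0 R θ * Complex.I := by
        ext θ; simp
      rw [this]; fun_prop
    simp only [smul_eq_mul]
    fun_prop
  · filter_upwards [eventually_ne_atTop 0] with n hn
    refine ae_of_all _ fun θ _ => ?_
    have hz := hre _ (hcm θ)
    have h5 := (GammaSeq_bound (hRp.trans_le hz.1) hn).trans ((le_abs_self _).trans (hM _ hz))
    simp only [norm_smul, deriv_circleMap, norm_mul, norm_circleMap_zero, Complex.norm_I, mul_one,
      norm_zpow, circleMap_sub_center, abs_of_pos hRp]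
    gcongr
  · simp
  · refine ae_of_all _ fun θ _ => ?_
    exact ((Complex.GammaSeq_tendsto_Gamma _).const_smul _).const_smul _

lemma digamma_tendsto {s : ℂ} (hs : 0 < s.re) :
    Tendsto (fun n : ℕ => Complex.log n - ∑ j ∈ Finset.range (n+1), 1 / (s + j)) atTop
      (nhds (logDeriv Complex.Gamma s)) := by
  have h0 : Complex.Gamma s ≠ 0 := Complex.Gamma_ne_zero_of_re_pos hs
  have h1 := (deriv_GammaSeq_tendsto hs).div (Complex.GammaSeq_tendsto_Gamma s) h0
  refine Tendsto.congr' ?_ h1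
  filter_upwards [eventually_ne_atTop 0, (Complex.GammaSeq_tendsto_Gamma s).eventually_ne h0] with n hn h2
  simp only [Pi.div_apply]
  rw [(GammaSeq_hasDerivAt hs hn).deriv, mul_comm, mul_div_assoc, div_self h2, mul_one]

end

section

lemma lower_lin {σ : ℝ} (hσ : 0 < σ) : ∃ a : ℝ, 0 < a ∧ ∀ (t : ℝ) (x : ℝ), 0 ≤ x →
    a * (1 + x + |t|) ≤ ‖((σ + x : ℝ) : ℂ) + t * Complex.I‖ := by
  refine ⟨min σ 1 / 2, by positivity, fun t x hx => ?_⟩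
  have h1 := Complex.abs_re_le_norm (((σ + x : ℝ) : ℂ) + t * Complex.I)
  have h2 := Complex.abs_im_le_norm (((σ + x : ℝ) : ℂ) + t * Complex.I)
  simp only [Complex.add_re, Complex.ofReal_re, Complex.mul_re, Complex.I_re, mul_zero,
    Complex.ofReal_im, Complex.I_im, mul_one, sub_self, add_zero, Complex.add_im, Complex.mul_im,
    zero_add] at h1 h2
  rw [abs_of_nonneg (by positivity)] at h1
  have h3 : min σ 1 ≤ σ := min_le_left _ _
  have h4 : min σ 1 ≤ 1 := min_le_right _ _
  have h5 : 0 ≤ |t| := abs_nonneg t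
  nlinarith

lemma sum_inv_sq {τ : ℝ} (hτ : 0 ≤ τ) (n : ℕ) :
    ∑ j ∈ Finset.range (n+1), 1 / (1 + (j:ℝ) + τ)^2 ≤ 2 / (1 + τ) := by
  have : ∑ j ∈ Finset.range (n+1), 1 / (1 + (j:ℝ) + τ)^2 ≤ 2 / (1 + τ) - 1 / (n + 1 + τ) := by
    induction n with
    | zero =>
      simp only [zero_add, Finset.sum_range_one, Nat.cast_zero, add_zero]
      rw [← sub_div, show (2:ℝ) - 1 = 1 by norm_num]
      apply one_div_le_one_div_of_le (by positivity)
      nlinarith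
    | succ n ih =>
      rw [Finset.sum_range_succ]
      have : 1 / (1 + ((n+1:ℕ):ℝ) + τ)^2 ≤ 1 / (n + 1 + τ) - 1 / (((n+1:ℕ):ℝ) + 1 + τ) := by
        push_cast
        rw [div_sub_div _ _ (by positivity) (by positivity), div_le_div_iff₀ (by positivity) (by positivity)]
        have : (0:ℝ) ≤ n := by positivity
        nlinarith
      linarith
  have : 0 ≤ 1 / (n + 1 + τ) := by positivity
  linarith

lemma sum_inv_log {τ : ℝ} (hτ : 0 ≤ τ) (n : ℕ) :
    |∑ j ∈ Finset.range (n+1), 1 / (1 + (j:ℝ) + τ) - (Real.log (n + 2 + τ) - Real.log (1 + τ))| ≤ 1 := by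
  have key : ∀ x : ℝ, 0 < x → 1 / (x + 1) ≤ Real.log (x + 1) - Real.log x ∧
      Real.log (x + 1) - Real.log x ≤ 1 / x := by
    intro x hx
    rw [← Real.log_div (by positivity) hx.ne']
    constructor
    · have := Real.one_sub_inv_le_log_of_pos (show 0 < (x+1)/x by positivity)
      convert this using 1
      field_simp
      ring
    · have := Real.log_le_sub_one_of_pos (show 0 < (x+1)/x by positivity)
      convert this using 1
      field_simp
      ring
  have h1 : Real.log (n + 2 + τ) - Real.log (1 + τ) ≤ ∑ j ∈ Finset.range (n+1), 1 / (1 + (j:ℝ) + τ) := by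
    induction n with
    | zero =>
      have := (key (1 + τ) (by positivity)).2
      simp only [zero_add, Finset.sum_range_one, Nat.cast_zero, add_zero]
      convert this using 3
      ring
    | succ n ih =>
      rw [Finset.sum_range_succ]
      have := (key (n + 2 + τ) (by positivity)).2
      push_cast
      rw [show (n:ℝ) + 1 + 2 + τ = n + 2 + τ + 1 by ring, show 1 + ((n:ℝ) + 1) + τ = n + 2 + τ by ring]
      linarith
  have h2 : ∑ j ∈ Finset.range (n+1), 1 / (1 + (j:ℝ) + τ) ≤ 1 + (Real.log (n + 1 + τ) - Real.log (1 + τ)) := by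
    induction n with
    | zero =>
      simp only [zero_add, Finset.sum_range_one, Nat.cast_zero, add_zero, sub_self]
      rw [div_le_one (by positivity)]
      linarith
    | succ n ih =>
      rw [Finset.sum_range_succ]
      have := (key (n + 1 + τ) (by positivity)).1
      have h3 := ih (by
        have := (key (n + 1 + τ) (by positivity))
        have := (key (n + 2 + τ) (by positivity)).2
        rw [Finset.sum_range_succ] at h1
        push_cast at h1
        rw [show (n:ℝ) + 1 + 2 + τ = n + 2 + τ + 1 by ring] at h1
        rw [show 1 + ((n:ℝ) + 1) + τ = n + 2 + τ by ring] at h1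
        have e : (n:ℝ) + 1 + τ + 1 = n + 2 + τ := by ring
        have h0 : ∀ m : ℕ, Real.log (m + 2 + τ) - Real.log (1 + τ) ≤ ∑ j ∈ Finset.range (m+1), 1 / (1 + (j:ℝ) + τ) := by
          intro m
          induction m with
          | zero =>
            have := (key (1 + τ) (by positivity)).2
            simp only [zero_add, Finset.sum_range_one, Nat.cast_zero, add_zero]
            convert this using 3
            ring
          | succ n ih =>
            rw [Finset.sum_range_succ]
            have := (key (n + 2 + τ) (by positivity)).2
            push_cast
            rw [show (n:ℝ) + 1 + 2 + τ = n + 2 + τ + 1 by ring, show 1 + ((n:ℝ) + 1) + τ = n + 2 + τ by ring]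
            linarith
        exact h0 n)
      push_cast
      rw [show 1 + ((n:ℝ) + 1) + τ = n + 1 + τ + 1 by ring, show (n:ℝ) + 1 + 1 + τ = n + 1 + τ + 1 by ring]
      linarith
  have h3 : Real.log (n + 1 + τ) ≤ Real.log (n + 2 + τ) := Real.log_le_log (by positivity) (by linarith)
  rw [abs_le]
  constructor <;> linarith

lemma digamma_log {σ : ℝ} (hσ : 0 < σ) : ∃ C : ℝ, 0 ≤ C ∧ ∀ t : ℝ,
    ‖logDeriv Complex.Gamma (σ + t * Complex.I) - (Real.log (2 + |t|) : ℝ)‖ ≤ C := by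
  obtain ⟨a, ha, hl⟩ := lower_lin hσ
  refine ⟨2 * (2 + σ) / a + 3, by positivity, fun t => ?_⟩
  set τ := |t| with hτd
  have hτ : 0 ≤ τ := abs_nonneg t
  have hs : 0 < (σ + t * Complex.I : ℂ).re := by simpa using hσ
  have hlim := (digamma_tendsto hs).sub_const ((Real.log (2 + τ) : ℝ) : ℂ)
  refine le_of_tendsto hlim.norm ?_
  filter_upwards [eventually_ge_atTop ⌈2 + τ⌉₊] with n hn
  have hn' : 2 + τ ≤ n := (Nat.le_ceil _).trans (by exact_mod_cast hn)
  have hterm : ∀ j ∈ Finset.range (n+1), ‖1 / (σ + t * Complex.I + j : ℂ) - ((1 / (1 + (j:ℝ) + τ) : ℝ) : ℂ)‖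
      ≤ (2 + σ) * (1 + τ) / a * (1 / (1 + (j:ℝ) + τ)^2) := by
    intro j _
    have hj := hl t j (by positivity)
    have e : ((σ + (j:ℝ) : ℝ) : ℂ) + t * Complex.I = σ + t * Complex.I + j := by push_cast; ring
    rw [e] at hj
    have hne : (σ + t * Complex.I + j : ℂ) ≠ 0 := add_nat_ne hs j
    have hpos : 0 < 1 + (j:ℝ) + τ := by positivity
    have e2 : 1 / (σ + t * Complex.I + j : ℂ) - ((1 / (1 + (j:ℝ) + τ) : ℝ) : ℂ)
        = ((1 + τ : ℝ) - (σ + t * Complex.I)) / ((σ + t * Complex.I + j) * ((1 + (j:ℝ) + τ : ℝ) : ℂ)) := by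
      have : ((1 + (j:ℝ) + τ : ℝ) : ℂ) ≠ 0 := by exact_mod_cast hpos.ne'
      rw [Complex.ofReal_div, Complex.ofReal_one, div_sub_div _ _ hne this]
      congr 1
      push_cast
      ring
    rw [e2, norm_div, norm_mul, Complex.norm_of_nonneg hpos.le]
    have hnum : ‖((1 + τ : ℝ) - (σ + t * Complex.I) : ℂ)‖ ≤ (2 + σ) * (1 + τ) := by
      calc _ ≤ ‖((1 + τ : ℝ):ℂ)‖ + (‖(σ:ℂ)‖ + ‖(t * Complex.I : ℂ)‖) :=
            (norm_sub_le _ _).trans (by gcongr; exact norm_add_le _ _)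
        _ = (1 + τ) + (σ + τ) := by
            rw [Complex.norm_of_nonneg (by positivity), Complex.norm_of_nonneg hσ.le]
            simp [hτd]
        _ ≤ _ := by nlinarith
    calc _ ≤ (2 + σ) * (1 + τ) / ((a * (1 + (j:ℝ) + τ)) * (1 + (j:ℝ) + τ)) := by gcongr
      _ = _ := by field_simp
  have hsum : ‖∑ j ∈ Finset.range (n+1), (1 / (σ + t * Complex.I + j : ℂ) - ((1 / (1 + (j:ℝ) + τ) : ℝ) : ℂ))‖
      ≤ 2 * (2 + σ) / a := by
    refine (norm_sum_le_of_le _ hterm).trans ?_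
    rw [← Finset.mul_sum]
    calc _ ≤ (2 + σ) * (1 + τ) / a * (2 / (1 + τ)) := by gcongr; exact sum_inv_sq hτ n
      _ = _ := by field_simp
  have hlogn : |Real.log n - Real.log (n + 2 + τ)| ≤ 1 := by
    have hn0 : (0:ℝ) < n := by linarith
    rw [abs_sub_comm, abs_of_nonneg (sub_nonneg.2 (Real.log_le_log hn0 (by linarith))),
      ← Real.log_div (by positivity) hn0.ne']
    have : (n + 2 + τ) / n ≤ 2 := by rw [div_le_iff₀ hn0]; linarith
    have h2 := Real.log_le_sub_one_of_pos (show 0 < (n + 2 + τ) / n by positivity)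
    linarith
  have hlog2 : |Real.log (1 + τ) - Real.log (2 + τ)| ≤ 1 := by
    rw [abs_sub_comm, abs_of_nonneg (sub_nonneg.2 (Real.log_le_log (by positivity) (by linarith))),
      ← Real.log_div (by positivity) (by positivity)]
    have : (2 + τ) / (1 + τ) ≤ 2 := by rw [div_le_iff₀ (by positivity)]; linarith
    have h2 := Real.log_le_sub_one_of_pos (show 0 < (2 + τ) / (1 + τ) by positivity)
    linarith
  have hH := sum_inv_log hτ n
  set H := ∑ j ∈ Finset.range (n+1), 1 / (1 + (j:ℝ) + τ) with hHd
  rw [Finset.sum_sub_distrib, ← Complex.ofReal_sum, ← hHd] at hsum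
  set S := ∑ j ∈ Finset.range (n+1), 1 / (σ + t * Complex.I + j : ℂ) with hSd
  have e3 : Complex.log n - S - ((Real.log (2 + τ) : ℝ) : ℂ) =
      -(S - (H:ℂ)) + (((Real.log n - Real.log (n + 2 + τ)) + (Real.log (1 + τ) - Real.log (2 + τ))
        - (H - (Real.log (n + 2 + τ) - Real.log (1 + τ))) : ℝ) : ℂ) := by
    rw [Complex.natCast_log.symm]
    push_cast
    ring
  rw [e3]
  refine (norm_add_le _ _).trans ?_
  rw [norm_neg, Complex.norm_real, Real.norm_eq_abs]
  have := abs_sub (Real.log n - Real.log (n + 2 + τ) + (Real.log (1 + τ) - Real.log (2 + τ))) (H - (Real.log (n + 2 + τ) - Real.log (1 + τ)))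
  have := abs_add_le (Real.log n - Real.log (n + 2 + τ)) (Real.log (1 + τ) - Real.log (2 + τ))
  linarith

lemma digamma_lip {σ : ℝ} (hσ : 0 < σ) : ∃ C : ℝ, 0 ≤ C ∧ ∀ t t' : ℝ, |t' - t| ≤ 1/2 →
    ‖logDeriv Complex.Gamma (σ + t' * Complex.I) - logDeriv Complex.Gamma (σ + t * Complex.I)‖
      ≤ C / (1 + |t|) * ‖t' - t‖ := by
  obtain ⟨a, ha, hl⟩ := lower_lin hσ
  refine ⟨4 / a^2, by positivity, fun t t' htt => ?_⟩
  have hs : ∀ t : ℝ, 0 < (σ + t * Complex.I : ℂ).re := fun t => by simpa using hσ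
  refine le_of_tendsto ((digamma_tendsto (hs t')).sub (digamma_tendsto (hs t))).norm ?_
  refine Eventually.of_forall fun n => ?_
  have e : ∀ (j:ℕ) (t:ℝ), ((σ + (j:ℝ) : ℝ) : ℂ) + t * Complex.I = σ + t * Complex.I + j := by
    intro j t; push_cast; ring
  have h1 : Complex.log n - ∑ j ∈ Finset.range (n+1), 1 / (σ + t' * Complex.I + j : ℂ)
      - (Complex.log n - ∑ j ∈ Finset.range (n+1), 1 / (σ + t * Complex.I + j : ℂ))
      = ∑ j ∈ Finset.range (n+1), (1 / (σ + t * Complex.I + j : ℂ) - 1 / (σ + t' * Complex.I + j : ℂ)) := by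
    rw [Finset.sum_sub_distrib]; ring
  rw [h1]
  have hterm : ∀ j ∈ Finset.range (n+1), ‖1 / (σ + t * Complex.I + j : ℂ) - 1 / (σ + t' * Complex.I + j : ℂ)‖
      ≤ 2 * |t' - t| / a^2 * (1 / (1 + (j:ℝ) + |t|)^2) := by
    intro j _
    have hj := hl t j (by positivity)
    have hj' := hl t' j (by positivity)
    rw [e] at hj hj'
    have h3 : (1 + (j:ℝ) + |t|) / 2 ≤ 1 + (j:ℝ) + |t'| := by
      have := abs_sub_abs_le_abs_sub t t'
      rw [abs_sub_comm t t'] at this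
      have : (0:ℝ) ≤ j := by positivity
      have : 0 ≤ |t'| := abs_nonneg _
      linarith
    have hpos : 0 < 1 + (j:ℝ) + |t| := by positivity
    rw [div_sub_div _ _ (add_nat_ne (hs t) j) (add_nat_ne (hs t') j), norm_div, norm_mul]
    have e4 : (1 * (σ + t' * Complex.I + j) - (σ + t * Complex.I + j) * 1 : ℂ) = ((t' - t : ℝ):ℂ) * Complex.I := by
      push_cast; ring
    rw [e4, norm_mul, Complex.norm_I, mul_one, Complex.norm_real, Real.norm_eq_abs]
    calc _ ≤ |t' - t| / ((a * (1 + (j:ℝ) + |t|)) * (a * ((1 + (j:ℝ) + |t|)/2))) := by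
          gcongr
          exact (mul_le_mul_of_nonneg_left h3 ha.le).trans hj'
      _ = _ := by field_simp
  refine (norm_sum_le_of_le _ hterm).trans ?_
  rw [← Finset.mul_sum]
  calc _ ≤ 2 * |t' - t| / a^2 * (2 / (1 + |t|)) := by gcongr; exact sum_inv_sq (abs_nonneg t) n
    _ = _ := by rw [Real.norm_eq_abs]; field_simp; ring

structure LogLike (G G' : ℝ → ℂ) (C : ℝ) : Prop where
  nn : 0 ≤ C
  der : ∀ t, HasDerivAt G (G' t) t
  size : ∀ t, ‖G t - ((Real.log (2 + |t|) / 2 : ℝ) : ℂ)‖ ≤ C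
  dsize : ∀ t, ‖G' t‖ ≤ C / (1 + |t|)

lemma digamma_der {σ : ℝ} (hσ : 0 < σ) : ∃ C : ℝ, 0 ≤ C ∧ ∀ t : ℝ, ∃ d : ℂ, ‖d‖ ≤ C / (1 + |t|) ∧
    HasDerivAt (fun t : ℝ => logDeriv Complex.Gamma (σ + t * Complex.I)) d t := by
  obtain ⟨C, hC, h⟩ := digamma_lip hσ
  refine ⟨C, hC, fun t => ?_⟩
  have hopen : IsOpen {s : ℂ | 0 < s.re} := isOpen_lt continuous_const Complex.continuous_re
  have hs : (σ + t * Complex.I : ℂ) ∈ {s : ℂ | 0 < s.re} := by simpa using hσ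
  have hG : DifferentiableOn ℂ Complex.Gamma {s : ℂ | 0 < s.re} := by
    intro s hs
    apply DifferentiableAt.differentiableWithinAt
    apply Complex.differentiableAt_Gamma
    intro m h
    have h1 : 0 < s.re := hs
    rw [h] at h1
    simp at h1
    have : (0:ℝ) ≤ m := by positivity
    linarith
  have hd : DifferentiableAt ℂ (logDeriv Complex.Gamma) (σ + t * Complex.I) := by
    unfold logDeriv
    apply DifferentiableAt.div
    · exact (hG.deriv hopen).differentiableAt (hopen.mem_nhds hs)
    · exact hG.differentiableAt (hopen.mem_nhds hs)
    · exact Complex.Gamma_ne_zero_of_re_pos hs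
  have h1 : HasDerivAt (fun t : ℝ => (σ + t * Complex.I : ℂ)) Complex.I t := by
    have := ((hasDerivAt_id (t:ℂ)).comp_ofReal.mul_const Complex.I).const_add (σ:ℂ)
    simpa using this
  have h2 := HasDerivAt.scomp (𝕜 := ℝ) (𝕜' := ℂ) t hd.hasDerivAt h1
  refine ⟨_, ?_, h2⟩
  refine HasDerivAt.le_of_lip' h2 (by positivity) ?_
  filter_upwards [Metric.closedBall_mem_nhds t (show (0:ℝ) < 1/2 by norm_num)] with t' ht'
  exact h t t' (by simpa [Real.dist_eq] using ht')

end

section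

def vL (n : ℕ) : ℝ := ArithmeticFunction.vonMangoldt n / √n

lemma vL_nonneg (n : ℕ) : 0 ≤ vL n :=
  div_nonneg ArithmeticFunction.vonMangoldt_nonneg (Real.sqrt_nonneg _)

lemma half_wl (c t : ℝ) : 1 / 2 + Complex.I * wl c t = ((1/2 + c : ℝ) : ℂ) + t * Complex.I := by
  unfold wl
  push_cast
  linear_combination (-(c:ℂ)) * Complex.I_sq

lemma vL_term (n : ℕ) (z : ℂ) :
    LSeries.term (fun n => (ArithmeticFunction.vonMangoldt n : ℂ)) (1/2 + Complex.I * z) n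
      = (vL n : ℂ) * Complex.exp (-(Complex.I * (Real.log n : ℝ) * z)) := by
  rcases eq_or_ne n 0 with rfl | hn
  · simp [vL]
  have hn0 : (0:ℝ) < n := by positivity
  rw [LSeries.term_of_ne_zero hn, Complex.cpow_def_of_ne_zero (by exact_mod_cast hn), vL,
    ← Complex.natCast_log, mul_add, Complex.exp_add]
  have e1 : Complex.exp ((Real.log n : ℝ) * (1/2)) = ((√n : ℝ) : ℂ) := by
    rw [Real.sqrt_eq_rpow, Real.rpow_def_of_pos hn0]
    push_cast
    rfl
  rw [e1, Complex.exp_neg]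
  push_cast
  rw [show (Complex.I * Complex.log n * z : ℂ) = Complex.log n * (Complex.I * z) by ring]
  field_simp

lemma vL_term_norm (n : ℕ) (c t : ℝ) :
    ‖(vL n : ℂ) * Complex.exp (-(Complex.I * (Real.log n : ℝ) * wl c t))‖ = vL n * Real.exp (-(c * Real.log n)) := by
  rw [norm_mul, Complex.norm_of_nonneg (vL_nonneg n), Complex.norm_exp]
  congr 2
  simp [wl, -Complex.natCast_log]
  ring

lemma vL_summable {c : ℝ} (hc : 1/2 < c) : Summable fun n => vL n * Real.exp (-(c * Real.log n)) := by
  have h := ArithmeticFunction.LSeriesSummable_vonMangoldt (s := 1/2 + Complex.I * wl c 0)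
    (by rw [half_wl]; simp; linarith)
  have h2 : Summable fun n => LSeries.term (fun n => (ArithmeticFunction.vonMangoldt n : ℂ)) (1/2 + Complex.I * wl c 0) n := h
  refine h2.norm.congr fun n => ?_
  rw [vL_term, vL_term_norm]

lemma inv_der (b : ℝ) (hb : 0 < b) : ∃ C : ℝ, 0 ≤ C ∧ ∀ t : ℝ, ∃ d : ℂ, ‖d‖ ≤ C / (1 + |t|) ∧
    HasDerivAt (fun t : ℝ => 1 / ((b:ℂ) + t * Complex.I)) d t ∧ ‖1 / ((b:ℂ) + t * Complex.I)‖ ≤ C := by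
  obtain ⟨a, ha, hl⟩ := lower_lin hb
  refine ⟨1/a^2 + 1/a, by positivity, fun t => ?_⟩
  have hne : (b:ℂ) + t * Complex.I ≠ 0 := by
    intro h
    have := congrArg Complex.re h
    simp at this
    linarith
  have h1 : HasDerivAt (fun t : ℝ => (b + t * Complex.I : ℂ)) Complex.I t := by
    have := ((hasDerivAt_id (t:ℂ)).comp_ofReal.mul_const Complex.I).const_add (b:ℂ)
    simpa using this
  have h2 := h1.inv hne
  have h3 := hl t 0 le_rfl
  simp only [add_zero] at h3
  have hp : 0 < 1 + |t| := by positivity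
  refine ⟨_, ?_, by simpa using! h2, ?_⟩
  · rw [norm_div, norm_neg, Complex.norm_I, norm_pow]
    calc _ ≤ 1 / (a * (1 + |t|))^2 := by gcongr
      _ = 1/a^2 / (1 + |t|) / (1 + |t|) := by field_simp
      _ ≤ 1/a^2 / (1 + |t|) := div_le_self (by positivity) (by linarith [abs_nonneg t])
      _ ≤ _ := by gcongr; linarith [show 0 ≤ 1/a by positivity]
  · rw [norm_div, norm_one]
    calc _ ≤ 1 / (a * (1 + |t|)) := by gcongr
      _ = 1/a / (1 + |t|) := by field_simp
      _ ≤ 1/a := div_le_self (by positivity) (by linarith [abs_nonneg t])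
      _ ≤ _ := by linarith [show 0 ≤ 1/a^2 by positivity]

lemma Gammaℝ_logDeriv {s : ℂ} (hs : 0 < s.re) :
    logDeriv Complex.Gammaℝ s = -(Complex.log π) / 2 + logDeriv Complex.Gamma (s/2) / 2 := by
  have hpi : (π:ℂ) ≠ 0 := by exact_mod_cast Real.pi_ne_zero
  have hs2 : 0 < (s/2).re := by simpa using hs
  have e : Complex.Gammaℝ = fun s => (π:ℂ) ^ (-s/2) * Complex.Gamma (s/2) := by
    ext s; exact Complex.Gammaℝ_def s
  have hdG : DifferentiableAt ℂ Complex.Gamma (s/2) := by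
    apply Complex.differentiableAt_Gamma
    intro m h
    rw [h] at hs2
    simp at hs2
    have : (0:ℝ) ≤ m := by positivity
    linarith
  have h1 : HasDerivAt (fun s : ℂ => (π:ℂ) ^ (-s/2)) ((π:ℂ) ^ (-s/2) * Complex.log π * (-1/2)) s :=
    ((hasDerivAt_id s).neg.div_const 2).const_cpow (Or.inl hpi)
  have h2 : HasDerivAt (fun s : ℂ => Complex.Gamma (s/2)) (deriv Complex.Gamma (s/2) * (1/2)) s :=
    HasDerivAt.comp s hdG.hasDerivAt ((hasDerivAt_id s).div_const 2)
  have hp : (π:ℂ) ^ (-s/2) ≠ 0 := by simp [Complex.cpow_eq_zero_iff, hpi]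
  have hG := Complex.Gamma_ne_zero_of_re_pos hs2
  rw [e, logDeriv_mul s hp hG h1.differentiableAt h2.differentiableAt, logDeriv_apply, logDeriv_apply,
    h1.deriv, h2.deriv, logDeriv_apply]
  field_simp

lemma xi_logDeriv {s : ℂ} (hs : 1 < s.re) :
    logDeriv xi s = 1/s + 1/(s-1) + logDeriv Complex.Gammaℝ s + deriv riemannZeta s / riemannZeta s := by
  have hopen : IsOpen {s : ℂ | 1 < s.re} := isOpen_lt continuous_const Complex.continuous_re
  have hs0 : s ≠ 0 := by rintro rfl; simp at hs; linarith
  have hs1 : s ≠ 1 := by rintro rfl; simp at hs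
  have hs1' : s - 1 ≠ 0 := sub_ne_zero.2 hs1
  have e : xi =ᶠ[nhds s] fun s => (s * (s - 1)) * (Complex.Gammaℝ s * riemannZeta s) := by
    filter_upwards [hopen.mem_nhds hs] with w hw
    have hw' : 1 < w.re := hw
    rw [xi_eq_zeta (by linarith) (by rintro rfl; simp at hw')]
    ring
  have hG := Complex.Gammaℝ_ne_zero_of_re_pos (show 0 < s.re by linarith)
  have hz := riemannZeta_ne_zero_of_one_lt_re hs
  have hdG : DifferentiableAt ℂ Complex.Gammaℝ s := by
    have e : Complex.Gammaℝ = fun s => (π:ℂ) ^ (-s/2) * Complex.Gamma (s/2) := by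
      ext s; exact Complex.Gammaℝ_def s
    rw [e]
    have hpi : (π:ℂ) ≠ 0 := by exact_mod_cast Real.pi_ne_zero
    apply DifferentiableAt.mul
    · exact (((hasDerivAt_id s).neg.div_const 2).const_cpow (Or.inl hpi)).differentiableAt
    · apply DifferentiableAt.comp (f := fun s : ℂ => s/2) (g := Complex.Gamma) s
      · apply Complex.differentiableAt_Gamma
        intro m h
        have h2 := congrArg Complex.re h
        simp at h2
        have : (0:ℝ) ≤ m := by positivity
        linarith
      · fun_prop
  have hdz := differentiableAt_riemannZeta hs1
  have e2 : logDeriv xi s = logDeriv (fun s => (s * (s - 1)) * (Complex.Gammaℝ s * riemannZeta s)) s := by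
    rw [logDeriv_apply, logDeriv_apply, e.deriv_eq, e.eq_of_nhds]
  rw [e2, logDeriv_mul (f := fun s => s * (s-1)) (g := fun s => Complex.Gammaℝ s * riemannZeta s) s
      (mul_ne_zero hs0 hs1') (mul_ne_zero hG hz) (by fun_prop) (hdG.mul hdz),
    logDeriv_mul s hG hz hdG hdz, logDeriv_mul (f := fun s => s) (g := fun s => s - 1) s hs0 hs1'
      (by fun_prop) (by fun_prop)]
  rw [logDeriv_apply, logDeriv_apply, logDeriv_apply riemannZeta]
  simp
  ring

theorem Xi_decomp {c : ℝ} (hc : 1/2 < c) : ∃ (G G' : ℝ → ℂ) (C : ℝ), LogLike G G' C ∧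
    ∀ t, logDeriv Xi (wl c t) = Complex.I * (G t -
      ∑' n : ℕ, (vL n : ℂ) * Complex.exp (-(Complex.I * (Real.log n : ℝ) * wl c t))) := by
  obtain ⟨C1, hC1, h1⟩ := inv_der (1/2 + c) (by linarith)
  obtain ⟨C2, hC2, h2⟩ := inv_der (c - 1/2) (by linarith)
  obtain ⟨C3, hC3, h3⟩ := digamma_der (σ := (1/2+c)/2) (by linarith)
  obtain ⟨C4, hC4, h4⟩ := digamma_log (σ := (1/2+c)/2) (by linarith)
  choose d1 hd1 hD1 hn1 using h1
  choose d2 hd2 hD2 hn2 using h2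
  choose d3 hd3 hD3 using h3
  refine ⟨fun t => 1 / (((1/2 + c : ℝ):ℂ) + t * Complex.I) + 1 / (((c - 1/2 : ℝ):ℂ) + t * Complex.I)
    + (-(Complex.log π) / 2 + logDeriv Complex.Gamma ((((1/2+c)/2 : ℝ):ℂ) + (t/2 : ℝ) * Complex.I) / 2),
    fun t => d1 t + d2 t + (d3 (t/2) * (1/2 : ℝ)) / 2, C1 + C2 + ‖Complex.log π‖ + C4 + C3 + 1, ?_, ?_⟩
  · refine ⟨by positivity, fun t => ?_, fun t => ?_, fun t => ?_⟩
    · refine ((hD1 t).add (hD2 t)).add ((HasDerivAt.div_const ?_ 2).const_add _)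
      have := HasDerivAt.scomp t (hD3 (t/2)) ((hasDerivAt_id t).div_const 2)
      simp only [Complex.real_smul] at this
      rw [mul_comm]
      exact this
    · have h5 := h4 (t/2)
      have hl : |Real.log (2 + |t/2|) - Real.log (2 + |t|)| ≤ 1 := by
        rw [abs_sub_comm, abs_of_nonneg, ← Real.log_div (by positivity) (by positivity)]
        · have h6 := Real.log_le_sub_one_of_pos (show 0 < (2 + |t|) / (2 + |t/2|) by positivity)
          have : (2 + |t|) / (2 + |t/2|) ≤ 2 := by
            rw [div_le_iff₀ (by positivity), abs_div, abs_two]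
            linarith [abs_nonneg t]
          linarith
        · rw [sub_nonneg]
          apply Real.log_le_log (by positivity)
          rw [abs_div, abs_two]
          linarith [abs_nonneg t]
      set X := logDeriv Complex.Gamma ((((1/2+c)/2 : ℝ):ℂ) + (t/2 : ℝ) * Complex.I)
      set Y1 := 1 / (((1/2 + c : ℝ):ℂ) + t * Complex.I)
      set Y2 := 1 / (((c - 1/2 : ℝ):ℂ) + t * Complex.I)
      have e : Y1 + Y2 + (-(Complex.log π) / 2 + X / 2) - ((Real.log (2 + |t|) / 2 : ℝ) : ℂ)
        = Y1 + Y2 + (-(Complex.log π)/2) + (X - (Real.log (2 + |t/2|) : ℝ)) / 2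
          + (((Real.log (2 + |t/2|) - Real.log (2 + |t|)) / 2 : ℝ) : ℂ) := by
        push_cast; ring
      rw [e]
      have n1 : ‖(-(Complex.log π)/2 : ℂ)‖ ≤ ‖Complex.log π‖ := by
        rw [norm_div, norm_neg]; simp
      have n2 : ‖(X - (Real.log (2 + |t/2|) : ℝ)) / 2‖ ≤ C4 := by
        rw [norm_div]; simp only [Complex.norm_ofNat]; linarith
      have n3 : ‖(((Real.log (2 + |t/2|) - Real.log (2 + |t|)) / 2 : ℝ) : ℂ)‖ ≤ 1 := by
        rw [Complex.norm_real, Real.norm_eq_abs, abs_div, abs_two]; linarith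
      refine (norm_add_le _ _).trans ?_
      have n4 := norm_add₄_le (a := Y1) (b := Y2) (c := -(Complex.log π)/2) (d := (X - (Real.log (2 + |t/2|) : ℝ)) / 2)
      have := hn1 t
      have := hn2 t
      linarith
    · have h5 := hd3 (t/2)
      have : C3 / (1 + |t/2|) ≤ 2 * (C3 / (1 + |t|)) := by
        rw [← mul_div_assoc, div_le_div_iff₀ (by positivity) (by positivity), abs_div, abs_two]
        nlinarith [abs_nonneg t]
      have n3 : ‖(d3 (t/2) * (1/2 : ℝ)) / 2‖ ≤ C3 / (1 + |t|) := by
        have : ‖(d3 (t/2) * (1/2 : ℝ)) / 2‖ = ‖d3 (t/2)‖ / 4 := by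
          rw [norm_div, norm_mul, Complex.norm_real]; simp; ring
        rw [this]
        have : 0 ≤ C3 / (1 + |t|) := by positivity
        linarith
      refine (norm_add₃_le).trans ?_
      have : C1 / (1 + |t|) + C2 / (1 + |t|) + C3 / (1 + |t|) ≤ (C1 + C2 + ‖Complex.log π‖ + C4 + C3 + 1) / (1 + |t|) := by
        rw [← add_div, ← add_div]
        apply div_le_div_of_nonneg_right _ (by positivity)
        linarith [norm_nonneg (Complex.log π)]
      linarith [hd1 t, hd2 t]
  · intro t
    have hre : 1 < (((1/2 + c : ℝ):ℂ) + t * Complex.I).re := by simp; linarith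
    have e1 : logDeriv Xi (wl c t) = logDeriv xi (1/2 + Complex.I * wl c t) * Complex.I := by
      have h : HasDerivAt (fun z : ℂ => 1/2 + Complex.I * z) Complex.I (wl c t) := by
        simpa using ((hasDerivAt_id (wl c t)).const_mul Complex.I).const_add (1/2 : ℂ)
      have := logDeriv_comp (f := xi) (g := fun z : ℂ => 1/2 + Complex.I * z) (x := wl c t)
        (xi_diff _) h.differentiableAt
      rw [h.deriv] at this
      exact this
    rw [e1, mul_comm]
    congr 1
    have e2 : ∑' n : ℕ, (vL n : ℂ) * Complex.exp (-(Complex.I * (Real.log n : ℝ) * wl c t))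
        = - deriv riemannZeta (1/2 + Complex.I * wl c t) / riemannZeta (1/2 + Complex.I * wl c t) := by
      rw [← ArithmeticFunction.LSeries_vonMangoldt_eq_deriv_riemannZeta_div (by rw [half_wl]; exact hre)]
      exact tsum_congr fun n => (vL_term n _).symm
    rw [e2, half_wl, xi_logDeriv hre, Gammaℝ_logDeriv (by linarith)]
    have e3 : (((1/2 + c : ℝ):ℂ) + t * Complex.I) - 1 = ((c - 1/2 : ℝ):ℂ) + t * Complex.I := by
      push_cast; ring
    have e4 : (((1/2 + c : ℝ):ℂ) + t * Complex.I) / 2 = (((1/2+c)/2 : ℝ):ℂ) + (t/2 : ℝ) * Complex.I := by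
      push_cast; ring
    rw [e3, e4]
    ring

end

section

def gg (u W v : ℝ) : ℂ := (W * √(2 * π) : ℝ) * Complex.exp (Complex.I * u * v - W ^ 2 * v ^ 2 / 2)

lemma gg_norm (u v : ℝ) {W : ℝ} (hW : 0 < W) : ‖gg u W v‖ = W * √(2*π) * Real.exp (-(W^2 * v^2 / 2)) := by
  unfold gg
  rw [norm_mul, Complex.norm_of_nonneg (by positivity), Complex.norm_exp]
  congr 2
  have : (Complex.I * u * v - W ^ 2 * v ^ 2 / 2 : ℂ) = ((-(W^2 * v^2/2) : ℝ):ℂ) + ((u*v:ℝ):ℂ) * Complex.I := by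
    push_cast; ring
  rw [this]
  simp [-Complex.ofReal_mul, -Complex.ofReal_neg, -Complex.ofReal_div, -Complex.ofReal_pow]

lemma int_Gt_wl (u y c : ℝ) {W : ℝ} (hW : 0 < W) : ∫ t, Gt u W y (wl c t) = gg u W y :=
  Gt_integral u y (-c) hW

lemma neg_wl (c t : ℝ) : -(wl c t) = wl (-c) (-t) := by
  unfold wl; push_cast; ring

lemma int_Gt_wl_neg (u y c : ℝ) {W : ℝ} (hW : 0 < W) : ∫ t, Gt u W y (-(wl c t)) = gg u W y := by
  simp_rw [neg_wl]
  rw [integral_neg_eq_self (fun t => Gt u W y (wl (-c) t))]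
  exact int_Gt_wl u y (-c) hW

lemma Hl_cont (u W y c : ℝ) : Continuous (Hl u W y c) := by
  have := Gt_cont u W y
  have := wl_cont c
  unfold Hl; fun_prop

lemma Hl_int (u y c : ℝ) {W : ℝ} (hW : 0 < W) : Integrable (Hl u W y c) :=
  (Gt_wl_int u y c hW).add (Gt_wl_neg_int u y c hW)

lemma Hl_exp (u W y x c t : ℝ) : Hl u W y c t * Complex.exp (-(Complex.I * x * wl c t))
    = Gt u W (y - x) (wl c t) + Gt u W (y + x) (-(wl c t)) := by
  unfold Hl
  rw [add_mul, Gt_mul_exp]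
  congr 1
  have := Gt_mul_exp u W y (-x) (-(wl c t))
  rw [sub_neg_eq_add] at this
  rw [← this]
  congr 2
  push_cast
  ring

lemma LogLike.bd {G G' : ℝ → ℂ} {C : ℝ} (h : LogLike G G' C) (t : ℝ) :
    ‖G t‖ ≤ C + Real.log (2 + |t|) / 2 := by
  have h1 := h.size t
  have h2 := norm_sub_norm_le (G t) ((Real.log (2 + |t|) / 2 : ℝ) : ℂ)
  have h3 : 0 ≤ Real.log (2 + |t|) := Real.log_nonneg (by linarith [abs_nonneg t])
  rw [Complex.norm_of_nonneg (by positivity)] at h2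
  linarith

lemma LogLike.bd2 {G G' : ℝ → ℂ} {C : ℝ} (h : LogLike G G' C) (t : ℝ) :
    ‖G t‖ ≤ (C + 1) * (1 + t^2)^2 := by
  have h1 := h.bd t
  have h2 := Real.log_le_sub_one_of_pos (show 0 < 2 + |t| by positivity)
  have h3 := h.nn
  have h4 : |t| ≤ 1 + t^2 := by rw [← sq_abs]; nlinarith [sq_nonneg (|t| - 1)]
  have h5 : 1 + t^2 ≤ (1 + t^2)^2 := by nlinarith [sq_nonneg t]
  nlinarith [sq_nonneg t]

lemma LogLike.cont {G G' : ℝ → ℂ} {C : ℝ} (h : LogLike G G' C) : Continuous G :=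
  continuous_iff_continuousAt.2 fun t => (h.der t).continuousAt

lemma LogLike.neg {G G' : ℝ → ℂ} {C : ℝ} (h : LogLike G G' C) :
    LogLike (fun t => G (-t)) (fun t => - G' (-t)) C := by
  refine ⟨h.nn, fun t => ?_, fun t => ?_, fun t => ?_⟩
  · simpa using! HasDerivAt.scomp t (h.der (-t)) (hasDerivAt_neg t)
  · simpa using h.size (-t)
  · simpa using h.dsize (-t)

lemma Gt_G_int {G G' : ℝ → ℂ} {C : ℝ} (h : LogLike G G' C) (u y c : ℝ) {W : ℝ} (hW : 0 < W) :
    Integrable fun t => Gt u W y (wl c t) * G t := by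
  have h1 := (gauss_poly_int u hW).mul_const ((C+1) * (Real.exp (c ^ 2 / (2 * W ^ 2)) * Real.exp (y * c)))
  refine h1.mono' ?_ (Eventually.of_forall fun t => ?_)
  · have := Gt_cont u W y
    have := wl_cont c
    have := h.cont
    exact Continuous.aestronglyMeasurable (by fun_prop)
  · rw [norm_mul, Gt_wl_norm]
    have := h.bd2 t
    calc _ ≤ Real.exp (-(t - u) ^ 2 / (2 * W ^ 2)) * Real.exp (c ^ 2 / (2 * W ^ 2)) * Real.exp (y * c) * ((C + 1) * (1 + t^2)^2) := by gcongr
      _ = _ := by ring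

lemma Hl_G_split {G G' : ℝ → ℂ} {C : ℝ} (h : LogLike G G' C) (u y c : ℝ) {W : ℝ} (hW : 0 < W) :
    Integrable (fun t => Hl u W y c t * G t) ∧ ∫ t, Hl u W y c t * G t =
      (∫ t, Gt u W y (wl c t) * G t) + ∫ t, Gt u W y (wl (-c) t) * G (-t) := by
  have i1 := Gt_G_int h u y c hW
  have i2 := Gt_G_int h.neg u y (-c) hW
  have i3 : Integrable fun t => Gt u W y (-(wl c t)) * G t := by
    have := i2.comp_neg
    simpa [neg_wl] using this
  have e : (fun t => Hl u W y c t * G t) = fun t => Gt u W y (wl c t) * G t + Gt u W y (-(wl c t)) * G t := by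
    ext t; unfold Hl; ring
  rw [e]
  refine ⟨i1.add i3, ?_⟩
  rw [integral_add i1 i3]
  congr 1
  rw [← integral_neg_eq_self]
  simp [neg_wl]

def SS (u W y : ℝ) : ℂ := ∑' γ : Zt Xi, (zm Xi γ : ℂ) * Gt u W y (γ : ℝ)

theorem expl (hRH : RiemannHypothesis) {c : ℝ} (hc : 1/2 < c) {G G' : ℝ → ℂ} {C : ℝ} (hG : LogLike G G' C)
    (hXi : ∀ t, logDeriv Xi (wl c t) = Complex.I * (G t -
      ∑' n : ℕ, (vL n : ℂ) * Complex.exp (-(Complex.I * (Real.log n : ℝ) * wl c t))))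
    (u y : ℝ) {W : ℝ} (hW : 0 < W) :
    2 * π * SS u W y = (∫ t, Gt u W y (wl c t) * G t) + (∫ t, Gt u W y (wl (-c) t) * G (-t))
      - ∑' n : ℕ, (vL n : ℂ) * (gg u W (y - Real.log n) + gg u W (y + Real.log n)) := by
  have h := explicit_gen (Xi_good hRH) u y (show 0 < c by linarith) hW
  obtain ⟨i1, e1⟩ := Hl_G_split hG u y c hW
  set F : ℕ → ℝ → ℂ := fun n t => (vL n : ℂ) * (Hl u W y c t * Complex.exp (-(Complex.I * (Real.log n : ℝ) * wl c t))) with hF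
  have hFn : ∀ n t, ‖F n t‖ = vL n * Real.exp (-(c * Real.log n)) * ‖Hl u W y c t‖ := by
    intro n t
    rw [← vL_term_norm n c t, hF]
    simp only [norm_mul]
    ring
  have hFi : ∀ n, Integrable (F n) := by
    intro n
    have := Hl_cont u W y c
    have := wl_cont c
    refine ((Hl_int u y c hW).norm.const_mul (vL n * Real.exp (-(c * Real.log n)))).mono' ?_
      (Eventually.of_forall fun t => (hFn n t).le)
    exact Continuous.aestronglyMeasurable (by fun_prop)
  have hFs : Summable fun n => ∫ t, ‖F n t‖ := by
    simp_rw [hFn, integral_const_mul]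
    exact (vL_summable hc).mul_right _
  have hFe : ∀ n, ∫ t, F n t = (vL n : ℂ) * (gg u W (y - Real.log n) + gg u W (y + Real.log n)) := by
    intro n
    simp only [hF]
    rw [integral_const_mul]
    simp_rw [Hl_exp]
    rw [integral_add (Gt_wl_int _ _ _ hW) (Gt_wl_neg_int _ _ _ hW), int_Gt_wl _ _ _ hW, int_Gt_wl_neg _ _ _ hW]
  have hts := hasSum_integral_of_summable_integral_norm hFi hFs
  have i2 : Integrable fun t => ∑' n, F n t := by
    refine ((Hl_int u y c hW).norm.const_mul (∑' n, vL n * Real.exp (-(c * Real.log n)))).mono' ?_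
      (Eventually.of_forall fun t => ?_)
    · refine AEStronglyMeasurable.congr (f := fun t => Hl u W y c t * ∑' n : ℕ, (vL n : ℂ) * Complex.exp (-(Complex.I * (Real.log n : ℝ) * wl c t))) ?_ ?_
      · have h1 := Hl_cont u W y c
        have h2 := wl_cont c
        refine Continuous.aestronglyMeasurable (h1.mul ?_)
        refine continuous_tsum (fun n => by fun_prop) (vL_summable hc) fun n t => (vL_term_norm n c t).le
      · refine Eventually.of_forall fun t => ?_
        simp only [hF]
        rw [← tsum_mul_left]
        exact tsum_congr fun n => by ring
    · have hs : Summable fun n => ‖F n t‖ := by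
        simp_rw [hFn]; exact (vL_summable hc).mul_right _
      refine (norm_tsum_le_tsum_norm hs).trans ?_
      simp_rw [hFn]
      rw [tsum_mul_right]
  have e2 : ∫ t, Hl u W y c t * logDeriv Xi (wl c t) = Complex.I * ((∫ t, Hl u W y c t * G t) - ∫ t, ∑' n, F n t) := by
    rw [← integral_sub i1 i2, ← integral_const_mul]
    congr 1
    ext t
    rw [hXi]
    simp only [hF]
    have : ∑' n : ℕ, (vL n : ℂ) * (Hl u W y c t * Complex.exp (-(Complex.I * (Real.log n : ℝ) * wl c t)))
        = Hl u W y c t * ∑' n : ℕ, (vL n : ℂ) * Complex.exp (-(Complex.I * (Real.log n : ℝ) * wl c t)) := by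
      rw [← tsum_mul_left]
      exact tsum_congr fun n => by ring
    rw [this]
    ring
  rw [h, e1, ← hts.tsum_eq] at e2
  simp_rw [hFe] at e2
  have hI := Complex.I_ne_zero
  apply mul_left_cancel₀ hI
  rw [← e2]
  unfold SS
  ring

end

section

lemma quart_gauss (x : ℝ) : (1 + x^2)^2 ≤ 64 * Real.exp (x^2/4) := by
  have h := Real.add_one_le_exp (x^2/8)
  have h2 : 1 + x^2 ≤ 8 * Real.exp (x^2/8) := by nlinarith [sq_nonneg x]
  calc (1 + x^2)^2 ≤ (8 * Real.exp (x^2/8))^2 := by gcongr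
    _ = 64 * (Real.exp (x^2/8) * Real.exp (x^2/8)) := by ring
    _ = _ := by rw [← Real.exp_add]; congr 2; ring

lemma K_quart (u : ℝ) {W : ℝ} (hW : 0 < W) (t : ℝ) :
    (1 + ((t-u)/W)^2)^2 * Real.exp (-(t - u) ^ 2 / (2 * W ^ 2)) ≤ 64 * Real.exp (-(t - u) ^ 2 / (2 * (√2 * W) ^ 2)) := by
  calc _ ≤ 64 * Real.exp (((t-u)/W)^2/4) * Real.exp (-(t - u) ^ 2 / (2 * W ^ 2)) := by
        gcongr; exact quart_gauss _
    _ = _ := by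
        rw [mul_assoc, ← Real.exp_add, mul_pow, Real.sq_sqrt (by norm_num)]
        congr 2
        field_simp
        ring

lemma sqrt2pi_le : √(2*π) ≤ 2.6 := by
  rw [Real.sqrt_le_left (by norm_num)]
  have := Real.pi_lt_d2
  nlinarith

lemma K_quart_int (u : ℝ) {W : ℝ} (hW : 0 < W) :
    Integrable (fun t => (1 + ((t-u)/W)^2)^2 * Real.exp (-(t - u) ^ 2 / (2 * W ^ 2))) := by
  refine ((gauss_integrable u (W := √2 * W) (by positivity)).const_mul 64).mono' ?_
    (Eventually.of_forall fun t => ?_)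
  · exact Continuous.aestronglyMeasurable (by fun_prop)
  · rw [Real.norm_of_nonneg (by positivity)]
    exact K_quart u hW t

lemma K_quart_le (u : ℝ) {W : ℝ} (hW : 0 < W) :
    ∫ t, (1 + ((t-u)/W)^2)^2 * Real.exp (-(t - u) ^ 2 / (2 * W ^ 2)) ≤ 250 * W := by
  calc _ ≤ ∫ t, 64 * Real.exp (-(t - u) ^ 2 / (2 * (√2 * W) ^ 2)) :=
        integral_mono (K_quart_int u hW) ((gauss_integrable u (W := √2 * W) (by positivity)).const_mul 64)
          fun t => K_quart u hW t
    _ = 64 * (√2 * W * √(2*π)) := by rw [integral_const_mul, gauss_integral u (by positivity)]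
    _ ≤ 64 * (1.5 * W * 2.6) := by
        gcongr
        · rw [Real.sqrt_le_left (by norm_num)]; norm_num
        · exact sqrt2pi_le
    _ ≤ _ := by nlinarith

/-- standing size assumptions -/
structure Sz (T W : ℝ) : Prop where
  T8 : 20 ≤ T
  L2 : 2 ≤ Real.log T
  lo : T / Real.log T ≤ W
  hi : W ≤ 2 * T / Real.log T

lemma Sz.Wpos {T W : ℝ} (h : Sz T W) : 0 < W := by
  have := h.T8; have := h.L2
  exact lt_of_lt_of_le (by positivity) h.lo

lemma Sz.WT {T W : ℝ} (h : Sz T W) : W ≤ T := by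
  have := h.T8; have := h.L2
  refine h.hi.trans ?_
  rw [div_le_iff₀ (by linarith)]
  nlinarith

lemma Sz.W1 {T W : ℝ} (h : Sz T W) : 1 ≤ W := by
  have := h.T8; have := h.L2
  refine le_trans ?_ h.lo
  rw [le_div_iff₀ (by linarith)]
  have := Real.log_le_sub_one_of_pos (show 0 < T by linarith)
  linarith

lemma Sz.LW {T W : ℝ} (h : Sz T W) : Real.log T ≤ W ^ 2 := by
  have h1 := h.T8; have := h.L2
  have hT0 : 0 < T := by linarith
  have h3 : Real.log T ^ 3 ≤ T ^ 2 := by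
    have h4 := Real.log_le_sub_one_of_pos (show 0 < √T by positivity)
    have h5 : Real.log T = 2 * Real.log √T := by rw [Real.log_sqrt hT0.le]; ring
    have h6 : Real.log √T = 2 * Real.log √√T := by rw [Real.log_sqrt (Real.sqrt_nonneg T)]; ring
    have h7 := Real.log_le_sub_one_of_pos (show 0 < √√T by positivity)
    set q := √√T with hq
    have hq2 : q^2 = √T := Real.sq_sqrt (by positivity)
    have hT4 : T = q^4 := by
      rw [show q^4 = (q^2)^2 by ring, hq2, Real.sq_sqrt hT0.le]
    have hL : Real.log T ≤ 4 * (q - 1) := by rw [h5, h6]; linarith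
    have hq0 : 0 < q := by positivity
    have hq1 : 2 ≤ q := by
      by_contra hcon
      push Not at hcon
      have : q^4 < 2^4 := by gcongr
      linarith
    calc Real.log T ^ 3 ≤ (4 * (q-1))^3 := by gcongr
      _ ≤ T^2 := by
        rw [hT4]
        have e : (q^4)^2 = q^3 * q^5 := by ring
        rw [e]
        have a3 : 4 * (q-1) ≤ q^2 := by nlinarith [sq_nonneg (q-2)]
        have a4 : (4*(q-1))^3 ≤ (q^2)^3 := by gcongr; linarith
        have a5 : (q^2)^3 ≤ q^3*q^5 := by
          have : (1:ℝ) ≤ q^2 := by nlinarith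
          calc (q^2)^3 = q^6 * 1 := by ring
            _ ≤ q^6 * q^2 := by gcongr
            _ = _ := by ring
        linarith
  calc Real.log T = Real.log T ^ 3 / Real.log T ^ 2 := by field_simp
    _ ≤ T^2 / Real.log T ^ 2 := by gcongr
    _ = (T / Real.log T)^2 := by rw [div_pow]
    _ ≤ _ := by gcongr; exact h.lo

lemma log_up {T W u : ℝ} (h : Sz T W) (hu : |u| ≤ 2*T) (t : ℝ) :
    Real.log (2 + |t|) ≤ Real.log T + 3 + ((t-u)/W)^2 := by
  have h1 := h.T8
  have hT0 : 0 < T := by linarith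
  have hW := h.Wpos
  have h2 : 2 + |t| ≤ T * (4 * (1 + |t-u|/W)) := by
    have : |t| ≤ |t-u| + |u| := by simpa using abs_add_le (t-u) u
    have h3 : |t-u| ≤ T * (|t-u|/W) := by
      rw [← mul_div_assoc, le_div_iff₀ hW, mul_comm]
      exact mul_le_mul_of_nonneg_right h.WT (abs_nonneg _)
    have : 0 ≤ T * (|t-u|/W) := by positivity
    nlinarith
  have h3 := Real.log_le_log (by positivity) h2
  rw [Real.log_mul hT0.ne' (by positivity), Real.log_mul (by norm_num) (by positivity)] at h3
  have h4 := Real.log_le_sub_one_of_pos (show 0 < 1 + |t-u|/W by positivity)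
  have h5 : Real.log 4 ≤ 2 := by
    have : Real.log 4 = 2 * Real.log 2 := by
      rw [show (4:ℝ) = 2^2 by norm_num, Real.log_pow]; norm_num
    linarith [Real.log_two_lt_d9]
  have h6 : ((t-u)/W)^2 = (|t-u|/W)^2 := by rw [div_pow, div_pow, sq_abs]
  rw [h6]
  nlinarith [sq_nonneg (|t-u|/W - 1)]

lemma log_near {δ : ℝ} (hδ : 0 < δ) : ∃ C : ℝ, 0 ≤ C ∧ ∀ T W u : ℝ, Sz T W → δ * T ≤ u → u ≤ 2*T → ∀ t,
    |Real.log (2 + |t|) - Real.log T| ≤ C * (1 + ((t-u)/W)^2) := by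
  refine ⟨3 + |Real.log (δ/2)| + 16/δ^2, by positivity, fun T W u h h1 h2 t => ?_⟩
  have hT := h.T8
  have hT0 : 0 < T := by linarith
  have hW := h.Wpos
  have hL := h.L2
  have hu0 : 0 < u := lt_of_lt_of_le (by positivity) h1
  have hup := log_up h (by rw [abs_of_pos hu0]; exact h2) t
  set x2 := ((t-u)/W)^2 with hx2
  have hx : 0 ≤ x2 := sq_nonneg _
  have ha := abs_nonneg (Real.log (δ/2))
  have hd : 0 ≤ 16/δ^2 := by positivity
  rw [abs_le]
  constructor
  · by_cases hc : u/2 ≤ |t|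
    · have h3 : T * (δ/2) ≤ 2 + |t| := by nlinarith
      have h4 := Real.log_le_log (by positivity) h3
      rw [Real.log_mul hT0.ne' (by positivity)] at h4
      have := neg_abs_le (Real.log (δ/2))
      nlinarith [mul_nonneg ha hx, mul_nonneg hd hx]
    · push Not at hc
      have h3 : u/2 ≤ |t-u| := by
        have := abs_sub_abs_le_abs_sub u t
        rw [abs_of_pos hu0, abs_sub_comm] at this
        linarith
      have h4 : δ * Real.log T / 4 ≤ |t-u|/W := by
        rw [le_div_iff₀ hW]
        have : δ * Real.log T / 4 * W ≤ δ * Real.log T / 4 * (2 * T / Real.log T) := by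
          gcongr; exact h.hi
        have e : δ * Real.log T / 4 * (2 * T / Real.log T) = δ * T / 2 := by field_simp; ring
        linarith
      have h5 : (δ * Real.log T / 4)^2 ≤ x2 := by
        have : x2 = (|t-u|/W)^2 := by rw [hx2, div_pow, div_pow, sq_abs]
        rw [this]; gcongr
      have h6 : 16/δ^2 * (δ * Real.log T / 4)^2 = Real.log T ^2 := by field_simp; ring
      have h7 : Real.log T ^2 ≤ 16/δ^2 * x2 := by rw [← h6]; gcongr
      have h8 : 0 ≤ Real.log (2 + |t|) := Real.log_nonneg (by linarith [abs_nonneg t])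
      nlinarith [mul_nonneg ha hx]
  · nlinarith [mul_nonneg ha hx, mul_nonneg hd hx]

lemma exp_c_le {T W : ℝ} (h : Sz T W) (c : ℝ) : Real.exp (c^2/(2*W^2)) ≤ Real.exp (c^2) := by
  apply Real.exp_le_exp.2
  have := h.W1
  apply div_le_self (by positivity)
  nlinarith

lemma near_G {G G' : ℝ → ℂ} {C : ℝ} (hG : LogLike G G' C) {δ : ℝ} (hδ : 0 < δ) (c : ℝ) :
    ∃ C1 : ℝ, 0 ≤ C1 ∧ ∀ T W u : ℝ, Sz T W → δ * T ≤ u → u ≤ 2*T → ∀ y, |y| ≤ 1 →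
    ‖(∫ t, Gt u W y (wl c t) * G t) - (Real.log T / 2 : ℝ) * gg u W y‖ ≤ C1 * W := by
  obtain ⟨Cd, hCd, hlog⟩ := log_near hδ
  have hC := hG.nn
  refine ⟨Real.exp (c^2) * Real.exp |c| * (C + Cd) * 250, by positivity, fun T W u h h1 h2 y hy => ?_⟩
  have hW := h.Wpos
  rw [← int_Gt_wl u y c hW, ← integral_const_mul, ← integral_sub (Gt_G_int hG u y c hW) ((Gt_wl_int u y c hW).const_mul _)]
  calc _ ≤ ∫ t, Real.exp (c^2) * Real.exp |c| * (C + Cd) * ((1 + ((t-u)/W)^2)^2 * Real.exp (-(t - u) ^ 2 / (2 * W ^ 2))) := by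
        apply norm_integral_le_of_norm_le ((K_quart_int u hW).const_mul _)
        refine Eventually.of_forall fun t => ?_
        have e : Gt u W y (wl c t) * G t - (Real.log T / 2 : ℝ) * Gt u W y (wl c t)
          = Gt u W y (wl c t) * ((G t - ((Real.log (2 + |t|) / 2 : ℝ) : ℂ)) + (((Real.log (2 + |t|) - Real.log T)/2 : ℝ) : ℂ)) := by
          push_cast; ring
        rw [e, norm_mul, Gt_wl_norm]
        have n1 : ‖(G t - ((Real.log (2 + |t|) / 2 : ℝ) : ℂ)) + (((Real.log (2 + |t|) - Real.log T)/2 : ℝ) : ℂ)‖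
            ≤ (C + Cd) * (1 + ((t-u)/W)^2)^2 := by
          refine (norm_add_le _ _).trans ?_
          rw [Complex.norm_real, Real.norm_eq_abs, abs_div, abs_two]
          have := hG.size t
          have h3 := hlog T W u h h1 h2 t
          set x2 := ((t-u)/W)^2
          have hx : 0 ≤ x2 := sq_nonneg _
          nlinarith [mul_nonneg hC hx, mul_nonneg hCd hx, mul_nonneg hC (mul_nonneg hx hx), mul_nonneg hCd (mul_nonneg hx hx)]
        have n2 : Real.exp (y*c) ≤ Real.exp |c| := by
          apply Real.exp_le_exp.2
          calc y*c ≤ |y*c| := le_abs_self _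
            _ = |y| * |c| := abs_mul _ _
            _ ≤ 1 * |c| := by gcongr
            _ = _ := one_mul _
        calc _ ≤ Real.exp (-(t - u) ^ 2 / (2 * W ^ 2)) * Real.exp (c ^ 2) * Real.exp |c| * ((C + Cd) * (1 + ((t-u)/W)^2)^2) := by
              gcongr
              exact Real.exp_le_exp.1 (exp_c_le h c)
          _ = _ := by ring
    _ ≤ _ := by
        rw [integral_const_mul, mul_assoc _ 250 W]
        gcongr
        exact K_quart_le u hW

lemma up_G {G G' : ℝ → ℂ} {C : ℝ} (hG : LogLike G G' C) (c : ℝ) :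
    ∃ C1 : ℝ, 0 ≤ C1 ∧ ∀ T W u : ℝ, Sz T W → |u| ≤ 2*T →
    ‖∫ t, Gt u W 0 (wl c t) * G t‖ ≤ W * √(2*π) * (Real.log T / 2) + C1 * W := by
  have hC := hG.nn
  refine ⟨Real.exp (c^2) * (C + 2) * 250 + Real.exp (c^2) * c^2 * 2.6, by positivity, fun T W u h h1 => ?_⟩
  have hW := h.Wpos
  have hW1 := h.W1
  have hL := h.L2
  have i1 := ((gauss_integrable u hW).const_mul (Real.exp (c^2/(2*W^2)) * (Real.log T/2))).add
    ((K_quart_int u hW).const_mul (Real.exp (c^2) * (C + 2)))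
  calc _ ≤ ∫ t, ((Real.exp (c^2/(2*W^2)) * (Real.log T/2)) * Real.exp (-(t - u) ^ 2 / (2 * W ^ 2)) + Real.exp (c^2) * (C + 2) * ((1 + ((t-u)/W)^2)^2 * Real.exp (-(t - u) ^ 2 / (2 * W ^ 2)))) := by
        apply norm_integral_le_of_norm_le i1
        refine Eventually.of_forall fun t => ?_
        rw [norm_mul, Gt_wl_norm]
        have h2 := hG.bd t
        have h3 := log_up h h1 t
        have h4 : ‖G t‖ ≤ Real.log T/2 + (C + 2) * (1 + ((t-u)/W)^2)^2 := by
          set x2 := ((t-u)/W)^2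
          have hx : 0 ≤ x2 := sq_nonneg _
          nlinarith [mul_nonneg hC hx, mul_nonneg hC (mul_nonneg hx hx), mul_nonneg hx hx]
        simp only [zero_mul, Real.exp_zero, mul_one]
        calc _ ≤ Real.exp (-(t - u) ^ 2 / (2 * W ^ 2)) * Real.exp (c ^ 2 / (2 * W ^ 2)) * (Real.log T/2 + (C + 2) * (1 + ((t-u)/W)^2)^2) := by gcongr
          _ = (Real.exp (c^2/(2*W^2)) * (Real.log T/2)) * Real.exp (-(t - u) ^ 2 / (2 * W ^ 2)) + Real.exp (c^2/(2*W^2)) * (C + 2) * ((1 + ((t-u)/W)^2)^2 * Real.exp (-(t - u) ^ 2 / (2 * W ^ 2))) := by ring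
          _ ≤ _ := by
            have h10 := exp_c_le h c
            have h11 : 0 ≤ (C+2) * ((1 + ((t-u)/W)^2)^2 * Real.exp (-(t - u) ^ 2 / (2 * W ^ 2))) := by positivity
            have h12 := mul_le_mul_of_nonneg_right h10 h11
            simp only [Pi.add_apply]
            rw [mul_assoc _ (C+2) _, mul_assoc _ (C+2) _]
            exact add_le_add_right h12 _
    _ = (Real.exp (c^2/(2*W^2)) * (Real.log T/2)) * (W * √(2*π)) + Real.exp (c^2) * (C + 2) * ∫ t, (1 + ((t-u)/W)^2)^2 * Real.exp (-(t - u) ^ 2 / (2 * W ^ 2)) := by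
        rw [integral_add ((gauss_integrable u hW).const_mul _) ((K_quart_int u hW).const_mul _), integral_const_mul, integral_const_mul, gauss_integral u hW]
    _ ≤ ((1 + Real.exp (c^2) * (c^2 / W^2)) * (Real.log T/2)) * (W * √(2*π)) + Real.exp (c^2) * (C + 2) * (250 * W) := by
        gcongr
        · set a := c^2/(2*W^2) with ha
          have ha0 : 0 ≤ a := by positivity
          have h5 : 1 - a ≤ Real.exp (-a) := by linarith [Real.add_one_le_exp (-a)]
          have h6 : Real.exp a * Real.exp (-a) = 1 := by rw [← Real.exp_add]; simp
          have h7 : Real.exp a ≤ 1 + Real.exp a * a := by nlinarith [Real.exp_pos a]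
          have h8 : Real.exp a * a ≤ Real.exp (c^2) * (c^2/W^2) := by
            refine mul_le_mul (exp_c_le h c) ?_ ha0 (Real.exp_pos _).le
            rw [ha]
            gcongr
            nlinarith [sq_nonneg W]
          linarith
        · exact K_quart_le u hW
    _ ≤ _ := by
        have h9 : Real.exp (c^2) * (c^2 / W^2) * (Real.log T/2) * (W * √(2*π)) ≤ Real.exp (c^2) * c^2 * 2.6 * W := by
          have : Real.log T / 2 / W^2 ≤ 1 := by
            rw [div_le_one (by positivity)]
            linarith [h.LW]
          calc _ = Real.exp (c^2) * c^2 * (Real.log T/2/W^2) * √(2*π) * W := by ring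
            _ ≤ Real.exp (c^2) * c^2 * 1 * 2.6 * W := by
              gcongr
              exact sqrt2pi_le
            _ = _ := by ring
        nlinarith

end

section

lemma Gt_wl_deriv (u W y c t : ℝ) (hW : 0 < W) :
    HasDerivAt (fun t : ℝ => Gt u W y (wl c t))
      (Gt u W y (wl c t) * (-(wl c t - u)/(W:ℂ)^2 + Complex.I * y)) t := by
  have hW' : (W:ℂ) ≠ 0 := by exact_mod_cast hW.ne'
  have h1 : HasDerivAt (fun t : ℝ => wl c t) 1 t := by
    unfold wl
    exact (Complex.ofRealCLM.hasDerivAt (x := t)).add_const _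
  have h2 : HasDerivAt (fun t : ℝ => -(wl c t - u)^2/(2*(W:ℂ)^2) + Complex.I * y * wl c t)
      (-(wl c t - u)/(W:ℂ)^2 + Complex.I * y) t := by
    have h3 := ((((h1.sub_const (u:ℂ)).pow 2).neg).div_const (2*(W:ℂ)^2)).add (h1.const_mul (Complex.I * y))
    refine h3.congr_deriv ?_
    field_simp
    push_cast
    ring
  exact h2.cexp

lemma inv_gauss {δ : ℝ} (hδ : 0 < δ) : ∃ C1 : ℝ, 0 ≤ C1 ∧ ∀ T W u : ℝ, Sz T W → δ * T ≤ u →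
    Integrable (fun t : ℝ => 1/(1+|t|) * Real.exp (-(t - u) ^ 2 / (2 * W ^ 2))) ∧
    ∫ t : ℝ, 1/(1+|t|) * Real.exp (-(t - u) ^ 2 / (2 * W ^ 2)) ≤ C1 := by
  refine ⟨2/δ * 2.6 + Real.exp (16/δ^2) * (2*2.6), by positivity, fun T W u h h1 => ?_⟩
  have hW := h.Wpos
  have hT0 : 0 < T := by linarith [h.T8]
  have hL := h.L2
  have hu0 : 0 < u := by nlinarith
  have hW2 : 0 < √2 * W := by positivity
  have hW2' : (√2*W)^2 = 2*W^2 := by rw [mul_pow, Real.sq_sqrt (by norm_num)]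
  have hint : Integrable (fun t : ℝ => 1/(1+|t|) * Real.exp (-(t - u) ^ 2 / (2 * W ^ 2))) := by
    apply (gauss_integrable u hW).mono'
    · apply Continuous.aestronglyMeasurable
      have : ∀ t : ℝ, 1 + |t| ≠ 0 := fun t => by positivity
      fun_prop (disch := assumption)
    · refine Eventually.of_forall fun t => ?_
      rw [Real.norm_eq_abs, abs_of_nonneg (by positivity)]
      apply mul_le_of_le_one_left (by positivity)
      rw [div_le_one (by positivity)]
      linarith [abs_nonneg t]
  refine ⟨hint, ?_⟩
  have i2 := ((gauss_integrable u hW).const_mul (2/(δ*T))).add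
    ((gauss_integrable u hW2).const_mul (Real.exp (16/δ^2)/T))
  calc _ ≤ ∫ t : ℝ, (2/(δ*T) * Real.exp (-(t - u) ^ 2 / (2 * W ^ 2)) + Real.exp (16/δ^2)/T * Real.exp (-(t - u) ^ 2 / (2 * (√2*W) ^ 2))) := by
        apply integral_mono hint i2
        intro t
        simp only [Pi.add_apply]
        by_cases hc : u/2 ≤ |t|
        · have : 1/(1+|t|) ≤ 2/(δ*T) := by
            rw [div_le_div_iff₀ (by positivity) (by positivity)]
            linarith
          have := mul_le_mul_of_nonneg_right this (Real.exp_pos (-(t - u) ^ 2 / (2 * W ^ 2))).le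
          have : 0 ≤ Real.exp (16/δ^2)/T * Real.exp (-(t - u) ^ 2 / (2 * (√2*W) ^ 2)) := by positivity
          linarith
        · push Not at hc
          have h3 : u/2 ≤ |t-u| := by
            have := abs_sub_abs_le_abs_sub u t
            rw [abs_of_pos hu0, abs_sub_comm] at this
            linarith
          have h4 : δ * Real.log T / 4 ≤ |t-u|/W := by
            rw [le_div_iff₀ hW]
            have : δ * Real.log T / 4 * W ≤ δ * Real.log T / 4 * (2 * T / Real.log T) := by
              gcongr; exact h.hi
            have e : δ * Real.log T / 4 * (2 * T / Real.log T) = δ * T / 2 := by field_simp; ring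
            linarith
          have h5 : (δ * Real.log T / 4)^2 ≤ (t-u)^2/W^2 := by
            have : (t-u)^2/W^2 = (|t-u|/W)^2 := by rw [div_pow, sq_abs]
            rw [this]; gcongr
          have h6 : 1/(1+|t|) * Real.exp (-(t - u) ^ 2 / (2 * W ^ 2)) ≤ Real.exp (-(t - u) ^ 2 / (2 * W ^ 2)) := by
            apply mul_le_of_le_one_left (by positivity)
            rw [div_le_one (by positivity)]
            linarith [abs_nonneg t]
          have h7 : Real.exp (-(t - u) ^ 2 / (2 * W ^ 2)) ≤ Real.exp (16/δ^2)/T * Real.exp (-(t - u) ^ 2 / (2 * (√2*W) ^ 2)) := by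
            rw [hW2']
            rw [show Real.exp (16/δ^2)/T = Real.exp (16/δ^2 - Real.log T) by rw [Real.exp_sub, Real.exp_log hT0], ← Real.exp_add]
            apply Real.exp_le_exp.2
            have e1 : -(t - u) ^ 2 / (2 * W ^ 2) = -((t-u)^2/W^2)/2 := by ring
            have e2 : -(t - u) ^ 2 / (2 * (2*W ^ 2)) = -((t-u)^2/W^2)/4 := by ring
            rw [e1, e2]
            have e3 : 16/δ^2 - Real.log T + (δ * Real.log T / 4)^2/4 = (4/δ - δ * Real.log T/8)^2 := by
              field_simp; ring
            nlinarith [sq_nonneg (4/δ - δ * Real.log T/8)]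
          have : 0 ≤ 2/(δ*T) * Real.exp (-(t - u) ^ 2 / (2 * W ^ 2)) := by positivity
          linarith
    _ = 2/(δ*T) * (W * √(2*π)) + Real.exp (16/δ^2)/T * (√2 * W * √(2*π)) := by
        rw [integral_add ((gauss_integrable u hW).const_mul _) ((gauss_integrable u hW2).const_mul _), integral_const_mul, integral_const_mul, gauss_integral u hW, gauss_integral u hW2]
    _ ≤ _ := by
        have hWT := h.WT
        have hs := sqrt2pi_le
        have hs2 : √2 ≤ 2 := by
          rw [Real.sqrt_le_left (by norm_num)]; norm_num
        have e1 : 2/(δ*T) * (W * √(2*π)) ≤ 2/(δ*T) * (T * 2.6) := by gcongr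
        have e2 : 2/(δ*T) * (T * 2.6) = 2/δ*2.6 := by field_simp
        have e3 : Real.exp (16/δ^2)/T * (√2 * W * √(2*π)) ≤ Real.exp (16/δ^2)/T * (2 * T * 2.6) := by gcongr
        have e4 : Real.exp (16/δ^2)/T * (2 * T * 2.6) = Real.exp (16/δ^2) * (2*2.6) := by field_simp
        linarith

lemma far_G {G G' : ℝ → ℂ} {C : ℝ} (hG : LogLike G G' C) {δ : ℝ} (hδ : 0 < δ) (c : ℝ) :
    ∃ C1 : ℝ, 0 ≤ C1 ∧ ∀ T W u : ℝ, Sz T W → δ * T ≤ u → u ≤ 2*T → ∀ y, 1/2 ≤ y →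
    ‖∫ t, Gt u W y (wl c t) * G t‖ ≤ C1 * Real.log T * Real.exp (y*c) := by
  obtain ⟨Cg, hCg, hinv⟩ := inv_gauss hδ
  have hC := hG.nn
  refine ⟨2 * Real.exp (c^2) * ((1+|c|) * (C+3) * 250 + C * Cg), by positivity, fun T W u h h1 h2 y hy => ?_⟩
  have hW := h.Wpos
  have hW1 := h.W1
  have hT0 : 0 < T := by linarith [h.T8]
  have hL := h.L2
  have hu0 : 0 < u := by nlinarith
  have hWc : (W:ℂ) ≠ 0 := by exact_mod_cast hW.ne'
  obtain ⟨hi1, hi2⟩ := hinv T W u h h1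
  set F1 : ℝ → ℂ := fun t => Gt u W y (wl c t) * (-(wl c t - u)/(W:ℂ)^2) * G t with hF1
  set F2 : ℝ → ℂ := fun t => Gt u W y (wl c t) * G' t with hF2
  have b1 : ∀ t, ‖F1 t‖ ≤ (Real.exp (c^2) * Real.exp (y*c) * ((1+|c|) * (C+3) * Real.log T / W)) * ((1 + ((t-u)/W)^2)^2 * Real.exp (-(t - u) ^ 2 / (2 * W ^ 2))) := by
    intro t
    rw [hF1]
    simp only [norm_mul, Gt_wl_norm]
    have n1 : ‖-(wl c t - u)/(W:ℂ)^2‖ ≤ (1+|c|) / W * (1 + ((t-u)/W)^2) := by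
      rw [norm_div, norm_neg, norm_pow, Complex.norm_real, Real.norm_eq_abs, abs_of_pos hW]
      have : ‖wl c t - u‖ ≤ |t-u| + |c| := by
        have e : wl c t - u = ((t-u:ℝ):ℂ) + ((-c:ℝ):ℂ) * Complex.I := by unfold wl; push_cast; ring
        rw [e]
        refine (norm_add_le _ _).trans ?_
        simp only [Complex.norm_real, norm_mul, Complex.norm_I, Real.norm_eq_abs, abs_neg, mul_one, le_refl]
      rw [div_le_iff₀ (by positivity)]
      have e2 : (1+|c|) / W * (1 + ((t-u)/W)^2) * W^2 = (1+|c|) * W * (1 + ((t-u)/W)^2) := by field_simp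
      rw [e2]
      have e3 : |t-u| = |(t-u)/W| * W := by rw [abs_div, abs_of_pos hW]; field_simp
      have e4 : |(t-u)/W| ≤ 1 + ((t-u)/W)^2 := by
        nlinarith [sq_abs ((t-u)/W), sq_nonneg (|(t-u)/W| - 1), abs_nonneg ((t-u)/W)]
      set x2 := ((t-u)/W)^2
      have hx : 0 ≤ x2 := sq_nonneg _
      have e5 : |t-u| ≤ (1+x2)*W := by rw [e3]; gcongr
      have e6 : |c| ≤ |c| * (W * (1+x2)) := by
        apply le_mul_of_one_le_right (abs_nonneg _)
        nlinarith
      nlinarith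
    have n2 : ‖G t‖ ≤ (C+3) * Real.log T * (1 + ((t-u)/W)^2) := by
      have h3 := hG.bd t
      have h4 := log_up h (u := u) (by rw [abs_of_pos hu0]; exact h2) t
      set x2 := ((t-u)/W)^2
      have hx : 0 ≤ x2 := sq_nonneg _
      have a1 : 2 * (1+x2) ≤ Real.log T * (1+x2) := by gcongr
      have a2 : C * (2 * (1+x2)) ≤ C * (Real.log T * (1+x2)) := by gcongr
      nlinarith [mul_nonneg hC hx]
    have n3 := exp_c_le h c
    calc _ ≤ Real.exp (-(t - u) ^ 2 / (2 * W ^ 2)) * Real.exp (c ^ 2) * Real.exp (y * c) * ((1+|c|) / W * (1 + ((t-u)/W)^2)) * ((C+3) * Real.log T * (1 + ((t-u)/W)^2)) := by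
          refine mul_le_mul (mul_le_mul ?_ n1 (norm_nonneg _) (by positivity)) n2 (norm_nonneg _) (by positivity)
          exact mul_le_mul_of_nonneg_right (mul_le_mul_of_nonneg_left n3 (Real.exp_pos _).le) (Real.exp_pos _).le
      _ = _ := by ring
  have b2 : ∀ t, ‖F2 t‖ ≤ (Real.exp (c^2) * Real.exp (y*c) * C) * (1/(1+|t|) * Real.exp (-(t - u) ^ 2 / (2 * W ^ 2))) := by
    intro t
    rw [hF2]
    simp only [norm_mul, Gt_wl_norm]
    have n3 := exp_c_le h c
    calc _ ≤ Real.exp (-(t - u) ^ 2 / (2 * W ^ 2)) * Real.exp (c ^ 2) * Real.exp (y * c) * (C/(1+|t|)) := by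
          refine mul_le_mul ?_ (hG.dsize t) (norm_nonneg _) (by positivity)
          exact mul_le_mul_of_nonneg_right (mul_le_mul_of_nonneg_left n3 (Real.exp_pos _).le) (Real.exp_pos _).le
      _ = _ := by ring
  have cG : Continuous fun t : ℝ => Gt u W y (wl c t) :=
    continuous_iff_continuousAt.2 fun t => (Gt_wl_deriv u W y c t hW).continuousAt
  have I1 : Integrable F1 := by
    apply ((K_quart_int u hW).const_mul _).mono' _ (Eventually.of_forall b1)
    have := wl_cont c
    have := hG.cont
    apply Continuous.aestronglyMeasurable
    rw [hF1]
    fun_prop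
  have I2 : Integrable F2 := by
    apply (hi1.const_mul _).mono' _ (Eventually.of_forall b2)
    have : G' = deriv G := funext fun t => ((hG.der t).deriv).symm
    rw [hF2, this]
    exact cG.aestronglyMeasurable.mul (measurable_deriv G).aestronglyMeasurable
  have I3 := Gt_G_int hG u y c hW
  have hz := integral_eq_zero_of_hasDerivAt_of_integrable
    (f := fun t => Gt u W y (wl c t) * G t)
    (f' := fun t => F1 t + F2 t + Complex.I * y * (Gt u W y (wl c t) * G t))
    (fun t => by
      have := (Gt_wl_deriv u W y c t hW).mul (hG.der t)
      refine this.congr_deriv ?_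
      simp only [hF1, hF2]; ring) ((I1.add I2).add (I3.const_mul _)) I3
  have hsum : (∫ t, F1 t + F2 t + Complex.I * y * (Gt u W y (wl c t) * G t))
     = (∫ t, F1 t) + (∫ t, F2 t) + Complex.I * y * ∫ t, (Gt u W y (wl c t) * G t) := by
    rw [← integral_const_mul, ← integral_add I1 I2]
    exact integral_add (I1.add I2) (I3.const_mul _)
  rw [hsum] at hz
  have hy' : ‖Complex.I * y * ∫ t, (Gt u W y (wl c t) * G t)‖ = y * ‖∫ t, (Gt u W y (wl c t) * G t)‖ := by
    rw [norm_mul, norm_mul, Complex.norm_I, one_mul, Complex.norm_real, Real.norm_eq_abs, abs_of_pos (by linarith)]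
  have hE : Complex.I * y * ∫ t, (Gt u W y (wl c t) * G t) = -((∫ t, F1 t) + (∫ t, F2 t)) := by
    linear_combination hz
  have m1 : ‖∫ t, F1 t‖ ≤ (Real.exp (c^2) * Real.exp (y*c) * ((1+|c|) * (C+3) * Real.log T / W)) * (250 * W) := by
    refine (norm_integral_le_of_norm_le ((K_quart_int u hW).const_mul _) (Eventually.of_forall b1)).trans ?_
    rw [integral_const_mul]
    exact mul_le_mul_of_nonneg_left (K_quart_le u hW) (by positivity)
  have m2 : ‖∫ t, F2 t‖ ≤ (Real.exp (c^2) * Real.exp (y*c) * C) * Cg := by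
    refine (norm_integral_le_of_norm_le (hi1.const_mul _) (Eventually.of_forall b2)).trans ?_
    rw [integral_const_mul]
    exact mul_le_mul_of_nonneg_left hi2 (by positivity)
  have m3 : (Real.exp (c^2) * Real.exp (y*c) * ((1+|c|) * (C+3) * Real.log T / W)) * (250 * W)
    = Real.exp (c^2) * Real.exp (y*c) * ((1+|c|) * (C+3) * 250) * Real.log T := by field_simp
  have m4 : (Real.exp (c^2) * Real.exp (y*c) * C) * Cg ≤ (Real.exp (c^2) * Real.exp (y*c) * C) * Cg * Real.log T :=
    le_mul_of_one_le_right (by positivity) (by linarith)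
  have m5 : y * ‖∫ t, (Gt u W y (wl c t) * G t)‖ ≤ ‖∫ t, F1 t‖ + ‖∫ t, F2 t‖ := by
    rw [← hy', hE, norm_neg]; exact norm_add_le _ _
  have m6 : 1/2 * ‖∫ t, (Gt u W y (wl c t) * G t)‖ ≤ y * ‖∫ t, (Gt u W y (wl c t) * G t)‖ := by gcongr
  rw [m3] at m1
  nlinarith

end

section

lemma vL_zero : vL 0 = 0 := by simp [vL]
lemma vL_one : vL 1 = 0 := by simp [vL]

def PrS (u W y : ℝ) : ℂ := ∑' n : ℕ, (vL n : ℂ) * (gg u W (y - Real.log n) + gg u W (y + Real.log n))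

lemma PrS_near {c : ℝ} (hc : 1/2 < c) : ∃ C1 : ℝ, 0 ≤ C1 ∧ ∀ u W y : ℝ, 0 < W → 12*c ≤ W^2 → |y| ≤ 1/4 →
    ‖PrS u W y‖ ≤ C1 * W := by
  have hs := vL_summable hc
  have hn : ∀ n : ℕ, 0 ≤ vL n * Real.exp (-(c*Real.log n)) := fun n => mul_nonneg (vL_nonneg n) (Real.exp_pos _).le
  refine ⟨5.2 * ∑' n : ℕ, vL n * Real.exp (-(c*Real.log n)), mul_nonneg (by norm_num) (tsum_nonneg hn), fun u W y hW hW2 hy => ?_⟩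
  have key : ∀ n : ℕ, 2 ≤ n → ∀ v : ℝ, Real.log n / 2 ≤ |v| → ‖gg u W v‖ ≤ 2.6 * W * Real.exp (-(c*Real.log n)) := by
    intro n hn v hv
    rw [gg_norm u v hW]
    have hl : Real.log 2 ≤ Real.log n := Real.log_le_log (by norm_num) (by exact_mod_cast hn)
    have hl2 := Real.log_two_gt_d9
    have h1 : c * Real.log n ≤ W^2*v^2/2 := by
      have : (Real.log n/2)^2 ≤ v^2 := by rw [← sq_abs v]; gcongr
      calc c * Real.log n ≤ W^2/12 * Real.log n := by gcongr; linarith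
        _ ≤ W^2 * (Real.log n/2)^2/2 := by
          have : W^2 * (Real.log n * (Real.log n / 8 - 1/12)) ≥ 0 := by
            apply mul_nonneg (sq_nonneg _) (mul_nonneg _ _) <;> linarith
          nlinarith
        _ ≤ _ := by gcongr
    have h2 : Real.exp (-(W^2*v^2/2)) ≤ Real.exp (-(c*Real.log n)) := Real.exp_le_exp.2 (by linarith)
    have h3 := sqrt2pi_le
    calc W * √(2*π) * Real.exp (-(W^2*v^2/2)) ≤ W * 2.6 * Real.exp (-(c*Real.log n)) := by gcongr
      _ = _ := by ring
  unfold PrS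
  have hb : ∀ n : ℕ, ‖(vL n : ℂ) * (gg u W (y - Real.log n) + gg u W (y + Real.log n))‖ ≤ (5.2 * W) * (vL n * Real.exp (-(c*Real.log n))) := by
    intro n
    rcases Nat.lt_or_ge n 2 with h | h
    · have : vL n = 0 := by
        interval_cases n
        · exact vL_zero
        · exact vL_one
      simp [this]
    · have hl : Real.log 2 ≤ Real.log n := Real.log_le_log (by norm_num) (by exact_mod_cast h)
      have hl2 := Real.log_two_gt_d9
      rw [abs_le] at hy
      have k1 := key n h (y - Real.log n) (by rw [abs_of_nonpos (by linarith)]; linarith)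
      have k2 := key n h (y + Real.log n) (by rw [abs_of_nonneg (by linarith)]; linarith)
      rw [norm_mul, Complex.norm_real, Real.norm_eq_abs, abs_of_nonneg (vL_nonneg n)]
      have k3 := norm_add_le (gg u W (y - Real.log n)) (gg u W (y + Real.log n))
      have : vL n * ‖gg u W (y - Real.log n) + gg u W (y + Real.log n)‖ ≤ vL n * (5.2 * W * Real.exp (-(c*Real.log n))) :=
        mul_le_mul_of_nonneg_left (by linarith) (vL_nonneg n)
      linarith
  refine (tsum_of_norm_bounded ((hs.mul_left _).hasSum) hb).trans ?_
  rw [tsum_mul_left]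
  apply le_of_eq; ring

lemma gg_far {c W p : ℝ} (u d l : ℝ) (hc : 0 < c) (hW : 0 < W) (hp : 1 ≤ p) (hW2 : 16*c*p ≤ W^2)
    (hlW : Real.log W ≤ W^2/(64*p^2)) (hd : 1/(4*p) ≤ |d|) (hl : l ≤ Real.log p + 1 + |d|) :
    ‖gg u W d‖ ≤ 2.6 * Real.exp c * Real.exp (c * Real.log p) * Real.exp (-(c*l)) := by
  rw [gg_norm u d hW]
  have h3 := sqrt2pi_le
  have e : W * √(2*π) * Real.exp (-(W^2*d^2/2)) = √(2*π) * Real.exp (Real.log W - W^2*d^2/2) := by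
    rw [sub_eq_add_neg, Real.exp_add, Real.exp_log hW]; ring
  rw [e, mul_assoc, mul_assoc, ← Real.exp_add, ← Real.exp_add]
  gcongr
  rw [← sq_abs d]
  set D := |d|
  have hD : 0 < D := lt_of_lt_of_le (by positivity) hd
  have h1 : W^2/(64*p^2) ≤ W^2*D^2/4 := by
    have : (1/(4*p))^2 ≤ D^2 := by gcongr
    calc _ = W^2 * (1/(4*p))^2/4 := by field_simp; ring
      _ ≤ _ := by gcongr
  have h2 : c * D ≤ W^2*D^2/4 := by
    have : 4 * c ≤ W^2 * D := by
      calc 4*c = 16*c*p*(1/(4*p)) := by field_simp; ring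
        _ ≤ W^2 * D := by gcongr
    nlinarith
  have h4 : c * l ≤ c * (Real.log p + 1 + D) := by gcongr
  nlinarith

lemma log_sep {n p : ℕ} (hn : 1 ≤ n) (hp : 1 ≤ p) (h : n ≠ p) : 1/(2*(p:ℝ)) ≤ |Real.log p - Real.log n| := by
  have hn' : (1:ℝ) ≤ n := by exact_mod_cast hn
  have hp' : (1:ℝ) ≤ p := by exact_mod_cast hp
  rcases lt_or_gt_of_ne h with h | h
  · have h1 : (n:ℝ) + 1 ≤ p := by exact_mod_cast h
    have h2 := Real.log_le_sub_one_of_pos (show 0 < (n:ℝ)/p by positivity)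
    rw [Real.log_div (by positivity) (by positivity)] at h2
    have h3 : (n:ℝ)/p ≤ 1 - 1/p := by
      rw [div_le_iff₀ (by positivity)]; field_simp; linarith
    have h4 : 1/(2*(p:ℝ)) ≤ 1/p := by gcongr; linarith
    exact le_trans (by linarith) (le_abs_self _)
  · have h1 : (p:ℝ) + 1 ≤ n := by exact_mod_cast h
    have h2 := Real.log_le_sub_one_of_pos (show 0 < (p:ℝ)/n by positivity)
    rw [Real.log_div (by positivity) (by positivity)] at h2
    have h3 : (p:ℝ)/n ≤ 1 - 1/(2*p) := by
      rw [div_le_iff₀ (by positivity)]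
      have : (p:ℝ) ≤ (1 - 1/(2*p)) * (p+1) := by
        have : (1 - 1/(2*p)) * ((p:ℝ)+1) = p + 1/2 - 1/(2*p) := by field_simp; ring
        rw [this]
        have : 1/(2*(p:ℝ)) ≤ 1/2 := by
          rw [div_le_div_iff₀ (by positivity) (by norm_num)]; linarith
        linarith
      refine this.trans (mul_le_mul_of_nonneg_left h1 ?_)
      have : 1/(2*(p:ℝ)) ≤ 1 := by
          rw [div_le_one (by positivity)]; linarith
      linarith
    rw [abs_sub_comm]
    exact le_trans (by linarith) (le_abs_self _)

lemma PrS_far {c : ℝ} (hc : 1/2 < c) : ∃ C1 : ℝ, 0 ≤ C1 ∧ ∀ (u W y : ℝ) (p : ℕ), 0 < W → 2 ≤ p → 16*c*p ≤ W^2 →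
    Real.log W ≤ W^2/(64*(p:ℝ)^2) → |y - Real.log p| ≤ 1/(8*p) →
    ‖PrS u W y - vL p * gg u W (y - Real.log p)‖ ≤ C1 * Real.exp (c * Real.log p) := by
  have hs := vL_summable hc
  have hn : ∀ n : ℕ, 0 ≤ vL n * Real.exp (-(c*Real.log n)) := fun n => mul_nonneg (vL_nonneg n) (Real.exp_pos _).le
  refine ⟨5.2 * Real.exp c * ∑' n : ℕ, vL n * Real.exp (-(c*Real.log n)), mul_nonneg (by positivity) (tsum_nonneg hn), fun u W y p hW hp hW2 hlW hy => ?_⟩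
  have hp2 : (2:ℝ) ≤ p := by exact_mod_cast hp
  have hlp : Real.log 2 ≤ Real.log p := Real.log_le_log (by norm_num) (by exact_mod_cast hp)
  have hl2 := Real.log_two_gt_d9
  have hip : 1/(8*(p:ℝ)) ≤ 1/16 := by
    rw [div_le_div_iff₀ (by positivity) (by norm_num)]; linarith
  have hip4 : 1/(4*(p:ℝ)) ≤ 1/8 := by
    rw [div_le_div_iff₀ (by positivity) (by norm_num)]; linarith
  have hy2 := abs_le.1 hy
  have hcc : 0 < c := by linarith
  set B := 2.6 * Real.exp c * Real.exp (c * Real.log p) with hB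
  have k2 : ∀ n : ℕ, 1 ≤ n → ‖gg u W (y + Real.log n)‖ ≤ B * Real.exp (-(c*Real.log n)) := by
    intro n hn
    have hln : 0 ≤ Real.log n := Real.log_nonneg (by exact_mod_cast hn)
    apply gg_far u _ _ hcc hW (by linarith) hW2 hlW
    · rw [abs_of_nonneg (by linarith)]; linarith
    · rw [abs_of_nonneg (by linarith)]; linarith
  have k1 : ∀ n : ℕ, 1 ≤ n → n ≠ p → ‖gg u W (y - Real.log n)‖ ≤ B * Real.exp (-(c*Real.log n)) := by
    intro n hn hnp
    apply gg_far u _ _ hcc hW (by linarith) hW2 hlW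
    · have h1 := log_sep hn (by omega) hnp
      have h2 := abs_sub_abs_le_abs_sub (Real.log p - Real.log n) (Real.log p - y)
      have e : Real.log p - Real.log n - (Real.log p - y) = y - Real.log n := by ring
      rw [e, abs_sub_comm (Real.log p) y] at h2
      have e1 : 1/(2*(p:ℝ)) = 4 * (1/(8*p)) := by field_simp; norm_num
      have e2 : 1/(4*(p:ℝ)) = 2 * (1/(8*p)) := by field_simp; norm_num
      have : 0 < 1/(8*(p:ℝ)) := by positivity
      linarith
    · have := neg_abs_le (y - Real.log n)
      linarith
  have hBp : 0 < B := by positivity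
  set g : ℕ → ℂ := fun n => (vL n : ℂ) * ((if n = p then 0 else gg u W (y - Real.log n)) + gg u W (y + Real.log n)) with hg
  have hb : ∀ n : ℕ, ‖g n‖ ≤ (2 * B) * (vL n * Real.exp (-(c*Real.log n))) := by
    intro n
    rw [hg]
    rcases Nat.eq_zero_or_pos n with h | h
    · simp [h, vL_zero]
    · have q1 : ‖(if n = p then 0 else gg u W (y - Real.log n))‖ ≤ B * Real.exp (-(c*Real.log n)) := by
        split_ifs with hh
        · simp only [norm_zero]; positivity
        · exact k1 n h hh
      have q2 := k2 n h
      simp only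
      rw [norm_mul, Complex.norm_real, Real.norm_eq_abs, abs_of_nonneg (vL_nonneg n)]
      have k3 := norm_add_le (if n = p then 0 else gg u W (y - Real.log n)) (gg u W (y + Real.log n))
      have : vL n * ‖(if n = p then 0 else gg u W (y - Real.log n)) + gg u W (y + Real.log n)‖ ≤ vL n * (2 * B * Real.exp (-(c*Real.log n))) :=
        mul_le_mul_of_nonneg_left (by linarith) (vL_nonneg n)
      linarith
  have hgs : Summable g := Summable.of_norm_bounded (hs.mul_left _) hb
  have hPS : PrS u W y = vL p * gg u W (y - Real.log p) + ∑' n, g n := by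
    unfold PrS
    have e : ∀ n : ℕ, (vL n : ℂ) * (gg u W (y - Real.log n) + gg u W (y + Real.log n))
       = (if n = p then (vL p * gg u W (y - Real.log p)) else 0) + g n := by
      intro n
      rw [hg]
      simp only
      split_ifs with hh
      · subst hh; ring
      · ring
    simp_rw [e]
    rw [Summable.tsum_add (hasSum_ite_eq p _).summable hgs, tsum_ite_eq]
  rw [hPS, add_sub_cancel_left]
  refine (tsum_of_norm_bounded ((hs.mul_left _).hasSum) hb).trans ?_
  rw [tsum_mul_left, hB]
  apply le_of_eq; ring

lemma SS_near (hRH : RiemannHypothesis) {δ : ℝ} (hδ : 0 < δ) : ∃ C1 : ℝ, 0 ≤ C1 ∧ ∃ T0 : ℝ, ∀ T W u y : ℝ, T0 ≤ T → Sz T W →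
    δ * T ≤ u → u ≤ 2*T → |y| ≤ 1/4 → ‖2*π*SS u W y - (Real.log T : ℝ) * gg u W y‖ ≤ C1 * W := by
  obtain ⟨G, G', C, hG, hXi⟩ := Xi_decomp (c := 1) (by norm_num)
  obtain ⟨C1, h1, hN1⟩ := near_G hG hδ 1
  obtain ⟨C2, h2, hN2⟩ := near_G hG.neg hδ (-1)
  obtain ⟨C3, h3, hN3⟩ := PrS_near (c := 1) (by norm_num)
  refine ⟨C1+C2+C3, by positivity, Real.exp 12, fun T W u y hT h hu1 hu2 hy => ?_⟩
  have hW2 : 12 * 1 ≤ W^2 := by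
    rw [mul_one]
    refine le_trans ?_ h.LW
    rw [← Real.log_exp 12]
    exact Real.log_le_log (Real.exp_pos _) hT
  rw [expl hRH (by norm_num) hG hXi u y h.Wpos]
  have q1 := hN1 T W u h hu1 hu2 y (by linarith)
  have q2 := hN2 T W u h hu1 hu2 y (by linarith)
  have q3 := hN3 u W y h.Wpos hW2 hy
  unfold PrS at q3
  set A := ∫ t, Gt u W y (wl 1 t) * G t
  set B := ∫ t, Gt u W y (wl (-1) t) * G (-t)
  set P := ∑' n : ℕ, (vL n : ℂ) * (gg u W (y - Real.log n) + gg u W (y + Real.log n))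
  have e : A + B - P - (Real.log T : ℝ) * gg u W y = (A - (Real.log T / 2 : ℝ) * gg u W y) + (B - (Real.log T / 2 : ℝ) * gg u W y) - P := by
    push_cast; ring
  rw [e]
  refine (norm_sub_le _ _).trans ?_
  have := norm_add_le (A - (Real.log T / 2 : ℝ) * gg u W y) (B - (Real.log T / 2 : ℝ) * gg u W y)
  linarith

lemma SS_up (hRH : RiemannHypothesis) : ∃ C1 : ℝ, 0 ≤ C1 ∧ ∃ T0 : ℝ, ∀ T W u : ℝ, T0 ≤ T → Sz T W →
    |u| ≤ 2*T → ‖2*π*SS u W 0‖ ≤ W * √(2*π) * Real.log T + C1 * W := by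
  obtain ⟨G, G', C, hG, hXi⟩ := Xi_decomp (c := 1) (by norm_num)
  obtain ⟨C1, h1, hN1⟩ := up_G hG 1
  obtain ⟨C2, h2, hN2⟩ := up_G hG.neg (-1)
  obtain ⟨C3, h3, hN3⟩ := PrS_near (c := 1) (by norm_num)
  refine ⟨C1+C2+C3, by positivity, Real.exp 12, fun T W u hT h hu => ?_⟩
  have hW2 : 12 * 1 ≤ W^2 := by
    rw [mul_one]
    refine le_trans ?_ h.LW
    rw [← Real.log_exp 12]
    exact Real.log_le_log (Real.exp_pos _) hT
  rw [expl hRH (by norm_num) hG hXi u 0 h.Wpos]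
  have q1 := hN1 T W u h hu
  have q2 := hN2 T W u h hu
  have q3 := hN3 u W 0 h.Wpos hW2 (by norm_num)
  unfold PrS at q3
  refine (norm_sub_le _ _).trans ?_
  have := norm_add_le (∫ t, Gt u W 0 (wl 1 t) * G t) (∫ t, Gt u W 0 (wl (-1) t) * G (-t))
  linarith

lemma SS_far (hRH : RiemannHypothesis) {δ c : ℝ} (hδ : 0 < δ) (hc : 1/2 < c) : ∃ C1 : ℝ, 0 ≤ C1 ∧ ∀ (T W u y : ℝ) (p : ℕ), Sz T W →
    δ * T ≤ u → u ≤ 2*T → 2 ≤ p → 16*c*p ≤ W^2 →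
    Real.log W ≤ W^2/(64*(p:ℝ)^2) → |y - Real.log p| ≤ 1/(8*p) →
    ‖2*π*SS u W y + vL p * gg u W (y - Real.log p)‖ ≤ C1 * Real.log T * Real.exp (c * Real.log p) := by
  obtain ⟨G, G', C, hG, hXi⟩ := Xi_decomp hc
  obtain ⟨C1, h1, hN1⟩ := far_G hG hδ c
  obtain ⟨C2, h2, hN2⟩ := far_G hG.neg hδ (-c)
  obtain ⟨C3, h3, hN3⟩ := PrS_far hc
  refine ⟨C1 * Real.exp c +C2 * Real.exp c+C3, by positivity, fun T W u y p h hu1 hu2 hp hW2 hlW hy => ?_⟩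
  rw [expl hRH hc hG hXi u y h.Wpos]
  have hp2 : (2:ℝ) ≤ p := by exact_mod_cast hp
  have hlp : Real.log 2 ≤ Real.log p := Real.log_le_log (by norm_num) (by exact_mod_cast hp)
  have hl2 := Real.log_two_gt_d9
  have hip : 1/(8*(p:ℝ)) ≤ 1/16 := by
    rw [div_le_div_iff₀ (by positivity) (by norm_num)]; linarith
  have hy2 := abs_le.1 hy
  have q1 := hN1 T W u h hu1 hu2 y (by linarith)
  have q2 := hN2 T W u h hu1 hu2 y (by linarith)
  have q3 := hN3 u W y p h.Wpos hp hW2 hlW hy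
  unfold PrS at q3
  have hL := h.L2
  have x1 : Real.exp (y*c) ≤ Real.exp c * Real.exp (c * Real.log p) := by
    rw [← Real.exp_add]; apply Real.exp_le_exp.2; nlinarith
  have x2 : Real.exp (y*(-c)) ≤ Real.exp c * Real.exp (c * Real.log p) := by
    refine le_trans (Real.exp_le_exp.2 ?_) x1
    nlinarith
  set A := ∫ t, Gt u W y (wl c t) * G t
  set B := ∫ t, Gt u W y (wl (-c) t) * G (-t)
  set P := ∑' n : ℕ, (vL n : ℂ) * (gg u W (y - Real.log n) + gg u W (y + Real.log n))
  have e : A + B - P + vL p * gg u W (y - Real.log p) = A + B - (P - vL p * gg u W (y - Real.log p)) := by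
    ring
  rw [e]
  refine (norm_sub_le _ _).trans ?_
  have := norm_add_le A B
  set Ep := Real.exp (c * Real.log p)
  have hE : 0 < Ep := Real.exp_pos _
  have y1 : C1 * Real.log T * Real.exp (y*c) ≤ C1 * Real.log T * (Real.exp c * Ep) := by gcongr
  have y2 : C2 * Real.log T * Real.exp (y*(-c)) ≤ C2 * Real.log T * (Real.exp c * Ep) := by gcongr
  have y3 : C3 * Ep ≤ C3 * Real.log T * Ep := by
    apply mul_le_mul_of_nonneg_right _ hE.le
    exact le_mul_of_one_le_right h3 (by linarith)
  nlinarith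

end

section

def Wd (T : ℝ) : ℝ := T / Real.log T

lemma Sz_one {T : ℝ} (hT : 20 ≤ T) : Sz T (Wd T) := by
  have hl : 2 ≤ Real.log T := by
    rw [Real.le_log_iff_exp_le (by linarith)]
    have := Real.exp_one_lt_d9
    have h2 : Real.exp 2 = Real.exp 1 * Real.exp 1 := by rw [← Real.exp_add]; norm_num
    have := Real.exp_pos 1
    nlinarith
  refine ⟨hT, hl, le_refl _, ?_⟩
  unfold Wd
  gcongr
  linarith

lemma Sz_two {T : ℝ} (hT : 20 ≤ T) : Sz T (√2 * Wd T) := by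
  have h := Sz_one hT
  have hW := h.Wpos
  have hl := h.L2
  refine ⟨hT, hl, ?_, ?_⟩
  · have : 1 ≤ √2 := by rw [Real.one_le_sqrt]; norm_num
    have : 1 * Wd T ≤ √2 * Wd T := by gcongr
    unfold Wd at *; linarith
  · have : √2 ≤ 2 := by rw [Real.sqrt_le_left (by norm_num)]; norm_num
    calc √2 * Wd T ≤ 2 * Wd T := by gcongr
      _ = _ := by unfold Wd; ring

lemma Kre (hRH : RiemannHypothesis) (u : ℝ) {W : ℝ} (hW : 0 < W) :
    Summable (fun γ : Zt Xi => (zm Xi γ : ℝ) * Real.exp (-((γ:ℝ) - u) ^ 2 / (2 * W ^ 2))) ∧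
    ∑' γ : Zt Xi, (zm Xi γ : ℝ) * Real.exp (-((γ:ℝ) - u) ^ 2 / (2 * W ^ 2)) = ‖SS u W 0‖ := by
  have h := K_summable (Xi_good hRH) u hW
  refine ⟨h, ?_⟩
  have e : SS u W 0 = ((∑' γ : Zt Xi, (zm Xi γ : ℝ) * Real.exp (-((γ:ℝ) - u) ^ 2 / (2 * W ^ 2)) : ℝ) : ℂ) := by
    unfold SS
    rw [Complex.ofReal_tsum]
    congr 1; ext γ
    unfold Gt
    push_cast
    congr 2
    ring
  rw [e, Complex.norm_real, Real.norm_eq_abs, abs_of_nonneg]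
  exact tsum_nonneg fun γ => by positivity

lemma ords_finite (hRH : RiemannHypothesis) (T : ℝ) : (zetaOrds T).Finite := by
  have h := (Xi_good hRH).fin T
  refine (h.image (fun γ : Zt Xi => (γ : ℝ))).subset ?_
  intro γ hγ
  obtain ⟨h1, h2, h3⟩ := hγ
  refine ⟨⟨γ, (Xi_zero_iff γ).2 h3⟩, ?_, rfl⟩
  simp only [Set.mem_ofPred_eq]
  rw [abs_of_pos h1]; exact h2

def Zf (hRH : RiemannHypothesis) (T : ℝ) : Finset ℝ := (ords_finite hRH T).toFinset

lemma mem_Zf (hRH : RiemannHypothesis) (T γ : ℝ) : γ ∈ Zf hRH T ↔ γ ∈ zetaOrds T := by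
  simp [Zf]

def Kg (u W γ : ℝ) : ℝ := Real.exp (-(γ - u) ^ 2 / (2 * W ^ 2))

lemma Kg_pos (u W γ : ℝ) : 0 < Kg u W γ := Real.exp_pos _

def SZ (Z : Finset ℝ) (u W y : ℝ) : ℂ := ∑ γ ∈ Z, (ordMult γ : ℂ) * Gt u W y γ

lemma sum_Zf (hRH : RiemannHypothesis) {E : Type*} [NormedAddCommGroup E] (T : ℝ) (F : ℝ → E) :
    ∑ γ ∈ Zf hRH T, F γ = ∑' γ : Zt Xi, if (γ:ℝ) ∈ Zf hRH T then F γ else 0 := by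
  classical
  have hz : ∀ γ ∈ Zf hRH T, Xi (γ:ℂ) = 0 := fun γ hγ => (Xi_zero_iff γ).2 ((mem_Zf hRH T γ).1 hγ).2.2
  rw [tsum_eq_sum (s := (Zf hRH T).subtype (fun γ : ℝ => Xi (γ:ℂ) = 0))]
  · rw [Finset.sum_subtype_eq_sum_filter (f := fun γ : ℝ => if γ ∈ Zf hRH T then F γ else 0), Finset.filter_true_of_mem hz]
    exact Finset.sum_congr rfl fun γ hγ => by simp [hγ]
  · intro γ hγ
    simp only [Finset.mem_subtype] at hγ
    simp [hγ]

lemma sum_K_le (hRH : RiemannHypothesis) (T u : ℝ) {W : ℝ} (hW : 0 < W) :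
    ∑ γ ∈ Zf hRH T, (ordMult γ : ℝ) * Kg u W γ ≤ ‖SS u W 0‖ := by
  obtain ⟨h1, h2⟩ := Kre hRH u hW
  rw [sum_Zf hRH T, ← h2]
  have hle : ∀ γ : Zt Xi, (if (γ:ℝ) ∈ Zf hRH T then (ordMult γ : ℝ) * Kg u W γ else 0) ≤ (zm Xi γ : ℝ) * Real.exp (-((γ:ℝ) - u) ^ 2 / (2 * W ^ 2)) := by
    intro γ
    rw [zm_eq_ordMult hRH]
    split_ifs
    · exact le_refl _
    · positivity
  refine Summable.tsum_le_tsum hle (Summable.of_nonneg_of_le (fun γ => ?_) hle h1) h1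
  split_ifs
  · exact mul_nonneg (Nat.cast_nonneg _) (Kg_pos _ _ _).le
  · exact le_refl _

lemma tail_exp {δ T x : ℝ} (hδ : 0 < δ) (hT : 20 ≤ T) (hx : δ * T ≤ |x|) :
    Real.exp (-x^2/(2*(Wd T)^2)) ≤ Real.exp (-(δ * Real.log T)^2/4) * Real.exp (-x^2/(2*(√2*Wd T)^2)) := by
  have h := Sz_one hT
  have hW := h.Wpos
  have hL := h.L2
  have hW2' : (√2*Wd T)^2 = 2*(Wd T)^2 := by rw [mul_pow, Real.sq_sqrt (by norm_num)]
  rw [hW2', ← Real.exp_add]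
  apply Real.exp_le_exp.2
  have h4 : δ * Real.log T ≤ |x|/Wd T := by
    rw [le_div_iff₀ hW]
    have e : δ * Real.log T * Wd T = δ * T := by unfold Wd; field_simp
    linarith
  have h5 : (δ * Real.log T)^2 ≤ x^2/(Wd T)^2 := by
    have : x^2/(Wd T)^2 = (|x|/Wd T)^2 := by rw [div_pow, sq_abs]
    rw [this]; gcongr
  have e1 : -x ^ 2 / (2 * (Wd T) ^ 2) = -(x^2/(Wd T)^2)/2 := by ring
  have e2 : -x ^ 2 / (2 * (2*(Wd T) ^ 2)) = -(x^2/(Wd T)^2)/4 := by ring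
  rw [e1, e2]
  linarith

lemma exp_sq_le {δ T : ℝ} (hδ : 0 < δ) (hT : 0 < T) :
    Real.exp (-(δ * Real.log T)^2/4) ≤ Real.exp (1/δ^2) / T := by
  rw [show Real.exp (1/δ^2)/T = Real.exp (1/δ^2 - Real.log T) by rw [Real.exp_sub, Real.exp_log hT]]
  apply Real.exp_le_exp.2
  have e3 : 1/δ^2 - Real.log T + (δ * Real.log T)^2/4 = (1/δ - δ * Real.log T/2)^2 := by
    field_simp; ring
  nlinarith [sq_nonneg (1/δ - δ * Real.log T/2)]

lemma SZ_tail (hRH : RiemannHypothesis) {δ : ℝ} (hδ : 0 < δ) : ∃ C1 : ℝ, 0 ≤ C1 ∧ ∃ T0 : ℝ, 20 ≤ T0 ∧ ∀ T u y : ℝ, T0 ≤ T →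
    δ * T ≤ u → u ≤ (1-δ)*T → ‖SS u (Wd T) y - SZ (Zf hRH T) u (Wd T) y‖ ≤ C1 := by
  obtain ⟨C1, h1, T0, hup⟩ := SS_up hRH
  refine ⟨Real.exp (1/δ^2) * (2*2.6 + C1*2), by positivity, max T0 20, le_max_right _ _, fun T u y hT hu1 hu2 => ?_⟩
  have hT0 : T0 ≤ T := (le_max_left _ _).trans hT
  have hT20 : 20 ≤ T := (le_max_right _ _).trans hT
  have hs1 := Sz_one hT20
  have hs2 := Sz_two hT20
  have hW := hs1.Wpos
  have hW2 := hs2.Wpos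
  have hL := hs1.L2
  have hb := hup T (√2 * Wd T) u hT0 hs2 (by rw [abs_of_nonneg (by nlinarith)]; nlinarith)
  obtain ⟨k1, k2⟩ := Kre hRH u hW2
  have e : SS u (Wd T) y - SZ (Zf hRH T) u (Wd T) y = ∑' γ : Zt Xi, if (γ:ℝ) ∈ Zf hRH T then 0 else (zm Xi γ : ℂ) * Gt u (Wd T) y (γ:ℝ) := by
    unfold SS SZ
    have hS := Gt_summable (Xi_good hRH) u y hW
    rw [sum_Zf hRH T (fun γ => (ordMult γ : ℂ) * Gt u (Wd T) y (γ:ℝ)), ← Summable.tsum_sub hS]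
    · congr 1; ext γ
      rw [zm_eq_ordMult hRH]
      split_ifs <;> simp
    · apply Summable.of_norm_bounded hS.norm
      intro γ
      rw [zm_eq_ordMult hRH]
      split_ifs
      · exact le_refl _
      · rw [norm_zero]; exact norm_nonneg _
  rw [e]
  set E := Real.exp (-(δ * Real.log T)^2/4)
  have hbd : ∀ γ : Zt Xi, ‖(if (γ:ℝ) ∈ Zf hRH T then 0 else (zm Xi γ : ℂ) * Gt u (Wd T) y (γ:ℝ))‖
      ≤ E * ((zm Xi γ : ℝ) * Real.exp (-((γ:ℝ) - u) ^ 2 / (2 * (√2 * Wd T) ^ 2))) := by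
    intro γ
    split_ifs with hh
    · rw [norm_zero]; positivity
    · rw [norm_mul, Gt_real_norm, Complex.norm_natCast]
      have : δ * T ≤ |(γ:ℝ) - u| := by
        rw [mem_Zf] at hh
        by_contra hcon
        push Not at hcon
        rw [abs_lt] at hcon
        apply hh
        refine ⟨by linarith, by linarith, (Xi_zero_iff _).1 γ.2⟩
      have := tail_exp hδ hT20 this
      calc _ ≤ (zm Xi γ : ℝ) * (E * Real.exp (-((γ:ℝ) - u) ^ 2 / (2 * (√2 * Wd T) ^ 2))) := by gcongr
        _ = _ := by ring
  refine (tsum_of_norm_bounded ((k1.mul_left E).hasSum) hbd).trans ?_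
  rw [tsum_mul_left, k2]
  have hE := exp_sq_le hδ (show 0 < T by linarith)
  have h2pi : ‖SS u (√2 * Wd T) 0‖ ≤ √2 * Wd T * √(2*π) * Real.log T + C1 * (√2 * Wd T) := by
    refine le_trans ?_ hb
    rw [norm_mul]
    apply le_mul_of_one_le_left (norm_nonneg _)
    rw [show (2*π:ℂ) = ((2*π:ℝ):ℂ) by push_cast; ring, Complex.norm_real, Real.norm_eq_abs, abs_of_pos Real.two_pi_pos]
    linarith [Real.pi_gt_three]
  have hsq : √2 ≤ 2 := by rw [Real.sqrt_le_left (by norm_num)]; norm_num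
  have hWL : Wd T * Real.log T = T := by unfold Wd; field_simp
  have hWT := hs1.WT
  have h3 := sqrt2pi_le
  calc E * ‖SS u (√2 * Wd T) 0‖ ≤ Real.exp (1/δ^2) / T * (√2 * Wd T * √(2*π) * Real.log T + C1 * (√2 * Wd T)) := by gcongr
    _ = Real.exp (1/δ^2) / T * (√2 * √(2*π) * (Wd T * Real.log T) + C1 * (√2 * Wd T)) := by ring
    _ ≤ Real.exp (1/δ^2) / T * (2 * 2.6 * T + C1 * (2 * T)) := by
      rw [hWL]; gcongr
    _ = _ := by
      have : T ≠ 0 := by linarith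
      field_simp

lemma SZ_near (hRH : RiemannHypothesis) {δ : ℝ} (hδ : 0 < δ) : ∃ C1 : ℝ, 0 ≤ C1 ∧ ∃ T0 : ℝ, 20 ≤ T0 ∧ ∀ T u y : ℝ, T0 ≤ T →
    δ * T ≤ u → u ≤ (1-δ)*T → |y| ≤ 1/4 →
    ‖2*π*SZ (Zf hRH T) u (Wd T) y - (Real.log T : ℝ) * gg u (Wd T) y‖ ≤ C1 * Wd T := by
  obtain ⟨C1, h1, T1, hT1, hA⟩ := SZ_tail hRH hδ
  obtain ⟨C2, h2, T2, hB⟩ := SS_near hRH hδ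
  refine ⟨2*π*C1 + C2, by positivity, max T1 T2, hT1.trans (le_max_left _ _), fun T u y hT hu1 hu2 hy => ?_⟩
  have hT1' : T1 ≤ T := (le_max_left _ _).trans hT
  have hs := Sz_one (hT1.trans hT1')
  have a := hA T u y hT1' hu1 hu2
  have b := hB T (Wd T) u y ((le_max_right _ _).trans hT) hs hu1 (by nlinarith [hs.T8]) hy
  set S1 := SS u (Wd T) y
  set S2 := SZ (Zf hRH T) u (Wd T) y
  have e : 2*π*S2 - (Real.log T : ℝ) * gg u (Wd T) y = (2*π*S1 - (Real.log T : ℝ) * gg u (Wd T) y) - ((2*π:ℝ):ℂ)*(S1 - S2) := by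
    push_cast; ring
  rw [e]
  refine (norm_sub_le _ _).trans ?_
  rw [norm_mul, Complex.norm_real, Real.norm_eq_abs, abs_of_pos Real.two_pi_pos]
  have : 2*π*‖S1 - S2‖ ≤ 2*π*C1*Wd T := by
    calc _ ≤ 2*π*C1 := by gcongr
      _ ≤ _ := le_mul_of_one_le_right (by positivity) hs.W1
  linarith

lemma SZ_far (hRH : RiemannHypothesis) {δ c : ℝ} (hδ : 0 < δ) (hc : 1/2 < c) : ∃ C1 : ℝ, 0 ≤ C1 ∧ ∃ T0 : ℝ, 20 ≤ T0 ∧ ∀ (T u y : ℝ) (p : ℕ), T0 ≤ T →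
    δ * T ≤ u → u ≤ (1-δ)*T → 2 ≤ p → 16*c*p ≤ (Wd T)^2 →
    Real.log (Wd T) ≤ (Wd T)^2/(64*(p:ℝ)^2) → |y - Real.log p| ≤ 1/(8*p) →
    ‖2*π*SZ (Zf hRH T) u (Wd T) y + vL p * gg u (Wd T) (y - Real.log p)‖ ≤ C1 * Real.log T * Real.exp (c * Real.log p) := by
  obtain ⟨C1, h1, T1, hT1, hA⟩ := SZ_tail hRH hδ
  obtain ⟨C2, h2, hB⟩ := SS_far hRH hδ hc
  refine ⟨2*π*C1 + C2, by positivity, T1, hT1, fun T u y p hT hu1 hu2 hp hq1 hq2 hy => ?_⟩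
  have hs := Sz_one (hT1.trans hT)
  have a := hA T u y hT hu1 hu2
  have b := hB T (Wd T) u y p hs hu1 (by nlinarith [hs.T8]) hp hq1 hq2 hy
  set S1 := SS u (Wd T) y
  set S2 := SZ (Zf hRH T) u (Wd T) y
  have e : 2*π*S2 + vL p * gg u (Wd T) (y - Real.log p) = (2*π*S1 + vL p * gg u (Wd T) (y - Real.log p)) - ((2*π:ℝ):ℂ)*(S1 - S2) := by
    push_cast; ring
  rw [e]
  refine (norm_sub_le _ _).trans ?_
  rw [norm_mul, Complex.norm_real, Real.norm_eq_abs, abs_of_pos Real.two_pi_pos]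
  have hlp : 0 ≤ Real.log p := Real.log_nonneg (by exact_mod_cast (by omega : 1 ≤ p))
  have hE : 1 ≤ Real.exp (c * Real.log p) := Real.one_le_exp (by positivity)
  have hL := hs.L2
  have hLE : 1 ≤ Real.log T * Real.exp (c * Real.log p) := by nlinarith
  have : 2*π*‖S1 - S2‖ ≤ 2*π*C1*(Real.log T * Real.exp (c * Real.log p)) := by
    calc _ ≤ 2*π*C1 := by gcongr
      _ ≤ _ := le_mul_of_one_le_right (by positivity) hLE
  nlinarith

end

section

lemma Kg_comm (u W γ : ℝ) : Kg u W γ = Kg γ W u := by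
  unfold Kg; congr 2; ring

lemma Kg_int_u (γ : ℝ) {W : ℝ} (hW : 0 < W) : Integrable (fun u => Kg u W γ) ∧ ∫ u, Kg u W γ = W * √(2*π) := by
  simp_rw [fun u => Kg_comm u W γ]
  exact ⟨gauss_integrable γ hW, gauss_integral γ hW⟩

lemma Kg_mass {δ T γ : ℝ} (hδ : 0 < δ) (hT : 20 ≤ T) (h1 : 0 < γ) (h2 : γ ≤ T) :
    Wd T * √(2*π) * (1 - 2 * (Real.exp (1/δ^2) / T)) ≤ ∫ u in Set.Icc (-(δ*T)) ((1+δ)*T), Kg u (Wd T) γ := by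
  have hs1 := Sz_one hT
  have hs2 := Sz_two hT
  have hW := hs1.Wpos
  have hW2 := hs2.Wpos
  obtain ⟨i1, v1⟩ := Kg_int_u γ hW
  obtain ⟨i2, v2⟩ := Kg_int_u γ hW2
  set E := Real.exp (1/δ^2) / T
  have hT0 : 0 < T := by linarith
  have hE : 0 ≤ E := by positivity
  set I := Set.Icc (-(δ*T)) ((1+δ)*T)
  have hI : MeasurableSet I := measurableSet_Icc
  have hle : ∫ u, Kg u (Wd T) γ ≤ ∫ u, (I.indicator (fun u => Kg u (Wd T) γ) u + E * Kg u (√2 * Wd T) γ) := by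
    apply integral_mono i1 ((i1.indicator hI).add (i2.const_mul E))
    intro u
    by_cases hu : u ∈ I
    · simp only [Set.indicator_of_mem hu, Pi.add_apply]
      have := mul_nonneg hE (Kg_pos u (√2 * Wd T) γ).le
      linarith
    · simp only [Set.indicator_of_notMem hu, Pi.add_apply, zero_add]
      have hx : δ * T ≤ |γ - u| := by
        by_contra hcon
        push Not at hcon
        rw [abs_lt] at hcon
        exact hu ⟨by linarith, by linarith⟩
      have := tail_exp hδ hT hx
      refine this.trans ?_
      unfold Kg
      exact mul_le_mul_of_nonneg_right (exp_sq_le hδ hT0) (Real.exp_pos _).le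
  rw [integral_add (i1.indicator hI) (i2.const_mul E), integral_const_mul, integral_indicator hI, v1, v2] at hle
  have hsq : √2 ≤ 2 := by rw [Real.sqrt_le_left (by norm_num)]; norm_num
  have : E * (√2 * Wd T * √(2*π)) ≤ E * (2 * Wd T * √(2*π)) := by gcongr
  linarith

lemma N_up (hRH : RiemannHypothesis) {θ : ℝ} (hθ : 0 < θ) : ∃ T0 : ℝ, 20 ≤ T0 ∧ ∀ T : ℝ, T0 ≤ T →
    ∑ γ ∈ Zf hRH T, (ordMult γ : ℝ) ≤ (1+θ) * (T * Real.log T / (2*π)) := by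
  obtain ⟨C1, h1, T1, hup⟩ := SS_up hRH
  set η := min (θ/10) (1/10) with hη
  have hη0 : 0 < η := by positivity
  have hη1 : η ≤ θ/10 := min_le_left _ _
  have hη2 : η ≤ 1/10 := min_le_right _ _
  set δ := η/2 with hδd
  have hδ : 0 < δ := by positivity
  refine ⟨max (max T1 20) (max (Real.exp (C1/η)) (2*Real.exp (1/δ^2)/η)), by simp, fun T hT => ?_⟩
  have hT1 : T1 ≤ T := (le_max_left _ _).trans ((le_max_left _ _).trans hT)
  have hT20 : 20 ≤ T := (le_max_right _ _).trans ((le_max_left _ _).trans hT)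
  have hT3 : Real.exp (C1/η) ≤ T := (le_max_left _ _).trans ((le_max_right _ _).trans hT)
  have hT4 : 2*Real.exp (1/δ^2)/η ≤ T := (le_max_right _ _).trans ((le_max_right _ _).trans hT)
  have hT0 : 0 < T := by linarith
  have hs1 := Sz_one hT20
  have hW := hs1.Wpos
  have hL := hs1.L2
  have hCL : C1 ≤ η * Real.log T := by
    have := (Real.le_log_iff_exp_le hT0).2 hT3
    rw [div_le_iff₀ hη0] at this
    linarith
  have hE : 2 * (Real.exp (1/δ^2)/T) ≤ η := by
    rw [div_le_iff₀ hη0] at hT4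
    rw [← mul_div_assoc, div_le_iff₀ hT0]; linarith
  set N := ∑ γ ∈ Zf hRH T, (ordMult γ : ℝ) with hN
  have hN0 : 0 ≤ N := Finset.sum_nonneg fun γ _ => Nat.cast_nonneg _
  set I := Set.Icc (-(δ*T)) ((1+δ)*T) with hI
  have hlow : N * (Wd T * √(2*π) * (1 - η)) ≤ ∫ u in I, ∑ γ ∈ Zf hRH T, (ordMult γ : ℝ) * Kg u (Wd T) γ := by
    rw [integral_finsetSum _ (fun γ _ => ((Kg_int_u γ hW).1.integrableOn.const_mul _)), hN, Finset.sum_mul]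
    apply Finset.sum_le_sum
    intro γ hγ
    rw [mem_Zf] at hγ
    rw [integral_const_mul]
    apply mul_le_mul_of_nonneg_left _ (Nat.cast_nonneg _)
    refine le_trans ?_ (Kg_mass hδ hT20 hγ.1 hγ.2.1)
    gcongr
  have hup2 : ∫ u in I, ∑ γ ∈ Zf hRH T, (ordMult γ : ℝ) * Kg u (Wd T) γ ≤ (1+2*δ)*T * ((Wd T * √(2*π) * Real.log T + C1 * Wd T)/(2*π)) := by
    have hle : ∀ u ∈ I, ∑ γ ∈ Zf hRH T, (ordMult γ : ℝ) * Kg u (Wd T) γ ≤ (Wd T * √(2*π) * Real.log T + C1 * Wd T)/(2*π) := by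
      intro u hu
      refine (sum_K_le hRH T u hW).trans ?_
      have := hup T (Wd T) u hT1 hs1 (by rw [abs_le]; constructor <;> nlinarith [hu.1, hu.2])
      rw [le_div_iff₀ (by positivity)]
      rw [norm_mul, show (2*π:ℂ) = ((2*π:ℝ):ℂ) by push_cast; ring, Complex.norm_real, Real.norm_eq_abs, abs_of_pos Real.two_pi_pos] at this
      linarith
    have hvol : (volume I).toReal = (1+2*δ)*T := by
      rw [hI, Real.volume_Icc, ENNReal.toReal_ofReal (by nlinarith)]; ring
    rw [← hvol]
    calc _ ≤ ∫ u in I, (Wd T * √(2*π) * Real.log T + C1 * Wd T)/(2*π) := by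
          apply setIntegral_mono_on _ _ measurableSet_Icc hle
          · exact integrable_finsetSum _ (fun γ _ => ((Kg_int_u γ hW).1.integrableOn.const_mul _))
          · exact integrableOn_const (by rw [Real.volume_Icc]; exact ENNReal.ofReal_ne_top)
      _ = _ := by
        rw [setIntegral_const, smul_eq_mul]; rfl
  have hs2 : 1 ≤ √(2*π) := by rw [Real.one_le_sqrt]; linarith [Real.pi_gt_three]
  have hfin : N * (Wd T * √(2*π) * (1 - η)) ≤ (1+η)^2 * (T * Real.log T / (2*π)) * (Wd T * √(2*π)) := by
    refine hlow.trans (hup2.trans ?_)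
    have : C1 * Wd T ≤ η * Real.log T * (Wd T * √(2*π)) := by
      calc _ ≤ (η * Real.log T) * Wd T := by gcongr
        _ ≤ _ := by
          apply mul_le_mul_of_nonneg_left _ (by positivity)
          exact le_mul_of_one_le_right hW.le hs2
    calc _ ≤ (1+2*δ)*T * ((Wd T * √(2*π) * Real.log T + η * Real.log T * (Wd T * √(2*π)))/(2*π)) := by gcongr
      _ = _ := by rw [hδd]; field_simp
  have hfin2 : N * (1 - η) ≤ (1+η)^2 * (T * Real.log T / (2*π)) := by
    have hp : 0 < Wd T * √(2*π) := by positivity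
    nlinarith
  set X := T * Real.log T / (2*π)
  have hX : 0 ≤ X := by positivity
  have : (1+η)^2 ≤ (1+θ)*(1-η) := by nlinarith
  have : (1+η)^2 * X ≤ (1+θ)*(1-η) * X := by gcongr
  have hh : N * (1-η) ≤ (1+θ) * X * (1-η) := by linarith
  exact le_of_mul_le_mul_right hh (by linarith)

end

section

section FT
open scoped FourierTransform RealInnerProductSpace

variable {lam : ℝ} {r : ℝ → ℝ}

lemma intC (f : ℝ → ℝ) : ((∫ x, f x : ℝ) : ℂ) = ∫ x, ((f x : ℝ) : ℂ) := by
  exact (integral_ofReal (𝕜 := ℂ) (f := f) (μ := volume)).symm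

lemma rC_int (hr : memA lam r) : Integrable (fun x => (r x : ℂ)) := hr.2.2.1.ofReal

lemma fc_eq (hr : memA lam r) (α : ℝ) : 𝓕 (fun x => (r x : ℂ)) α = (fourierCos r α : ℂ) := by
  rw [Real.fourier_real_eq_integral_exp_smul]
  set g : ℝ → ℂ := fun v => Complex.exp (((-2 * π * v * α : ℝ) : ℂ) * Complex.I) • (r v : ℂ) with hg
  have hgi : Integrable g := by
    simp only [hg, smul_eq_mul]
    apply (rC_int hr).bdd_mul (c := 1)
    · apply Continuous.aestronglyMeasurable; fun_prop
    · refine Eventually.of_forall fun x => ?_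
      rw [Complex.norm_exp_ofReal_mul_I]
  have h1 : ∫ v, g (-v) = ∫ v, g v := integral_neg_eq_self g volume
  have h2 : (2:ℂ) * ∫ v, g v = 2 * (fourierCos r α : ℂ) := by
    calc (2:ℂ) * ∫ v, g v = (∫ v, g v) + ∫ v, g (-v) := by rw [h1]; ring
      _ = ∫ v, (g v + g (-v)) := (integral_add hgi hgi.comp_neg).symm
      _ = ∫ v, (2:ℂ) * ((r v * Real.cos (2*π*α*v) : ℝ) : ℂ) := by
        congr 1; ext v
        simp only [hg, hr.2.1 v, smul_eq_mul]
        push_cast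
        have e : Complex.cos (2*π*α*v) = (Complex.exp ((-2 * π * v * α) * Complex.I) + Complex.exp ((-2 * π * -v * α) * Complex.I))/2 := by
          rw [Complex.cos, add_comm]
          congr 3 <;> congr 1 <;> ring
        rw [e]; ring
      _ = _ := by
        rw [integral_const_mul]
        congr 1
        unfold fourierCos
        exact integral_ofReal
  exact mul_left_cancel₀ two_ne_zero h2

lemma fc_cont (hr : memA lam r) : Continuous (fourierCos r) := by
  unfold fourierCos
  apply continuous_of_dominated (bound := fun u => |r u|)
  · intro α
    have := hr.1
    apply Continuous.aestronglyMeasurable; fun_prop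
  · intro α
    refine Eventually.of_forall fun u => ?_
    rw [Real.norm_eq_abs, abs_mul]
    exact mul_le_of_le_one_right (abs_nonneg _) (Real.abs_cos_le_one _)
  · exact hr.2.2.1.abs
  · refine Eventually.of_forall fun u => ?_
    fun_prop

lemma fc_even (α : ℝ) : fourierCos r (-α) = fourierCos r α := by
  unfold fourierCos
  congr 1; ext u
  rw [← Real.cos_neg (2*π*α*u)]; congr 2; ring

lemma fc_reg (hr : memA lam r) : Tendsto (fun c : ℝ => ∫ w : ℝ, Real.exp (-c⁻¹ * w^2) * fourierCos r w) atTop (nhds 1) := by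
  set f : ℝ → ℂ := fun x => (r x : ℂ) with hf
  have hfi : Integrable f := rC_int hr
  have h0 : ContinuousAt f 0 := (Complex.continuous_ofReal.comp hr.1).continuousAt
  have T1 := Real.tendsto_integral_gaussian_smul' hfi h0
  have hf0 : f 0 = 1 := by simp [hf, hr.2.2.2.1]
  rw [hf0] at T1
  have T2 : Tendsto (fun c : ℝ => ((∫ w : ℝ, Real.exp (-c⁻¹ * w^2) * fourierCos r w : ℝ) : ℂ)) atTop (nhds 1) := by
    apply T1.congr'
    filter_upwards [Ioi_mem_atTop 0] with c (hc : 0 < c)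
    have J : Integrable (fun w : ℝ ↦ Complex.exp (- (c:ℂ)⁻¹ * ‖w‖ ^ 2 + 2 * π * Complex.I * ⟪(0:ℝ), w⟫)) :=
      GaussianFourier.integrable_cexp_neg_mul_sq_norm_add (by simpa) _ _
    have K : (∫ w : ℝ, 𝓕 (fun w : ℝ ↦ Complex.exp (- (c:ℂ)⁻¹ * ‖w‖ ^ 2 + 2 * π * Complex.I * ⟪(0:ℝ), w⟫)) w • f w)
       = ∫ w : ℝ, Complex.exp (- (c:ℂ)⁻¹ * ‖w‖ ^ 2 + 2 * π * Complex.I * ⟪(0:ℝ), w⟫) • 𝓕 f w := by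
      simpa using! (VectorFourier.integral_fourierIntegral_smul_eq_flip (L := innerₗ ℝ)
        Real.continuous_fourierChar continuous_inner J hfi)
    have e1 : (∫ w : ℝ, (((π * c : ℂ) ^ (Module.finrank ℝ ℝ / 2 : ℂ)) * Complex.exp (-π ^ 2 * c * ‖0 - w‖ ^ 2)) • f w)
       = ∫ w : ℝ, 𝓕 (fun w : ℝ ↦ Complex.exp (- (c:ℂ)⁻¹ * ‖w‖ ^ 2 + 2 * π * Complex.I * ⟪(0:ℝ), w⟫)) w • f w := by
      congr with w
      rw [fourier_gaussian_innerProductSpace' (by simpa)]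
      congr 2
      · simp only [div_inv_eq_mul]
      · congr 1
        simp only [div_inv_eq_mul]; ring
    rw [e1, K, intC]
    congr 1; ext w
    rw [fc_eq hr w, smul_eq_mul]
    push_cast
    congr 2
    simp only [inner_zero_left, Complex.ofReal_zero, mul_zero, add_zero]
    rw [← Complex.ofReal_pow, Real.norm_eq_abs, sq_abs]
    push_cast; ring
  have := (Complex.continuous_re.tendsto _).comp T2
  exact this.congr (fun c => Complex.ofReal_re _)

lemma fc_integrable (hr : memA lam r) : Integrable (fourierCos r) := by
  have hc := fc_cont hr
  have hnn := hr.2.2.2.2.2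
  apply integrable_of_intervalIntegral_norm_bounded (a := fun n : ℕ => -(n:ℝ)) (b := fun n : ℕ => (n:ℝ)) (l := atTop) 4
  · intro i; exact (hc.integrableOn_Icc (a := -(i:ℝ)) (b := i)).mono_set Set.Ioc_subset_Icc_self
  · exact tendsto_neg_atTop_atBot.comp tendsto_natCast_atTop_atTop
  · exact tendsto_natCast_atTop_atTop
  refine Eventually.of_forall fun n => ?_
  have t1 : ∀ᶠ c : ℝ in atTop, ∫ w : ℝ, Real.exp (-c⁻¹ * w^2) * fourierCos r w ≤ 2 :=
    (fc_reg hr).eventually (eventually_le_nhds (by norm_num))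
  have t2 : ∀ᶠ c : ℝ in atTop, Real.exp (c⁻¹ * (n:ℝ)^2) ≤ 2 := by
    have : Tendsto (fun c : ℝ => Real.exp (c⁻¹ * (n:ℝ)^2)) atTop (nhds (Real.exp (0 * (n:ℝ)^2))) :=
      (Real.continuous_exp.tendsto _).comp (tendsto_inv_atTop_zero.mul_const _)
    rw [zero_mul, Real.exp_zero] at this
    exact this.eventually (eventually_le_nhds (by norm_num))
  obtain ⟨c, h1, h2, hc0⟩ := (t1.and (t2.and (eventually_gt_atTop 0))).exists
  have hci : 0 < c⁻¹ := inv_pos.2 hc0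
  have hGi : Integrable (fun w : ℝ => Real.exp (-c⁻¹ * w^2) * fourierCos r w) := by
    apply (integrable_exp_neg_mul_sq hci).mul_bdd (c := ∫ u, |r u|) hc.aestronglyMeasurable
    refine Eventually.of_forall fun x => ?_
    unfold fourierCos
    refine (norm_integral_le_of_norm_le hr.2.2.1.abs (Eventually.of_forall fun u => ?_))
    rw [Real.norm_eq_abs, abs_mul]
    exact mul_le_of_le_one_right (abs_nonneg _) (Real.abs_cos_le_one _)
  have hn : -(n:ℝ) ≤ n := by linarith [Nat.cast_nonneg (α := ℝ) n]
  rw [intervalIntegral.integral_of_le hn]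
  calc ∫ x in Set.Ioc (-(n:ℝ)) n, ‖fourierCos r x‖ ≤ ∫ x in Set.Ioc (-(n:ℝ)) n, 2 * (Real.exp (-c⁻¹ * x^2) * fourierCos r x) := by
        apply setIntegral_mono_on _ (hGi.const_mul 2).integrableOn measurableSet_Ioc
        · intro x hx
          rw [Real.norm_eq_abs, abs_of_nonneg (hnn x)]
          have hx2 : x^2 ≤ (n:ℝ)^2 := sq_le_sq' hx.1.le hx.2
          have : 1 ≤ 2 * Real.exp (-c⁻¹ * x^2) := by
            have e : Real.exp (c⁻¹ * x^2) * Real.exp (-c⁻¹ * x^2) = 1 := by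
              rw [← Real.exp_add]; simp
            have : Real.exp (c⁻¹ * x^2) ≤ 2 := le_trans (Real.exp_le_exp.2 (by gcongr)) h2
            nlinarith [Real.exp_pos (-c⁻¹ * x^2)]
          nlinarith [hnn x]
        · exact ((hc.norm.integrableOn_Icc (a := -(n:ℝ)) (b := n)).mono_set Set.Ioc_subset_Icc_self)
    _ ≤ ∫ x, 2 * (Real.exp (-c⁻¹ * x^2) * fourierCos r x) := by
        apply setIntegral_le_integral (hGi.const_mul 2)
        refine Eventually.of_forall fun x => ?_
        have := hnn x
        simp only [Pi.zero_apply]; positivity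
    _ ≤ 4 := by rw [integral_const_mul]; linarith

lemma fc_inv (hr : memA lam r) (v : ℝ) : ∫ α : ℝ, Complex.exp (((2*π*α*v:ℝ):ℂ) * Complex.I) * (fourierCos r α : ℂ) = (r v : ℂ) := by
  have h1 : 𝓕 (fun x => (r x : ℂ)) = fun α => (fourierCos r α : ℂ) := funext (fc_eq hr)
  have h := (rC_int hr).fourierInv_fourier_eq (by rw [h1]; exact (fc_integrable hr).ofReal) (v := v)
    (Complex.continuous_ofReal.comp hr.1).continuousAt
  rw [h1, Real.fourierInv_eq'] at h
  rw [← h]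
  congr 1; ext α
  simp only [smul_eq_mul, RCLike.inner_apply, conj_trivial]
  congr 3
  ring_nf

lemma r_le_one (hr : memA lam r) (v : ℝ) : r v ≤ 1 := by
  have h0 := fc_inv hr 0
  have hv := fc_inv hr v
  have e0 : ((∫ α, fourierCos r α : ℝ):ℂ) = 1 := by
    have : (r 0 : ℂ) = 1 := by rw [hr.2.2.2.1]; simp
    rw [← this, ← h0, intC]
    congr 1; ext α; simp
  have e1 : ∫ α, fourierCos r α = 1 := by exact_mod_cast e0
  have : ‖(r v : ℂ)‖ ≤ 1 := by
    rw [← hv, ← e1]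
    apply norm_integral_le_of_norm_le (fc_integrable hr)
    refine Eventually.of_forall fun α => ?_
    rw [norm_mul, Complex.norm_exp_ofReal_mul_I, one_mul, Complex.norm_real, Real.norm_eq_abs, abs_of_nonneg (hr.2.2.2.2.2 α)]
  rw [Complex.norm_real] at this
  exact (le_abs_self _).trans this

lemma SZ_sq (Z : Finset ℝ) (u W y : ℝ) : ((‖SZ Z u W y‖^2 : ℝ) : ℂ) =
    ∑ γ ∈ Z, ∑ γ' ∈ Z, (((ordMult γ : ℝ) * Kg u W γ * ((ordMult γ' : ℝ) * Kg u W γ') : ℝ) : ℂ) * Complex.exp (((y * (γ - γ') : ℝ):ℂ) * Complex.I) := by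
  have hG : ∀ γ : ℝ, Gt u W y γ = (Kg u W γ : ℂ) * Complex.exp (((y * γ : ℝ):ℂ) * Complex.I) := by
    intro γ
    unfold Gt Kg
    push_cast
    rw [← Complex.exp_add]
    congr 1; ring
  rw [Complex.ofReal_pow, ← Complex.mul_conj']
  unfold SZ
  rw [map_sum, Finset.sum_mul_sum]
  refine Finset.sum_congr rfl fun γ _ => Finset.sum_congr rfl fun γ' _ => ?_
  rw [hG, hG]
  simp only [map_mul, Complex.conj_natCast, Complex.conj_ofReal, ← Complex.exp_conj, Complex.conj_I]
  have : Complex.exp (((y * (γ - γ') : ℝ):ℂ) * Complex.I) = Complex.exp (((y * γ : ℝ):ℂ) * Complex.I) * Complex.exp (((y * γ' : ℝ):ℂ) * -Complex.I) := by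
    rw [← Complex.exp_add]; congr 1; push_cast; ring
  rw [this]; push_cast; ring

lemma SZ_cont (Z : Finset ℝ) (u W : ℝ) : Continuous (fun y => SZ Z u W y) := by
  unfold SZ Gt
  fun_prop

lemma Q_eq (hr : memA lam r) (Z : Finset ℝ) (u W L : ℝ) :
    Integrable (fun α => fourierCos r α * ‖SZ Z u W (α * L)‖^2) ∧
    ∑ γ ∈ Z, ∑ γ' ∈ Z, ((ordMult γ : ℝ) * Kg u W γ * ((ordMult γ' : ℝ) * Kg u W γ')) * r ((γ - γ') * L / (2*π))
      = ∫ α, fourierCos r α * ‖SZ Z u W (α * L)‖^2 := by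
  have hfi := fc_integrable hr
  have hint : ∀ γ γ' : ℝ, Integrable (fun α : ℝ => (((ordMult γ : ℝ) * Kg u W γ * ((ordMult γ' : ℝ) * Kg u W γ') : ℝ) : ℂ) * (Complex.exp (((2*π*α*((γ - γ') * L / (2*π)):ℝ):ℂ) * Complex.I) * (fourierCos r α : ℂ))) := by
    intro γ γ'
    apply Integrable.const_mul
    apply hfi.ofReal.bdd_mul (c := 1)
    · apply Continuous.aestronglyMeasurable; fun_prop
    · refine Eventually.of_forall fun x => ?_
      rw [Complex.norm_exp_ofReal_mul_I]
  have e : ∀ α : ℝ, ((fourierCos r α * ‖SZ Z u W (α * L)‖^2 : ℝ) : ℂ) = ∑ γ ∈ Z, ∑ γ' ∈ Z, (((ordMult γ : ℝ) * Kg u W γ * ((ordMult γ' : ℝ) * Kg u W γ') : ℝ) : ℂ) * (Complex.exp (((2*π*α*((γ - γ') * L / (2*π)):ℝ):ℂ) * Complex.I) * (fourierCos r α : ℂ)) := by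
    intro α
    rw [Complex.ofReal_mul, SZ_sq, Finset.mul_sum]
    refine Finset.sum_congr rfl fun γ _ => ?_
    rw [Finset.mul_sum]
    refine Finset.sum_congr rfl fun γ' _ => ?_
    have : 2*π*α*((γ - γ') * L / (2*π)) = α * L * (γ - γ') := by
      have := Real.pi_pos
      field_simp
    rw [this]; ring
  have hI : Integrable (fun α => ((fourierCos r α * ‖SZ Z u W (α * L)‖^2 : ℝ) : ℂ)) := by
    simp_rw [e]
    exact integrable_finsetSum _ fun γ _ => integrable_finsetSum _ fun γ' _ => hint γ γ'
  refine ⟨?_, ?_⟩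
  · exact hI.re.congr (Eventually.of_forall fun α => Complex.ofReal_re _)
  · apply Complex.ofReal_injective
    rw [intC]
    simp_rw [e]
    rw [integral_finsetSum _ fun γ _ => integrable_finsetSum _ fun γ' _ => hint γ γ']
    rw [Complex.ofReal_sum]
    refine Finset.sum_congr rfl fun γ _ => ?_
    rw [integral_finsetSum _ fun γ' _ => hint γ γ', Complex.ofReal_sum]
    refine Finset.sum_congr rfl fun γ' _ => ?_
    rw [integral_const_mul, fc_inv hr, Complex.ofReal_mul]

end FT

end

section

def Mp (n : ℕ) : ℝ := ∑ p ∈ Nat.primesLE n, Real.log p / p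

lemma log_fact (n : ℕ) : Real.log (n.factorial : ℝ) = ∑ p ∈ Nat.primesLE n, ((n.factorial).factorization p : ℝ) * Real.log p := by
  have h : n.factorial = ∏ p ∈ Nat.primesLE n, p ^ (n.factorial).factorization p := by
    conv_lhs => rw [← Nat.prod_factorization_pow_eq_self (Nat.factorial_ne_zero n)]
    rw [Nat.prod_factorization_eq_prod_primeFactors]
    apply Finset.prod_congr _ (fun _ _ => rfl)
    ext p
    rw [Nat.mem_primesLE, Nat.mem_primeFactors]
    constructor
    · rintro ⟨hp, hd, _⟩; exact ⟨(hp.dvd_factorial).1 hd, hp⟩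
    · rintro ⟨hp, hd⟩; exact ⟨hd, (hd.dvd_factorial).2 hp, Nat.factorial_ne_zero n⟩
  have h2 : (n.factorial : ℝ) = ∏ p ∈ Nat.primesLE n, (p:ℝ) ^ (n.factorial).factorization p := by
    conv_lhs => rw [h]
    push_cast; rfl
  rw [h2, Real.log_prod]
  · refine Finset.sum_congr rfl fun p _ => ?_
    rw [Real.log_pow]
  · intro p hp
    have := (Nat.mem_primesLE.1 hp).2.pos
    positivity

lemma log_sum_bd : ∃ C : ℝ, 0 ≤ C ∧ ∀ s : Finset ℕ, ∑ m ∈ s, Real.log m / (m * (m - 1)) ≤ C := by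
  have hs : Summable (fun m : ℕ => 4 * (1 / (m:ℝ)^(3/2:ℝ))) :=
    (Real.summable_one_div_nat_rpow.2 (by norm_num)).mul_left 4
  refine ⟨∑' m : ℕ, 4 * (1 / (m:ℝ)^(3/2:ℝ)), tsum_nonneg fun m => by positivity, fun s => ?_⟩
  refine le_trans (Finset.sum_le_sum fun m _ => ?_) (hs.sum_le_tsum s fun m _ => by positivity)
  rcases Nat.lt_or_ge m 2 with h | h
  · interval_cases m <;> simp
  have hm : (2:ℝ) ≤ m := by exact_mod_cast h
  have h1 : Real.log m ≤ 2 * (m:ℝ)^(1/2:ℝ) := by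
    have := Real.log_le_rpow_div (x := (m:ℝ)) (by positivity) (ε := 1/2) (by norm_num)
    linarith
  have h2 : (m:ℝ)^(1/2:ℝ) * (m:ℝ)^(3/2:ℝ) = m^2 := by
    rw [← Real.rpow_add (by positivity)]; norm_num
  rw [mul_one_div, div_le_div_iff₀ (by nlinarith) (by positivity)]
  calc Real.log m * (m:ℝ)^(3/2:ℝ) ≤ 2 * (m:ℝ)^(1/2:ℝ) * (m:ℝ)^(3/2:ℝ) := by gcongr
    _ = 2 * m^2 := by rw [mul_assoc, h2]
    _ ≤ 4 * (m * (m-1)) := by nlinarith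

lemma mertens_nat : ∃ C : ℝ, 0 ≤ C ∧ ∀ n : ℕ, 1 ≤ n → |Mp n - Real.log n| ≤ C := by
  obtain ⟨C, hC, hb⟩ := log_sum_bd
  refine ⟨C + 2, by linarith, fun n hn => ?_⟩
  have hn0 : (0:ℝ) < n := by exact_mod_cast hn
  have hlf := log_fact n
  have lo : (n:ℝ) * Real.log n - n ≤ Real.log (n.factorial : ℝ) := by
    have h1 := Stirling.le_log_factorial_stirling (n := n) (by omega)
    have h2 : 0 ≤ Real.log n := Real.log_nonneg (by exact_mod_cast hn)
    have h3 : 0 ≤ Real.log (2*π) := Real.log_nonneg (by linarith [Real.pi_gt_three])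
    linarith
  have hi : Real.log (n.factorial : ℝ) ≤ (n:ℝ) * Real.log n := by
    rw [← Real.log_pow]
    apply Real.log_le_log (by exact_mod_cast Nat.factorial_pos n)
    exact_mod_cast Nat.factorial_le_pow n
  have a1 : Real.log (n.factorial : ℝ) ≤ n * (Mp n + C) := by
    rw [hlf]
    have : ∑ p ∈ Nat.primesLE n, ((n.factorial).factorization p : ℝ) * Real.log p ≤
        ∑ p ∈ Nat.primesLE n, (n * (Real.log p / p) + n * (Real.log p / (p * (p-1)))) := by
      refine Finset.sum_le_sum fun p hp => ?_
      have hp' := (Nat.mem_primesLE.1 hp).2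
      have hp2 : (2:ℝ) ≤ p := by exact_mod_cast hp'.two_le
      have h1 := Nat.factorization_factorial_le_div_pred hp' n
      have h2 : ((n.factorial).factorization p : ℝ) ≤ n / (p - 1) := by
        calc ((n.factorial).factorization p : ℝ) ≤ ((n / (p-1) : ℕ) : ℝ) := by exact_mod_cast h1
          _ ≤ (n:ℝ) / ((p - 1 : ℕ) : ℝ) := Nat.cast_div_le
          _ = n / (p-1) := by rw [Nat.cast_sub hp'.one_le]; simp
      have h3 : 0 ≤ Real.log p := Real.log_nonneg (by linarith)
      calc _ ≤ n / ((p:ℝ) - 1) * Real.log p := by gcongr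
        _ = _ := by
          have : (p:ℝ) - 1 ≠ 0 := by linarith
          have : (p:ℝ) ≠ 0 := by linarith
          field_simp; ring
    refine this.trans ?_
    rw [Finset.sum_add_distrib, ← Finset.mul_sum, ← Finset.mul_sum, mul_add]
    have := hb (Nat.primesLE n)
    unfold Mp
    gcongr
  have a2 : n * Mp n - Real.log 4 * n ≤ Real.log (n.factorial : ℝ) := by
    rw [hlf]
    have ht := Chebyshev.theta_le_log4_mul_x (x := n) hn0.le
    rw [Chebyshev.theta_eq_sum_primesLE_log] at ht
    have : ∑ p ∈ Nat.primesLE n, (n * (Real.log p / p) - Real.log p) ≤ ∑ p ∈ Nat.primesLE n, ((n.factorial).factorization p : ℝ) * Real.log p := by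
      refine Finset.sum_le_sum fun p hp => ?_
      obtain ⟨hpn, hp'⟩ := Nat.mem_primesLE.1 hp
      have hp2 : (2:ℝ) ≤ p := by exact_mod_cast hp'.two_le
      have h3 : 0 ≤ Real.log p := Real.log_nonneg (by linarith)
      have h1 : n / p ≤ (n.factorial).factorization p := by
        rw [Nat.factorization_factorial hp' (Nat.lt_add_one (Nat.log p n))]
        have hl : 1 ∈ Finset.Ico 1 (Nat.log p n + 1) := by
          have := Nat.log_pos hp'.one_lt hpn
          rw [Finset.mem_Ico]; omega
        have := Finset.single_le_sum (f := fun i => n / p^i) (fun i _ => Nat.zero_le _) hl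
        simpa using this
      have h2 : (n:ℝ)/p - 1 ≤ ((n.factorial).factorization p : ℝ) := by
        have e1 : ((n / p : ℕ):ℝ) ≤ ((n.factorial).factorization p : ℝ) := by exact_mod_cast h1
        have e2 : (n:ℝ)/p < ((n / p : ℕ):ℝ) + 1 := by
          rw [div_lt_iff₀ (by linarith)]
          have := Nat.lt_mul_div_succ n hp'.pos
          have : (n:ℝ) < p * ((n/p:ℕ) + 1) := by exact_mod_cast this
          linarith
        linarith
      calc _ = ((n:ℝ)/p - 1) * Real.log p := by ring
        _ ≤ _ := by gcongr
    refine le_trans ?_ this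
    rw [Finset.sum_sub_distrib, ← Finset.mul_sum]
    unfold Mp
    linarith
  have l4 : Real.log 4 ≤ 2 := by
    have : (4:ℝ) = 2^2 := by norm_num
    rw [this, Real.log_pow]
    push_cast
    linarith [Real.log_two_lt_d9]
  rw [abs_le]
  constructor
  · have : n * Real.log n ≤ n * (Mp n + C + 1) := by linarith
    have := le_of_mul_le_mul_left this hn0
    linarith
  · have : n * Mp n ≤ n * (Real.log n + Real.log 4) := by linarith
    have := le_of_mul_le_mul_left this hn0
    linarith

lemma mertens_real : ∃ C : ℝ, 0 ≤ C ∧ ∀ x : ℝ, 1 ≤ x → |Mp ⌊x⌋₊ - Real.log x| ≤ C := by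
  obtain ⟨C, hC, h⟩ := mertens_nat
  refine ⟨C + 1, by linarith, fun x hx => ?_⟩
  have hf : 1 ≤ ⌊x⌋₊ := Nat.le_floor (by simpa using hx)
  have h1 := h _ hf
  have hf' : (1:ℝ) ≤ ⌊x⌋₊ := by exact_mod_cast hf
  have h2 : Real.log ⌊x⌋₊ ≤ Real.log x := Real.log_le_log (by linarith) (Nat.floor_le (by linarith))
  have h3 : Real.log x ≤ Real.log ⌊x⌋₊ + 1 := by
    have : x ≤ 2 * ⌊x⌋₊ := by have := Nat.lt_floor_add_one x; linarith
    have := Real.log_le_log (by linarith) this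
    rw [Real.log_mul (by norm_num) (by linarith)] at this
    linarith [Real.log_two_lt_d9]
  rw [abs_le] at h1 ⊢
  constructor <;> linarith [h1.1, h1.2]

lemma mertens_range : ∃ C : ℝ, 0 ≤ C ∧ ∀ x y : ℝ, 1 ≤ x → x ≤ y → ∀ P : Finset ℕ, (∀ p : ℕ, p.Prime → x < p → (p:ℝ) ≤ y → p ∈ P) →
    Real.log y - Real.log x - C ≤ ∑ p ∈ P, Real.log p / p := by
  obtain ⟨C, hC, h⟩ := mertens_real
  refine ⟨2 * C, by linarith, fun x y hx hxy P hP => ?_⟩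
  have h1 := abs_le.1 (h x hx)
  have h2 := abs_le.1 (h y (hx.trans hxy))
  have hsub : Nat.primesLE ⌊x⌋₊ ⊆ Nat.primesLE ⌊y⌋₊ := by
    intro p hp
    rw [Nat.mem_primesLE] at hp ⊢
    exact ⟨hp.1.trans (Nat.floor_mono hxy), hp.2⟩
  have h3 : Mp ⌊y⌋₊ - Mp ⌊x⌋₊ = ∑ p ∈ Nat.primesLE ⌊y⌋₊ \ Nat.primesLE ⌊x⌋₊, Real.log p / p := by
    unfold Mp
    rw [← Finset.sum_sdiff hsub]; ring
  have h4 : ∑ p ∈ Nat.primesLE ⌊y⌋₊ \ Nat.primesLE ⌊x⌋₊, Real.log p / p ≤ ∑ p ∈ P, Real.log p / p := by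
    apply Finset.sum_le_sum_of_subset_of_nonneg
    · intro p hp
      rw [Finset.mem_sdiff, Nat.mem_primesLE, Nat.mem_primesLE] at hp
      obtain ⟨⟨ha, hb⟩, hc⟩ := hp
      apply hP p hb
      · rw [← Nat.floor_lt (by linarith)]
        by_contra hcon
        exact hc ⟨by omega, hb⟩
      · exact (Nat.le_floor_iff (by linarith)).1 ha
    · intro p _ _
      positivity
  linarith [h1.1, h1.2, h2.1, h2.2]

lemma mertens_wt {g : ℝ → ℝ} (hg : Continuous g) {κ η : ℝ} (hκ : 0 < κ) (hη : 0 < η) (hg0 : ∀ x, 0 ≤ x → 0 ≤ g x) :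
    ∃ L0 : ℝ, 1 ≤ L0 ∧ ∀ L : ℝ, L0 ≤ L → L * ((∫ x in (0:ℝ)..κ, g x) - η) ≤
      ∑ p ∈ Nat.primesLE ⌊Real.exp (κ * L)⌋₊, Real.log p / p * g (Real.log p / L) := by
  obtain ⟨C, hC, hM⟩ := mertens_range
  set e := η / (4 * κ) with he
  have he0 : 0 < e := by positivity
  have hu := isCompact_Icc.uniformContinuousOn_of_continuous (s := Set.Icc 0 κ) hg.continuousOn
  rw [Metric.uniformContinuousOn_iff] at hu
  obtain ⟨d, hd, hu⟩ := hu e he0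
  obtain ⟨B, hB⟩ := isCompact_Icc.exists_bound_of_continuousOn (s := Set.Icc 0 κ) hg.continuousOn
  have hB0 : 0 ≤ B := (norm_nonneg _).trans (hB 0 ⟨le_rfl, hκ.le⟩)
  obtain ⟨n, hn⟩ := exists_nat_gt (κ / d)
  have hn0 : (0:ℝ) < n := lt_of_le_of_lt (by positivity) hn
  have hnd : κ / n < d := by
    rw [div_lt_iff₀ hd] at hn
    rw [div_lt_iff₀ hn0]; linarith
  set a : ℕ → ℝ := fun i => i * (κ / n) with ha
  have ha0 : ∀ i, 0 ≤ a i := fun i => by positivity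
  have haS : ∀ i, a (i+1) = a i + κ / n := fun i => by simp only [ha]; push_cast; ring
  have hmono : Monotone a := by
    apply monotone_nat_of_le_succ
    intro i
    have : 0 < κ / n := by positivity
    rw [haS]; linarith
  have han : a n = κ := by simp only [ha]; field_simp
  have hin : ∀ i < n, ∀ x, a i ≤ x → x ≤ a (i+1) → |g x - g (a i)| < e := by
    intro i hi x h1 h2
    have h3 : a (i+1) ≤ κ := by rw [← han]; exact hmono (by omega)
    have := hu x ⟨(ha0 i).trans h1, h2.trans h3⟩ (a i) ⟨ha0 i, (h1.trans h2).trans h3⟩ (by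
      rw [Real.dist_eq, abs_of_nonneg (by linarith)]
      rw [haS] at h2; linarith)
    rwa [Real.dist_eq] at this
  refine ⟨max 1 (2 * (n * (B * C)) / η), le_max_left _ _, fun L hL => ?_⟩
  have hL1 : 1 ≤ L := (le_max_left _ _).trans hL
  have hL0 : 0 < L := by linarith
  have hL2 : n * (B * C) ≤ L * η / 2 := by
    have := (le_max_right _ _).trans hL
    rw [div_le_iff₀ hη] at this
    linarith
  set P := Nat.primesLE ⌊Real.exp (κ * L)⌋₊ with hP
  set F : ℕ → ℝ := fun p => Real.log p / p * g (Real.log p / L) with hF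
  have hF0 : ∀ p, 0 ≤ F p := fun p => by
    simp only [hF]
    have h1 : 0 ≤ Real.log (p:ℝ) := Real.log_natCast_nonneg p
    have := hg0 (Real.log p / L) (by positivity)
    positivity
  set Pi : ℕ → Finset ℕ := fun i => P.filter (fun p => a i * L < Real.log p ∧ Real.log p ≤ a (i+1) * L) with hPi
  have hdis : Set.PairwiseDisjoint (↑(Finset.range n)) Pi := by
    intro i _ j _ hij
    rw [Function.onFun, Finset.disjoint_left]
    intro p hp hq
    simp only [hPi, Finset.mem_filter] at hp hq
    rcases lt_or_gt_of_ne hij with h | h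
    · have := mul_le_mul_of_nonneg_right (hmono (show i+1 ≤ j by omega)) hL0.le
      linarith [hp.2.2, hq.2.1]
    · have := mul_le_mul_of_nonneg_right (hmono (show j+1 ≤ i by omega)) hL0.le
      linarith [hp.2.1, hq.2.2]
  have s1 : ∑ i ∈ Finset.range n, ∑ p ∈ Pi i, F p ≤ ∑ p ∈ P, F p := by
    rw [← Finset.sum_biUnion hdis]
    apply Finset.sum_le_sum_of_subset_of_nonneg
    · intro p hp
      rw [Finset.mem_biUnion] at hp
      obtain ⟨i, _, hp⟩ := hp
      exact (Finset.mem_filter.1 hp).1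
    · intro p _ _; exact hF0 p
  have s2 : ∀ i ∈ Finset.range n, L * (∫ x in a i..a (i+1), g x) - L * (2 * e * (κ/n)) - B * C ≤ ∑ p ∈ Pi i, F p := by
    intro i hi
    have hi' : i < n := Finset.mem_range.1 hi
    have hkn : 0 < κ / n := by positivity
    set m := max (g (a i) - e) 0 with hm
    have hm0 : 0 ≤ m := le_max_right _ _
    have haκ : a (i+1) ≤ κ := by rw [← han]; exact hmono (by omega)
    have hmB : m ≤ B := by
      apply max_le _ hB0
      have := hB (a i) ⟨ha0 i, (hmono (Nat.le_succ i)).trans haκ⟩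
      have := (le_abs_self _).trans this
      linarith
    have t1 : m * (L * (κ/n) - C) ≤ ∑ p ∈ Pi i, F p := by
      have := hM (Real.exp (a i * L)) (Real.exp (a (i+1) * L)) (Real.one_le_exp (mul_nonneg (ha0 i) hL0.le))
        (Real.exp_le_exp.2 (mul_le_mul_of_nonneg_right (hmono (Nat.le_succ i)) hL0.le)) (Pi i) (by
          intro p hp h1 h2
          have hp0 : (0:ℝ) < p := by exact_mod_cast hp.pos
          simp only [hPi, Finset.mem_filter, hP, Nat.mem_primesLE]
          refine ⟨⟨?_, hp⟩, (Real.lt_log_iff_exp_lt hp0).2 h1, (Real.log_le_iff_le_exp hp0).2 h2⟩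
          apply Nat.le_floor
          exact h2.trans (Real.exp_le_exp.2 (mul_le_mul_of_nonneg_right haκ hL0.le)))
      rw [Real.log_exp, Real.log_exp, haS] at this
      calc m * (L * (κ/n) - C) ≤ m * ∑ p ∈ Pi i, Real.log p / p := by
            apply mul_le_mul_of_nonneg_left _ hm0; linarith
        _ ≤ _ := by
          rw [Finset.mul_sum]
          refine Finset.sum_le_sum fun p hp => ?_
          simp only [hPi, Finset.mem_filter] at hp
          have h1 := hin i hi' (Real.log p / L) (by rw [le_div_iff₀ hL0]; exact hp.2.1.le) (by rw [div_le_iff₀ hL0]; exact hp.2.2)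
          have h2 : m ≤ g (Real.log p / L) := by
            apply max_le
            · linarith [(abs_lt.1 h1).1]
            · exact hg0 _ (div_nonneg (Real.log_natCast_nonneg p) hL0.le)
          simp only [hF]
          rw [mul_comm]
          gcongr
    have t2 : ∫ x in a i..a (i+1), g x ≤ (m + 2 * e) * (κ / n) := by
      have : ∫ x in a i..a (i+1), g x ≤ ∫ x in a i..a (i+1), (m + 2 * e) := by
        apply intervalIntegral.integral_mono_on (hmono (Nat.le_succ i)) (hg.intervalIntegrable _ _) (continuous_const.intervalIntegrable _ _)
        intro x hx
        have := hin i hi' x hx.1 hx.2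
        have : g (a i) - e ≤ m := le_max_left _ _
        linarith [(abs_lt.1 ‹|g x - g (a i)| < e›).2]
      rw [intervalIntegral.integral_const, haS] at this
      rw [haS]
      simpa [mul_comm] using this
    have t3 := mul_le_mul_of_nonneg_left t2 hL0.le
    have t4 := mul_le_mul_of_nonneg_right hmB hC
    linarith
  have s3 := Finset.sum_le_sum s2
  have s4 : ∑ i ∈ Finset.range n, ∫ x in a i..a (i+1), g x = ∫ x in (0:ℝ)..κ, g x := by
    rw [intervalIntegral.sum_integral_adjacent_intervals (fun i _ => hg.intervalIntegrable _ _), han]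
    simp [ha]
  rw [Finset.sum_sub_distrib, Finset.sum_sub_distrib, ← Finset.mul_sum, s4] at s3
  simp only [Finset.sum_const, Finset.card_range, nsmul_eq_mul] at s3
  have s5 : (n:ℝ) * (L * (2 * e * (κ/n))) = L * η / 2 := by
    rw [he]; field_simp; ring
  linarith

end

section

lemma gauss_half {θ : ℝ} (hθ : 0 < θ) : ∃ B : ℝ, 1 ≤ B ∧ (1 - θ) * (√π / 2) ≤ ∫ s in (0:ℝ)..B, Real.exp (-s^2) := by
  have h1 : IntegrableOn (fun s : ℝ => Real.exp (-s^2)) (Set.Ioi 0) := by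
    have := integrable_exp_neg_mul_sq (b := 1) one_pos
    simp only [neg_mul, one_mul] at this
    exact this.integrableOn
  have h2 := intervalIntegral_tendsto_integral_Ioi 0 h1 tendsto_id
  have h3 : ∫ s in Set.Ioi (0:ℝ), Real.exp (-s^2) = √π / 2 := by
    have := integral_gaussian_Ioi 1
    simpa only [neg_mul, one_mul, div_one] using this
  rw [h3] at h2
  have hpi : 0 < √π := Real.sqrt_pos.2 Real.pi_pos
  have h4 := h2.eventually (eventually_ge_nhds (show (1 - θ) * (√π / 2) < √π / 2 by nlinarith))
  obtain ⟨B, hB, hB1⟩ := (h4.and (eventually_ge_atTop 1)).exists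
  exact ⟨B, hB1, hB⟩

lemma gauss_two (B : ℝ) : ∫ s in (-B)..B, Real.exp (-s^2) = 2 * ∫ s in (0:ℝ)..B, Real.exp (-s^2) := by
  have hc : Continuous (fun s : ℝ => Real.exp (-s^2)) := by fun_prop
  rw [← intervalIntegral.integral_add_adjacent_intervals (hc.intervalIntegrable (-B) 0) (hc.intervalIntegrable 0 B)]
  have : ∫ s in (-B)..0, Real.exp (-s^2) = ∫ s in (0:ℝ)..B, Real.exp (-s^2) := by
    have := intervalIntegral.integral_comp_neg (a := 0) (b := B) (fun s : ℝ => Real.exp (-s^2))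
    simpa using this.symm
  rw [this]; ring

lemma growth (k : ℕ) (K : ℝ) {a b : ℝ} (hab : a < b) :
    ∀ᶠ T : ℝ in atTop, K * (Real.log T)^k * Real.exp (a * Real.log T) ≤ Real.exp (b * Real.log T) := by
  have hd : 0 < b - a := by linarith
  have h1 : Tendsto (fun T : ℝ => (b-a) * Real.log T) atTop atTop := Real.tendsto_log_atTop.const_mul_atTop hd
  have h2 := ((Real.tendsto_pow_mul_exp_neg_atTop_nhds_zero k).comp h1).const_mul (K / (b-a)^k)
  rw [mul_zero] at h2
  filter_upwards [h2.eventually (eventually_le_nhds one_pos)] with T hT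
  simp only [Function.comp] at hT
  have e : Real.exp (b * Real.log T) = Real.exp ((b-a) * Real.log T) * Real.exp (a * Real.log T) := by
    rw [← Real.exp_add]; congr 1; ring
  rw [e]
  apply mul_le_mul_of_nonneg_right _ (Real.exp_pos _).le
  have e2 : K / (b-a)^k * (((b-a) * Real.log T)^k * Real.exp (-((b-a) * Real.log T))) = K * (Real.log T)^k * Real.exp (-((b-a) * Real.log T)) := by
    rw [mul_pow]; field_simp
  rw [e2, Real.exp_neg, ← div_eq_mul_inv, div_le_one (Real.exp_pos _)] at hT
  exact hT

lemma sq_low {X M e θ : ℝ} (hθ : 0 < θ) (he : 0 ≤ e) (hM : 0 ≤ M) (hX : 0 ≤ X) (h : M ≤ X + e) : (1 - θ) * M^2 - e^2/θ ≤ X^2 := by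
  have h1 : (1-θ)*M^2 - e^2/θ ≤ (M-e)^2 - e^2 := by
    have : 0 ≤ (θ * M - e)^2/θ := by positivity
    have e1 : (θ * M - e)^2/θ = θ * M^2 - 2 * M * e + e^2/θ := by field_simp; ring
    nlinarith
  by_cases h2 : e ≤ M
  · nlinarith [mul_self_nonneg (X - (M-e))]
  · have : (M - e)^2 ≤ e^2 := by nlinarith
    nlinarith

lemma local_low {S M : ℝ → ℂ} {ρ : ℝ → ℝ} (hS : Continuous S) (hρ : Continuous ρ) {c W s1 s2 A E R θ : ℝ} (hW : 0 < W) (hs : s1 ≤ s2)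
    (hθ : 0 < θ) (hA : 0 ≤ A) (hE : 0 ≤ E) (hR : 0 ≤ R)
    (hM : ∀ y, ‖M y‖ = A * (W * √(2*π) * Real.exp (-(W^2 * (y - c)^2 / 2))))
    (hb : ∀ y, c + s1/W ≤ y → y ≤ c + s2/W → ‖2 * π * S y - M y‖ ≤ E)
    (hr : ∀ y, c + s1/W ≤ y → y ≤ c + s2/W → R ≤ ρ y) :
    R / (4*π^2) * ((1 - θ) * A^2 * (2*π*W) * (∫ s in s1..s2, Real.exp (-s^2)) - E^2 * (s2 - s1) / (θ * W)) ≤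
      ∫ y in (c + s1/W)..(c + s2/W), ρ y * ‖S y‖^2 := by
  have hle : c + s1/W ≤ c + s2/W := by gcongr
  have key : ∫ y in (c + s1/W)..(c + s2/W), (R / (4*π^2) * ((1 - θ) * A^2 * (2*π*W^2)) * Real.exp (-(W * y - W * c)^2) - R / (4*π^2) * (E^2/θ)) ≤ ∫ y in (c + s1/W)..(c + s2/W), ρ y * ‖S y‖^2 := by
    apply intervalIntegral.integral_mono_on hle
    · apply Continuous.intervalIntegrable; fun_prop
    · apply Continuous.intervalIntegrable; fun_prop
    · intro y hy
      have h1 := hb y hy.1 hy.2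
      have h2 := hr y hy.1 hy.2
      have h3 : ‖M y‖ ≤ ‖2 * π * S y‖ + ‖2 * π * S y - M y‖ := by
        have := norm_sub_le (2 * π * S y) (2 * π * S y - M y)
        simpa using this
      have h4 := sq_low hθ hE (norm_nonneg (M y)) (norm_nonneg (2 * π * S y)) (by linarith)
      have h5 : ‖2 * π * S y‖^2 = 4*π^2 * ‖S y‖^2 := by
        rw [norm_mul, norm_mul, Complex.norm_real, Real.norm_eq_abs, abs_of_pos Real.pi_pos]
        simp; ring
      have h6 : ‖M y‖^2 = A^2 * (2*π*W^2) * Real.exp (-(W * y - W * c)^2) := by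
        rw [hM, mul_pow, mul_pow, mul_pow, Real.sq_sqrt (by positivity), ← Real.exp_nat_mul]
        have : ((2:ℕ):ℝ) * -(W^2 * (y-c)^2/2) = -(W * y - W * c)^2 := by push_cast; ring
        rw [this]; ring
      rw [h5, h6] at h4
      have hpi := Real.pi_pos
      calc _ = R / (4*π^2) * ((1 - θ) * (A^2 * (2*π*W^2) * Real.exp (-(W * y - W * c)^2)) - E^2/θ) := by ring
        _ ≤ R / (4*π^2) * (4*π^2 * ‖S y‖^2) := by gcongr
        _ = R * ‖S y‖^2 := by field_simp
        _ ≤ _ := by gcongr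
  refine le_trans (le_of_eq ?_) key
  rw [intervalIntegral.integral_sub, intervalIntegral.integral_const_mul, intervalIntegral.integral_comp_mul_sub (fun s => Real.exp (-s^2)) hW.ne', intervalIntegral.integral_const]
  · have e1 : W * (c + s1/W) - W * c = s1 := by field_simp; ring
    have e2 : W * (c + s2/W) - W * c = s2 := by field_simp; ring
    rw [e1, e2]
    simp only [smul_eq_mul]
    field_simp; ring
  · apply Continuous.intervalIntegrable; fun_prop
  · apply Continuous.intervalIntegrable; fun_prop

lemma split_low {h : ℝ → ℝ} (hh : ∀ y, 0 ≤ h y) (hev : ∀ y, h (-y) = h y) (hi : Integrable h) (P : Finset ℕ) {b : ℝ} (hb : 0 < b) (hb2 : b ≤ 1/16)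
    (hP : ∀ p ∈ P, 2 ≤ p ∧ b ≤ 1/(8*(p:ℝ))) :
    2 * (∫ y in (0:ℝ)..b, h y) + 2 * ∑ p ∈ P, ∫ y in (Real.log p - b)..(Real.log p + b), h y ≤ ∫ y, h y := by
  have e1 : ∫ y, h y = 2 * ∫ y in Set.Ioi (0:ℝ), h y := by
    rw [← integral_comp_abs]
    congr 1; ext y
    rcases le_total 0 y with hy | hy
    · rw [abs_of_nonneg hy]
    · rw [abs_of_nonpos hy, hev]
  have hl2 : ∀ p ∈ P, 1/2 ≤ Real.log p := by
    intro p hp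
    have : (2:ℝ) ≤ p := by exact_mod_cast (hP p hp).1
    have := Real.log_le_log (by norm_num) this
    linarith [Real.log_two_gt_d9]
  set s : ℕ → Set ℝ := fun p => Set.Ioc (Real.log p - b) (Real.log p + b) with hs
  have e2 : ∫ y in ⋃ p ∈ P, s p, h y = ∑ p ∈ P, ∫ y in (Real.log p - b)..(Real.log p + b), h y := by
    rw [integral_biUnion_finset P (fun _ _ => measurableSet_Ioc) _ (fun _ _ => hi.integrableOn)]
    · refine Finset.sum_congr rfl fun p _ => ?_
      rw [intervalIntegral.integral_of_le (by linarith)]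
    · intro n hn p hp hnp
      rw [Function.onFun, Set.disjoint_left]
      intro y hy1 hy2
      simp only [hs, Set.mem_Ioc] at hy1 hy2
      have h1 := log_sep (by linarith [(hP n hn).1]) (by linarith [(hP p hp).1]) hnp
      have h2 := (hP p hp).2
      have h3 : 1/(2*(p:ℝ)) = 4 * (1/(8*(p:ℝ))) := by ring
      have h4 : |Real.log p - Real.log n| < 2 * b := by
        rw [abs_lt]; constructor <;> linarith [hy1.1, hy1.2, hy2.1, hy2.2]
      linarith
  have e3 : ∫ y in Set.Ioc 0 b ∪ ⋃ p ∈ P, s p, h y = (∫ y in (0:ℝ)..b, h y) + ∑ p ∈ P, ∫ y in (Real.log p - b)..(Real.log p + b), h y := by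
    rw [setIntegral_union _ _ hi.integrableOn hi.integrableOn, e2, intervalIntegral.integral_of_le hb.le]
    · rw [Set.disjoint_left]
      intro y hy hy2
      simp only [Set.mem_iUnion] at hy2
      obtain ⟨p, hp, hy2⟩ := hy2
      have := hl2 p hp
      simp only [hs, Set.mem_Ioc] at hy hy2
      linarith [hy.2, hy2.1]
    · exact Finset.measurableSet_biUnion P fun _ _ => measurableSet_Ioc
  have e4 : ∫ y in Set.Ioc 0 b ∪ ⋃ p ∈ P, s p, h y ≤ ∫ y in Set.Ioi (0:ℝ), h y := by
    apply setIntegral_mono_set hi.integrableOn (Eventually.of_forall hh)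
    apply LE.le.eventuallyLE
    apply Set.union_subset
    · intro y hy; exact hy.1
    · intro y hy
      simp only [Set.mem_iUnion] at hy
      obtain ⟨p, hp, hy2⟩ := hy
      have := hl2 p hp
      simp only [hs, Set.mem_Ioc] at hy2
      simp only [Set.mem_Ioi]
      linarith [hy2.1]
  rw [e1]
  linarith

end

section

lemma SZ_even (Z : Finset ℝ) (u W y : ℝ) : ‖SZ Z u W (-y)‖ = ‖SZ Z u W y‖ := by
  rw [← Complex.norm_conj]
  congr 1
  unfold SZ Gt
  rw [map_sum]
  refine Finset.sum_congr rfl fun γ _ => ?_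
  rw [map_mul, Complex.conj_natCast, ← Complex.exp_conj]
  congr 2
  simp only [map_add, map_mul, map_div₀, map_neg, map_pow, map_sub, Complex.conj_ofReal, Complex.conj_I, Complex.ofReal_neg, map_ofNat]
  ring

lemma Q_param {κ c B C θ d L0 : ℝ} (hκ : κ < 1) (hκ0 : 0 < κ) (hcκ : κ * (2*c+1) < 2) (hθ : 0 < θ) (hd : 0 < d) :
    ∀ᶠ T : ℝ in atTop, L0 ≤ Real.log T ∧ B ≤ d * T ∧ C^2 * B ≤ θ^2 * (Real.log T)^2 ∧
      8 * B * Real.exp (κ * Real.log T) ≤ Wd T ∧ 16 * c * Real.exp (κ * Real.log T) ≤ (Wd T)^2 ∧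
      64 * Real.log (Wd T) * (Real.exp (κ * Real.log T))^2 ≤ (Wd T)^2 ∧
      4 * B * C^2 * (Real.log T)^2 * Real.exp (κ * (2*c+1) * Real.log T) ≤ θ^2 * (Wd T)^2 := by
  have hlog := Real.tendsto_log_atTop
  have hl2 : Tendsto (fun T : ℝ => θ^2 * (Real.log T)^2) atTop atTop :=
    ((tendsto_pow_atTop two_ne_zero).comp hlog).const_mul_atTop (by positivity)
  have hdT : Tendsto (fun T : ℝ => d * T) atTop atTop := tendsto_id.const_mul_atTop hd
  filter_upwards [hlog.eventually_ge_atTop L0, hdT.eventually_ge_atTop B, hl2.eventually_ge_atTop (C^2*B),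
    growth 1 (8*B) hκ, growth 2 (16*c) (show κ < 2 by linarith), growth 3 64 (show 2*κ < 2 by linarith),
    growth 4 (4*B*C^2/θ^2) hcκ, eventually_ge_atTop 20] with T h1 h2 h3 h4 h5 h6 h7 hT
  have hS := Sz_one hT
  have hL : 0 < Real.log T := by linarith [hS.L2]
  have hTe : Real.exp (1 * Real.log T) = T := by rw [one_mul, Real.exp_log (by linarith)]
  have hTe2 : Real.exp (2 * Real.log T) = T^2 := by
    rw [two_mul, Real.exp_add, Real.exp_log (by linarith)]; ring
  rw [hTe] at h4
  rw [hTe2] at h5 h6 h7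
  have hW2 : (Wd T)^2 = T^2 / (Real.log T)^2 := by unfold Wd; rw [div_pow]
  refine ⟨h1, h2, h3, ?_, ?_, ?_, ?_⟩
  · unfold Wd; rw [le_div_iff₀ hL]; linarith
  · rw [hW2, le_div_iff₀ (by positivity)]; linarith
  · rw [hW2, le_div_iff₀ (by positivity)]
    have : Real.log (Wd T) ≤ Real.log T := Real.log_le_log hS.Wpos hS.WT
    have e : Real.exp (2*κ*Real.log T) = (Real.exp (κ * Real.log T))^2 := by
      rw [sq, ← Real.exp_add]; congr 1; ring
    rw [e] at h6
    calc 64 * Real.log (Wd T) * (Real.exp (κ * Real.log T))^2 * (Real.log T)^2 ≤ 64 * Real.log T * (Real.exp (κ * Real.log T))^2 * (Real.log T)^2 := by gcongr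
      _ ≤ _ := by linarith
  · rw [hW2]
    rw [div_mul_eq_mul_div, div_mul_eq_mul_div, div_le_iff₀ (by positivity)] at h7
    rw [← mul_div_assoc, le_div_iff₀ (by positivity)]
    linarith

lemma arith0 {L W B C R0 θ q G : ℝ} (_hC : 0 ≤ C) (hL2 : 2 ≤ L) (hW1 : 1 ≤ W) (hB1 : 1 ≤ B) (hR0n : 0 ≤ R0) (hθ : 0 < θ) (hθ3 : 0 ≤ 1 - θ)
    (hq0 : 0 < q) (hpq : 1 ≤ π * q) (hB : (1 - θ) * (q / 2) ≤ G) (p3 : C^2 * B ≤ θ^2 * L^2) :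
    L^2 * W * q / (2*π) * (R0 * (1 - 3*θ)) ≤ 2 * (R0 / (4*π^2) * ((1 - θ) * L^2 * (2*π*W) * G - (C*W)^2 * B / (θ * W))) := by
  have hpi0 := Real.pi_pos
  have k1 : (1 - θ) * L^2 * (2*π*W) * G ≥ (1-θ) * L^2 * (2*π*W) * ((1-θ) * (q/2)) := by gcongr
  have k2 : (C*W)^2 * B / (θ * W) ≤ θ * L^2 * W * (π*q) := by
    have : (C*W)^2 * B / (θ * W) = (C^2 * B) * W / θ := by field_simp
    rw [this, div_le_iff₀ hθ]
    calc C^2 * B * W ≤ θ^2 * L^2 * W := by gcongr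
      _ = θ^2 * L^2 * W * 1 := by ring
      _ ≤ θ^2 * L^2 * W * (π*q) := by gcongr
      _ = _ := by ring
  have k3 : L^2 * W * (π * q) * (1 - 3*θ) ≤ (1 - θ) * L^2 * (2*π*W) * G - (C*W)^2 * B / (θ * W) := by
    have : 0 ≤ θ^2 * (L^2 * W * (π * q)) := by positivity
    linarith
  have hpi := Real.pi_pos
  calc _ = 2 * (R0 / (4*π^2) * (L^2 * W * (π * q) * (1 - 3*θ))) := by field_simp; ring
    _ ≤ _ := by gcongr

lemma arithp {L W B C Rp θ q G c κ v lp : ℝ} {p : ℕ} (hC : 0 ≤ C) (hL2 : 2 ≤ L) (hW1 : 1 ≤ W) (hB1 : 1 ≤ B) (hRpn : 0 ≤ Rp) (hθ : 0 < θ) (hθ3 : 0 ≤ 1 - θ)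
    (hq0 : 0 < q) (hpq : 1 ≤ π * q) (hB : (1 - θ) * (q / 2) ≤ G) (p7 : 4 * B * C^2 * L^2 * Real.exp (κ * (2*c+1) * L) ≤ θ^2 * W^2)
    (hp0 : (0:ℝ) < p) (hlp0 : 1/2 ≤ lp) (hlp : lp = Real.log p) (hlpL : lp ≤ κ * L) (hv2 : v^2 = lp^2/p) (hc : 0 ≤ 2*c+1) :
    W * q / (2*π) * (1 - 3*θ) * (L * (lp / p * (lp / L * Rp))) ≤ Rp / (4*π^2) * ((1 - θ) * v^2 * (2*π*W) * (2*G) - (C * L * Real.exp (c*lp))^2 * (B - -B) / (θ * W)) := by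
  have hpi0 := Real.pi_pos
  have k1 : (1 - θ) * v^2 * (2*π*W) * (2*G) ≥ (1 - θ) * v^2 * (2*π*W) * (2*((1-θ)*(q/2))) := by gcongr
  have k2 : (C * L * Real.exp (c*lp))^2 * (B - -B) / (θ * W) ≤ θ * v^2 * (2 * W) * (π*q) := by
    rw [div_le_iff₀ (by positivity)]
    have e1 : (Real.exp (c*lp))^2 * p = Real.exp ((2*c+1)*lp) := by
      have : (p:ℝ) = Real.exp lp := by rw [hlp, Real.exp_log hp0]
      rw [this, sq, ← Real.exp_add, ← Real.exp_add]; congr 1; ring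
    have e2 : Real.exp ((2*c+1)*lp) ≤ Real.exp (κ * (2*c+1) * L) := by
      apply Real.exp_le_exp.2
      have : (2*c+1) * lp ≤ (2*c+1) * (κ * L) := by gcongr
      linarith
    have e3 : (C * L * Real.exp (c*lp))^2 * B ≤ θ^2 * v^2 * W^2 := by
      rw [hv2]
      have : θ^2 * (lp^2/p) * W^2 = (θ^2 * W^2 * lp^2)/p := by ring
      rw [this, le_div_iff₀ hp0]
      calc (C * L * Real.exp (c*lp))^2 * B * p = B * C^2 * L^2 * ((Real.exp (c*lp))^2 * p) := by ring
        _ ≤ B * C^2 * L^2 * Real.exp (κ * (2*c+1) * L) := by rw [e1]; gcongr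
        _ ≤ θ^2 * W^2 / 4 := by linarith
        _ ≤ θ^2 * W^2 * lp^2 := by
          have : 1/4 ≤ lp^2 := by
            have := pow_le_pow_left₀ (by norm_num) hlp0 2
            norm_num at this ⊢; linarith
          have h2 : 0 ≤ θ^2 * W^2 := by positivity
          have h3 := mul_le_mul_of_nonneg_left this h2
          linarith
    calc (C * L * Real.exp (c*lp))^2 * (B - -B) = 2 * ((C * L * Real.exp (c*lp))^2 * B) := by ring
      _ ≤ 2 * (θ^2 * v^2 * W^2) := by gcongr
      _ = 2 * (θ^2 * v^2 * W^2) * 1 := by ring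
      _ ≤ 2 * (θ^2 * v^2 * W^2) * (π * q) := by gcongr
      _ = _ := by ring
  have k3 : v^2 * (2 * W) * (π * q) * (1 - 3*θ) ≤ (1 - θ) * v^2 * (2*π*W) * (2*G) - (C * L * Real.exp (c*lp))^2 * (B - -B) / (θ * W) := by
    have : 0 ≤ θ^2 * (v^2 * (2 * W) * (π * q)) := by positivity
    linarith
  have hpi := Real.pi_pos
  calc _ = Rp / (4*π^2) * (v^2 * (2 * W) * (π * q) * (1 - 3*θ)) := by
          rw [hv2]
          field_simp; ring
    _ ≤ _ := by gcongr

lemma Q_core {F : ℝ → ℝ} (hfc : Continuous F) (hnn : ∀ α, 0 ≤ F α) (hFe : ∀ α, F (-α) = F α) {S : ℝ → ℂ} (hSc : Continuous S) (hSe : ∀ y, ‖S (-y)‖ = ‖S y‖)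
    {κ θ c B C d L W T I0 u ε b X : ℝ} {P : Finset ℕ} (hκ0 : 0 < κ) (hκ : κ < 1) (hI0 : I0 = ∫ α in (0:ℝ)..κ, α * F α)
    (hθ : 0 < θ) (hθ1 : θ ≤ 1/3) (hθ2 : θ * (5 + 3 * (F 0 + 2 * I0)) ≤ ε) (hc2 : 1/2 < c) (hB1 : 1 ≤ B) (hB : (1 - θ) * (√π / 2) ≤ ∫ s in (0:ℝ)..B, Real.exp (-s^2))
    (hC0 : 0 ≤ C) (hd : 0 < d)
    (hu : ∀ x ∈ Set.Icc (-1:ℝ) 2, ∀ y ∈ Set.Icc (-1:ℝ) 2, dist x y < d → dist (F x) (F y) < θ)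
    (hL2 : 2 ≤ L) (hW1 : 1 ≤ W) (hWL : W * L = T) (p2 : B ≤ min d 1 / 2 * T) (p3 : C^2 * B ≤ θ^2 * L^2)
    (p7 : 4 * B * C^2 * L^2 * Real.exp (κ * (2*c+1) * L) ≤ θ^2 * W^2)
    (hhi : Integrable (fun y => F (y/L) * ‖S y‖^2)) (hb : b = B / W) (b16 : b ≤ 1/16) (hX : X = Real.exp (κ * L))
    (hPX : ∀ p ∈ P, 2 ≤ p ∧ (2:ℝ) ≤ p ∧ (p:ℝ) ≤ X ∧ p.Prime) (hbp : ∀ p ∈ P, b ≤ 1/(8*(p:ℝ)))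
    (near : ∀ y, |y| ≤ 1/4 → ‖2 * π * S y - (L:ℂ) * gg u W y‖ ≤ C * W)
    (far : ∀ p ∈ P, ∀ y, |y - Real.log p| ≤ 1/(8*(p:ℝ)) → ‖2 * π * S y + (vL p : ℂ) * gg u W (y - Real.log p)‖ ≤ C * L * Real.exp (c * Real.log p))
    (zm' : L * ((∫ x in (0:ℝ)..κ, x * max (F x - θ) 0) - θ) ≤ ∑ p ∈ P, Real.log p / p * (Real.log p / L * max (F (Real.log p / L) - θ) 0)) :
    L * W * √π / (2*π) * (F 0 + 2 * I0 - ε) ≤ L⁻¹ * ∫ y, F (y/L) * ‖S y‖^2 := by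
  have hI0n : 0 ≤ I0 := by
    rw [hI0]
    apply intervalIntegral.integral_nonneg hκ0.le
    intro x hx
    exact mul_nonneg hx.1 (hnn x)
  obtain ⟨A, hA⟩ : ∃ A, A = F 0 + 2 * I0 := ⟨_, rfl⟩
  have hAn : 0 ≤ A := by have := hnn 0; linarith
  rw [← hA] at hθ2 ⊢
  have hb0 : 0 < b := by rw [hb]; positivity
  have hgc : Continuous (fun x => x * max (F x - θ) 0) := by fun_prop
  have hρc : Continuous (fun y => F (y / L)) := by fun_prop
  obtain ⟨q, hq⟩ : ∃ q, q = √π := ⟨_, rfl⟩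
  rw [← hq] at hB ⊢
  have hq0 : 0 < q := by rw [hq]; exact Real.sqrt_pos.2 Real.pi_pos
  have hpi3 := Real.pi_gt_three
  have hq1 : 1 ≤ q := by rw [hq, Real.one_le_sqrt]; linarith
  have hpq : 1 ≤ π * q := one_le_mul_of_one_le_of_one_le (by linarith) hq1
  obtain ⟨G, hG⟩ : ∃ G, G = ∫ s in (0:ℝ)..B, Real.exp (-s^2) := ⟨_, rfl⟩
  rw [← hG] at hB
  have hθ3 : 0 ≤ 1 - θ := by linarith
  have hbL : b / L < d ∧ b / L < 1 := by
    have h1 : b / L = B / T := by rw [hb, div_div, hWL]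
    have hT0 : 0 < T := by
      have : 0 < L := by linarith
      rw [← hWL]; positivity
    have h0 : 0 < min d 1 := lt_min hd one_pos
    have h2 : b / L ≤ min d 1 / 2 := by rw [h1, div_le_iff₀ hT0]; exact p2
    have h3 : min d 1 ≤ d := min_le_left _ _
    have h4 : min d 1 ≤ 1 := min_le_right _ _
    constructor <;> linarith
  have hρlow : ∀ x y : ℝ, 0 ≤ x → x ≤ κ * L → |y - x| ≤ b → max (F (x/L) - θ) 0 ≤ F (y / L) := by
    intro x y hx0 hx1 hxy
    apply max_le _ (hnn _)
    have hL0' : 0 < L := by linarith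
    have e1 : |y / L - x / L| ≤ b / L := by
      rw [← sub_div, abs_div, abs_of_pos hL0']; gcongr
    have e2 := abs_le.1 e1
    have e3 : 0 ≤ x / L := by positivity
    have e4 : x / L ≤ κ := by rw [div_le_iff₀ hL0']; exact hx1
    have := hu (x/L) ⟨by linarith, by linarith⟩ (y/L) ⟨by linarith [e2.1, hbL.2], by linarith [e2.2, hbL.2]⟩ (by
      rw [dist_comm, Real.dist_eq]; linarith [hbL.1])
    rw [Real.dist_eq] at this
    linarith [(abs_lt.1 this).2]
  obtain ⟨R0, hR0⟩ : ∃ R0, R0 = max (F 0 - θ) 0 := ⟨_, rfl⟩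
  have hR0n : 0 ≤ R0 := by rw [hR0]; exact le_max_right _ _
  have z0 : L^2 * W * q / (2*π) * (R0 * (1 - 3*θ)) ≤ 2 * ∫ y in (0:ℝ)..b, F (y / L) * ‖S y‖^2 := by
    have := local_low (S := S) (M := fun y => (L:ℂ) * gg u W y) (ρ := fun y => F (y / L)) hSc hρc (c := 0) (W := W) (s1 := 0) (s2 := B) (A := L) (E := C * W) (R := R0) (θ := θ)
      (by linarith) (by linarith) hθ (by linarith) (by positivity) hR0n
      (fun y => by
        rw [norm_mul, gg_norm _ _ (by linarith), Complex.norm_real, Real.norm_eq_abs, abs_of_nonneg (by linarith), sub_zero])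
      (fun y hy1 hy2 => by
        simp only [zero_div, zero_add] at hy1 hy2
        rw [← hb] at hy2
        apply near y
        rw [abs_of_nonneg (by linarith)]; linarith)
      (fun y hy1 hy2 => by
        simp only [zero_div, zero_add] at hy1 hy2
        rw [← hb] at hy2
        have := hρlow 0 y le_rfl (by positivity) (by rw [sub_zero, abs_of_nonneg (by linarith)]; linarith)
        rwa [zero_div, ← hR0] at this)
    simp only [zero_div, zero_add, sub_zero] at this
    rw [← hb, ← hG] at this
    refine le_trans ?_ (mul_le_mul_of_nonneg_left this (by norm_num))
    exact arith0 (by linarith) hL2 hW1 hB1 hR0n hθ hθ3 hq0 hpq hB p3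
  have zp : ∀ p ∈ P, W * q / (2*π) * (1 - 3*θ) * (L * (Real.log p / p * (Real.log p / L * max (F (Real.log p / L) - θ) 0))) ≤ ∫ y in (Real.log p - b)..(Real.log p + b), F (y / L) * ‖S y‖^2 := by
    intro p hp
    obtain ⟨hp2, hp2r, hpX, hpp⟩ := hPX p hp
    have hp0 : (0:ℝ) < p := by linarith
    obtain ⟨lp, hlp⟩ : ∃ lp, lp = Real.log p := ⟨_, rfl⟩
    rw [← hlp]
    have hlp0 : 1/2 ≤ lp := by
      have := Real.log_le_log (by norm_num) hp2r
      rw [hlp]; linarith [Real.log_two_gt_d9]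
    have hlpL : lp ≤ κ * L := by rw [hlp, Real.log_le_iff_le_exp hp0, ← hX]; exact hpX
    obtain ⟨Rp, hRp⟩ : ∃ Rp, Rp = max (F (lp/L) - θ) 0 := ⟨_, rfl⟩
    have hRpn : 0 ≤ Rp := by rw [hRp]; exact le_max_right _ _
    rw [← hRp]
    have hv : vL p = lp / √p := by rw [vL, ArithmeticFunction.vonMangoldt_apply_prime hpp, hlp]
    have hv2 : (vL p)^2 = lp^2 / p := by rw [hv, div_pow, Real.sq_sqrt hp0.le]
    have hv0 : 0 ≤ vL p := vL_nonneg p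
    have := local_low (S := S) (M := fun y => -((vL p:ℂ) * gg u W (y - lp))) (ρ := fun y => F (y / L)) hSc hρc (c := lp) (W := W) (s1 := -B) (s2 := B) (A := vL p) (E := C * L * Real.exp (c * lp)) (R := Rp) (θ := θ)
      (by linarith) (by linarith) hθ hv0 (by positivity) hRpn
      (fun y => by
        rw [norm_neg, norm_mul, gg_norm _ _ (by linarith), Complex.norm_real, Real.norm_eq_abs, abs_of_nonneg hv0])
      (fun y hy1 hy2 => by
        rw [sub_neg_eq_add]
        rw [hlp]
        rw [hlp] at hy1 hy2
        apply far p hp y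
        refine le_trans ?_ (hbp p hp)
        rw [neg_div, ← hb] at hy1
        rw [← hb] at hy2
        rw [abs_le]; constructor <;> linarith)
      (fun y hy1 hy2 => by
        rw [hRp]
        apply hρlow lp y (by linarith) hlpL
        rw [neg_div, ← hb] at hy1
        rw [← hb] at hy2
        rw [abs_le]; constructor <;> linarith)
    rw [gauss_two, ← hG] at this
    have ei : lp + -B / W = lp - b := by rw [hb]; ring
    rw [ei, ← hb] at this
    refine le_trans ?_ this
    have := arithp (c := c) (κ := κ) hC0 hL2 hW1 hB1 hRpn hθ hθ3 hq0 hpq hB p7 hp0 hlp0 hlp hlpL hv2 (by linarith)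
    exact this
  have hsplit := split_low (h := fun y => F (y / L) * ‖S y‖^2) (fun y => mul_nonneg (hnn _) (by positivity)) (fun y => by
    rw [neg_div, hFe, hSe]) hhi P hb0 b16 (fun p hp => ⟨(hPX p hp).1, hbp p hp⟩)
  have zs := Finset.sum_le_sum zp
  rw [← Finset.mul_sum, ← Finset.mul_sum] at zs
  have gI : I0 - θ ≤ ∫ x in (0:ℝ)..κ, x * max (F x - θ) 0 := by
    have h1 : ∫ x in (0:ℝ)..κ, (x * F x - θ) ≤ ∫ x in (0:ℝ)..κ, x * max (F x - θ) 0 := by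
      apply intervalIntegral.integral_mono_on hκ0.le
      · apply Continuous.intervalIntegrable; fun_prop
      · exact hgc.intervalIntegrable _ _
      · intro x hx
        have := mul_le_mul_of_nonneg_left (le_max_left (F x - θ) 0) hx.1
        have h3 : x * θ ≤ θ := mul_le_of_le_one_left hθ.le (hx.2.trans hκ.le)
        rw [mul_sub] at this
        linarith
    rw [hI0]
    rw [intervalIntegral.integral_sub (by apply Continuous.intervalIntegrable; fun_prop) (by apply Continuous.intervalIntegrable; fun_prop), intervalIntegral.integral_const] at h1
    simp only [smul_eq_mul, sub_zero] at h1
    have h5 : κ * θ ≤ θ := mul_le_of_le_one_left hθ.le hκ.le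
    linarith
  have f1 : W * q / (2*π) * (1 - 3*θ) * (L * (L * (I0 - θ - θ))) ≤ W * q / (2*π) * (1 - 3*θ) * (L * ∑ p ∈ P, Real.log p / p * (Real.log p / L * max (F (Real.log p / L) - θ) 0)) := by
    have h3 : 0 ≤ 1 - 3*θ := by linarith
    have : L * (I0 - θ - θ) ≤ ∑ p ∈ P, Real.log p / p * (Real.log p / L * max (F (Real.log p / L) - θ) 0) := by
      refine le_trans (mul_le_mul_of_nonneg_left ?_ (by linarith)) zm'
      linarith
    exact mul_le_mul_of_nonneg_left (mul_le_mul_of_nonneg_left this (by linarith)) (by positivity)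
  have f2 : L^2 * W * q / (2*π) * ((A - 5 * θ) * (1 - 3*θ)) ≤ ∫ y, F (y / L) * ‖S y‖^2 := by
    refine le_trans ?_ hsplit
    have h3 : 0 ≤ 1 - 3*θ := by linarith
    have h4 : F 0 - θ ≤ R0 := by rw [hR0]; exact le_max_left _ _
    have h5 : L^2 * W * q / (2*π) * ((F 0 - θ) * (1 - 3*θ)) ≤ L^2 * W * q / (2*π) * (R0 * (1 - 3*θ)) :=
      mul_le_mul_of_nonneg_left (mul_le_mul_of_nonneg_right h4 h3) (by positivity)
    have h6 : L^2 * W * q / (2*π) * ((A - 5 * θ) * (1 - 3*θ)) = L^2 * W * q / (2*π) * ((F 0 - θ) * (1 - 3*θ)) + 2 * (W * q / (2*π) * (1 - 3*θ) * (L * (L * (I0 - θ - θ)))) := by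
      rw [hA]; ring
    rw [h6]
    linarith
  have f3 : A - ε ≤ (A - 5 * θ) * (1 - 3*θ) := by
    have h7 : (A-5*θ)*(1-3*θ) = A - θ*(5+3*A) + 15*θ^2 := by ring
    have h8 : 0 ≤ θ^2 := sq_nonneg θ
    linarith
  calc L * W * q / (2*π) * (A - ε) ≤ L * W * q / (2*π) * ((A - 5 * θ) * (1 - 3*θ)) := mul_le_mul_of_nonneg_left f3 (by positivity)
    _ = L⁻¹ * (L^2 * W * q / (2*π) * ((A - 5 * θ) * (1 - 3*θ))) := by field_simp
    _ ≤ _ := mul_le_mul_of_nonneg_left f2 (by positivity)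

lemma Q_low (hRH : RiemannHypothesis) {lam : ℝ} {r : ℝ → ℝ} (hr : memA lam r) {κ δ ε : ℝ} (hκ0 : 0 < κ) (hκ : κ < 1) (hδ : 0 < δ) (hε : 0 < ε) :
    ∃ T0 : ℝ, 20 ≤ T0 ∧ ∀ T u : ℝ, T0 ≤ T → δ*T ≤ u → u ≤ (1-δ)*T →
      Real.log T * Wd T * √π / (2*π) * (fourierCos r 0 + 2 * (∫ α in (0:ℝ)..κ, α * fourierCos r α) - ε) ≤
        ∫ α, fourierCos r α * ‖SZ (Zf hRH T) u (Wd T) (α * Real.log T)‖^2 := by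
  set I0 := ∫ α in (0:ℝ)..κ, α * fourierCos r α with hI0
  have hfc := fc_cont hr
  have hnn := hr.2.2.2.2.2
  have hI0n : 0 ≤ I0 := by
    apply intervalIntegral.integral_nonneg hκ0.le
    intro x hx
    exact mul_nonneg hx.1 (hnn x)
  set A := fourierCos r 0 + 2 * I0 with hA
  have hAn : 0 ≤ A := by have := hnn 0; linarith
  obtain ⟨θ, hθ, hθ1, hθ2⟩ : ∃ θ : ℝ, 0 < θ ∧ θ ≤ 1/3 ∧ θ * (5 + 3 * A) ≤ ε := by
    refine ⟨min (1/3) (ε / (5+3*A)), by positivity, min_le_left _ _, ?_⟩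
    have : min (1/3) (ε / (5+3*A)) ≤ ε / (5+3*A) := min_le_right _ _
    rwa [le_div_iff₀ (by positivity)] at this
  set c : ℝ := 1 - κ/2 with hc
  have hc2 : 1/2 < c := by rw [hc]; linarith
  have hcκ : κ * (2*c+1) < 2 := by rw [hc]; nlinarith
  obtain ⟨B, hB1, hB⟩ := gauss_half hθ
  obtain ⟨C1, hC1, T1, hT1, near⟩ := SZ_near hRH hδ
  obtain ⟨C2, hC2, T2, hT2, far⟩ := SZ_far hRH hδ hc2
  set C := max C1 C2 with hC
  have hC0 : 0 ≤ C := hC1.trans (le_max_left _ _)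
  set g : ℝ → ℝ := fun α => α * max (fourierCos r α - θ) 0 with hg
  have hgc : Continuous g := by simp only [hg]; fun_prop
  obtain ⟨L0, hL0, mert⟩ := mertens_wt hgc hκ0 hθ (fun x hx => by simp only [hg]; positivity)
  -- uniform continuity
  have hu := isCompact_Icc.uniformContinuousOn_of_continuous (s := Set.Icc (-1) 2) hfc.continuousOn
  rw [Metric.uniformContinuousOn_iff] at hu
  obtain ⟨d, hd, hu⟩ := hu θ hθ
  have hmin : 0 < min d 1 / 2 := by positivity
  obtain ⟨T3, hT3⟩ := eventually_atTop.1 (Q_param (B := B) (C := C) (L0 := max L0 (1/κ)) hκ hκ0 hcκ hθ hmin)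
  refine ⟨max T1 (max T2 T3), hT1.trans (le_max_left _ _), fun T u hT hu1 hu2 => ?_⟩
  have hTT1 : T1 ≤ T := (le_max_left _ _).trans hT
  have hTT2 : T2 ≤ T := (le_max_left _ _).trans ((le_max_right _ _).trans hT)
  obtain ⟨p1', p2, p3, p4, p5, p6, p7⟩ := hT3 T ((le_max_right _ _).trans ((le_max_right _ _).trans hT))
  have hSz := Sz_one (hT1.trans hTT1)
  set W := Wd T with hW
  set L := Real.log T with hL
  set X := Real.exp (κ * L) with hX
  have hX0 : 0 < X := Real.exp_pos _
  have p1 : L0 ≤ L := (le_max_left _ _).trans p1'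
  have hL2 : 2 ≤ L := hSz.L2
  have hW1 : 1 ≤ W := hSz.W1
  have hWL : W * L = T := by
    show T / Real.log T * L = T
    exact div_mul_cancel₀ _ (by linarith)
  set S := fun y => SZ (Zf hRH T) u W y with hS
  have hSc : Continuous S := SZ_cont _ _ _
  set ρ : ℝ → ℝ := fun y => fourierCos r (y / L) with hρ
  have hρc : Continuous ρ := by simp only [hρ]; fun_prop
  set h : ℝ → ℝ := fun y => ρ y * ‖S y‖^2 with hh
  have hint := (Q_eq hr (Zf hRH T) u W L).1
  have hcomp : (fun α => fourierCos r α * ‖SZ (Zf hRH T) u W (α * L)‖^2) = fun α => h (α * L) := by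
    ext α; simp only [hh, hρ, hS]; rw [mul_div_cancel_right₀ _ (by linarith)]
  rw [hcomp] at hint ⊢
  have hhi : Integrable h := (integrable_comp_mul_right_iff h (by linarith)).1 hint
  rw [Measure.integral_comp_mul_right, smul_eq_mul, abs_of_pos (by positivity)]
  set P := Nat.primesLE ⌊X⌋₊ with hP
  set b := B / W with hb
  have hb0 : 0 < b := by positivity
  have hbX : b ≤ 1/(8*X) := by
    rw [hb, div_le_div_iff₀ (by linarith) (by positivity)]; linarith
  have hX1 : 1 ≤ X := Real.one_le_exp (by positivity)
  have hPX : ∀ p ∈ P, 2 ≤ p ∧ (2:ℝ) ≤ p ∧ (p:ℝ) ≤ X ∧ p.Prime := by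
    intro p hp
    obtain ⟨h1, h2⟩ := Nat.mem_primesLE.1 hp
    exact ⟨h2.two_le, by exact_mod_cast h2.two_le, (Nat.le_floor_iff hX0.le).1 h1, h2⟩
  have hbp : ∀ p ∈ P, b ≤ 1/(8*(p:ℝ)) := by
    intro p hp
    obtain ⟨_, h2, h3, _⟩ := hPX p hp
    exact hbX.trans (by gcongr)
  have b16 : b ≤ 1/16 := by
    have : 8 * B * X ≤ W := p4
    have h2 : (16:ℝ) * B ≤ W := by
      have h1 : 1/κ ≤ L := (le_max_right _ _).trans p1'
      rw [div_le_iff₀ hκ0] at h1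
      have h2 : 2 ≤ X := by
        rw [hX]; linarith [Real.add_one_le_exp (κ * L)]
      have h3 := mul_le_mul_of_nonneg_left h2 (show 0 ≤ 8 * B by linarith)
      linarith
    rw [hb, div_le_iff₀ (by linarith)]; linarith
  have hnear : ∀ y, |y| ≤ 1/4 → ‖2 * π * S y - (L:ℂ) * gg u W y‖ ≤ C * W := by
    intro y hy
    refine (near T u y hTT1 hu1 hu2 hy).trans ?_
    have : C1 ≤ C := le_max_left _ _
    exact mul_le_mul_of_nonneg_right this (by linarith)
  have hfar : ∀ p ∈ P, ∀ y, |y - Real.log p| ≤ 1/(8*(p:ℝ)) → ‖2 * π * S y + (vL p : ℂ) * gg u W (y - Real.log p)‖ ≤ C * L * Real.exp (c * Real.log p) := by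
    intro p hp y hy
    obtain ⟨hp2, hp2r, hpX, hpp⟩ := hPX p hp
    refine (far T u y p hTT2 hu1 hu2 hp2 ?_ ?_ hy).trans ?_
    · refine le_trans ?_ p5; gcongr
    · rw [le_div_iff₀ (by positivity)]
      have hlW : 0 ≤ Real.log W := Real.log_nonneg hW1
      refine le_trans ?_ p6
      calc Real.log (Wd T) * (64 * (p:ℝ)^2) ≤ Real.log W * (64 * X^2) := by gcongr
        _ = _ := by ring
    · have : C2 ≤ C := le_max_right _ _
      gcongr
  exact Q_core hfc hnn fc_even hSc (fun y => SZ_even _ _ _ y) hκ0 hκ hI0 hθ hθ1 hθ2 hc2 hB1 hB hC0 hd hu hL2 hW1 hWL p2 p3 p7 hhi hb b16 hX hPX hbp hnear hfar (mert L p1)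

end

section

lemma KK_int (γ γ' : ℝ) {W : ℝ} (hW : 0 < W) : Integrable (fun u => Kg u W γ * Kg u W γ') ∧ ∫ u, Kg u W γ * Kg u W γ' ≤ W * √π := by
  have hs : 0 < W / √2 := by positivity
  have sq : ∀ u γ, Kg u W γ ^ 2 = Kg u (W/√2) γ := by
    intro u γ
    unfold Kg
    rw [← Real.exp_nat_mul, div_pow, Real.sq_sqrt (by norm_num)]
    congr 1
    field_simp
    push_cast
    ring
  have hval : W / √2 * √(2*π) = W * √π := by
    rw [Real.sqrt_mul (by norm_num)]
    field_simp
  obtain ⟨i1, v1⟩ := Kg_int_u γ hs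
  obtain ⟨i2, v2⟩ := Kg_int_u γ' hs
  have hle : ∀ u, Kg u W γ * Kg u W γ' ≤ (1/2) * (Kg u (W/√2) γ + Kg u (W/√2) γ') := by
    intro u
    rw [← sq, ← sq]
    nlinarith [sq_nonneg (Kg u W γ - Kg u W γ')]
  have hi := (i1.add i2).const_mul (1/2)
  have hI : Integrable (fun u => Kg u W γ * Kg u W γ') := by
    refine hi.mono' ?_ (Eventually.of_forall fun u => ?_)
    · apply Continuous.aestronglyMeasurable
      unfold Kg
      fun_prop
    · rw [Real.norm_eq_abs, abs_of_pos (mul_pos (Kg_pos _ _ _) (Kg_pos _ _ _))]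
      exact hle u
  refine ⟨hI, (integral_mono hI hi hle).trans ?_⟩
  have : ∫ u, (1/2) * ((fun u => Kg u (W/√2) γ) + fun u => Kg u (W/√2) γ') u = W * √π := by
    rw [integral_const_mul]
    simp only [Pi.add_apply]
    rw [integral_add i1 i2, v1, v2, hval]; ring
  exact this.le

def Dc (Z : Finset ℝ) (d : ℝ) : ℝ := ∑ γ ∈ Z, ∑ γ' ∈ Z, if |γ - γ'| ≤ d then (ordMult γ : ℝ) * ordMult γ' else 0

lemma D_low (Z : Finset ℝ) {d W a b B : ℝ} (hW : 0 < W) (hab : a ≤ b)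
    (h : ∀ u, a ≤ u → u ≤ b → B ≤ ∑ γ ∈ Z, ∑ γ' ∈ Z, (if |γ - γ'| ≤ d then (ordMult γ : ℝ) * ordMult γ' else 0) * (Kg u W γ * Kg u W γ')) :
    (b - a) * B ≤ W * √π * Dc Z d := by
  have hc : ∀ γ γ' : ℝ, 0 ≤ (if |γ - γ'| ≤ d then (ordMult γ : ℝ) * ordMult γ' else 0) := by
    intro γ γ'; split_ifs <;> positivity
  have hI : ∀ γ ∈ Z, ∀ γ' ∈ Z, Integrable (fun u => (if |γ - γ'| ≤ d then (ordMult γ : ℝ) * ordMult γ' else 0) * (Kg u W γ * Kg u W γ')) :=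
    fun γ _ γ' _ => (KK_int γ γ' hW).1.const_mul _
  have hI2 : ∀ γ ∈ Z, Integrable (fun u => ∑ γ' ∈ Z, (if |γ - γ'| ≤ d then (ordMult γ : ℝ) * ordMult γ' else 0) * (Kg u W γ * Kg u W γ')) :=
    fun γ hγ => integrable_finsetSum _ (hI γ hγ)
  have hI3 : Integrable (fun u => ∑ γ ∈ Z, ∑ γ' ∈ Z, (if |γ - γ'| ≤ d then (ordMult γ : ℝ) * ordMult γ' else 0) * (Kg u W γ * Kg u W γ')) :=
    integrable_finsetSum _ hI2
  have hn : ∀ u, 0 ≤ ∑ γ ∈ Z, ∑ γ' ∈ Z, (if |γ - γ'| ≤ d then (ordMult γ : ℝ) * ordMult γ' else 0) * (Kg u W γ * Kg u W γ') := by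
    intro u
    refine Finset.sum_nonneg fun γ _ => Finset.sum_nonneg fun γ' _ => mul_nonneg (hc γ γ') (mul_pos (Kg_pos _ _ _) (Kg_pos _ _ _)).le
  calc (b - a) * B = ∫ u in a..b, B := by rw [intervalIntegral.integral_const, smul_eq_mul]
    _ ≤ ∫ u in a..b, ∑ γ ∈ Z, ∑ γ' ∈ Z, (if |γ - γ'| ≤ d then (ordMult γ : ℝ) * ordMult γ' else 0) * (Kg u W γ * Kg u W γ') := by
        apply intervalIntegral.integral_mono_on hab (by simp) hI3.intervalIntegrable
        intro u hu
        exact h u hu.1 hu.2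
    _ ≤ ∫ u, ∑ γ ∈ Z, ∑ γ' ∈ Z, (if |γ - γ'| ≤ d then (ordMult γ : ℝ) * ordMult γ' else 0) * (Kg u W γ * Kg u W γ') := by
        rw [intervalIntegral.integral_of_le hab]
        exact setIntegral_le_integral hI3 (Eventually.of_forall hn)
    _ = ∑ γ ∈ Z, ∑ γ' ∈ Z, (if |γ - γ'| ≤ d then (ordMult γ : ℝ) * ordMult γ' else 0) * ∫ u, (Kg u W γ * Kg u W γ') := by
        rw [integral_finsetSum _ hI2]
        refine Finset.sum_congr rfl fun γ hγ => ?_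
        rw [integral_finsetSum _ (hI γ hγ)]
        refine Finset.sum_congr rfl fun γ' hγ' => ?_
        rw [integral_const_mul]
    _ ≤ ∑ γ ∈ Z, ∑ γ' ∈ Z, (if |γ - γ'| ≤ d then (ordMult γ : ℝ) * ordMult γ' else 0) * (W * √π) := by
        refine Finset.sum_le_sum fun γ _ => Finset.sum_le_sum fun γ' _ => ?_
        exact mul_le_mul_of_nonneg_left (KK_int γ γ' hW).2 (hc γ γ')
    _ = W * √π * Dc Z d := by
        simp_rw [← Finset.sum_mul]
        rw [mul_comm]; rfl

lemma Q_up {lam : ℝ} {r : ℝ → ℝ} (hr : memA lam r) (Z : Finset ℝ) (u W : ℝ) {L : ℝ} (hL : 0 < L) :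
    ∫ α, fourierCos r α * ‖SZ Z u W (α * L)‖^2 ≤ ∑ γ ∈ Z, ∑ γ' ∈ Z, (if |γ - γ'| ≤ 2 * π * lam / L then (ordMult γ : ℝ) * ordMult γ' else 0) * (Kg u W γ * Kg u W γ') := by
  rw [← (Q_eq hr Z u W L).2]
  refine Finset.sum_le_sum fun γ _ => Finset.sum_le_sum fun γ' _ => ?_
  have hK : 0 < Kg u W γ * Kg u W γ' := mul_pos (Kg_pos _ _ _) (Kg_pos _ _ _)
  have hm : 0 ≤ (ordMult γ : ℝ) * ordMult γ' := by positivity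
  have e : ((ordMult γ : ℝ) * Kg u W γ * ((ordMult γ' : ℝ) * Kg u W γ')) = (ordMult γ : ℝ) * ordMult γ' * (Kg u W γ * Kg u W γ') := by ring
  rw [e]
  have hp : 0 ≤ (ordMult γ : ℝ) * ordMult γ' * (Kg u W γ * Kg u W γ') := by positivity
  split_ifs with h
  · exact mul_le_of_le_one_right hp (r_le_one hr _)
  · rw [zero_mul]
    refine mul_nonpos_of_nonneg_of_nonpos hp (hr.2.2.2.2.1 _ ?_)
    push Not at h
    rw [div_lt_iff₀ hL] at h
    rw [abs_div, abs_mul, abs_of_pos hL, abs_of_pos (by positivity : 0 < 2 * π), lt_div_iff₀ (by positivity)]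
    linarith

lemma zetaN_eq (hRH : RiemannHypothesis) (T : ℝ) : (zetaN T : ℝ) = ∑ γ ∈ Zf hRH T, (ordMult γ : ℝ) := by
  unfold zetaN
  rw [finsum_mem_eq_finite_toFinset_sum _ (ords_finite hRH T)]
  push_cast
  rfl

lemma D_eq (hRH : RiemannHypothesis) (T : ℝ) {d : ℝ} (hd : 0 ≤ d) :
    Dc (Zf hRH T) d = (∑ᶠ γ ∈ zetaOrds T, (ordMult γ : ℝ) * ((ordMult γ : ℝ) - 1)) + (pairCount T d : ℝ) + (zetaN T : ℝ) := by
  classical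
  rw [zetaN_eq hRH, finsum_mem_eq_finite_toFinset_sum _ (ords_finite hRH T)]
  have hset : {p : ℝ × ℝ | p.1 ∈ zetaOrds T ∧ p.2 ∈ zetaOrds T ∧ 0 < |p.1 - p.2| ∧ |p.1 - p.2| ≤ d} =
      (((Zf hRH T) ×ˢ (Zf hRH T)).filter (fun p : ℝ × ℝ => 0 < |p.1 - p.2| ∧ |p.1 - p.2| ≤ d) : Finset (ℝ × ℝ)) := by
    ext p
    simp only [Set.mem_setOf_eq, Finset.coe_filter, Finset.mem_product, mem_Zf]
    tauto
  have hpc : (pairCount T d : ℝ) = ∑ γ ∈ Zf hRH T, ∑ γ' ∈ Zf hRH T, if (0 < |γ - γ'| ∧ |γ - γ'| ≤ d) then (ordMult γ : ℝ) * ordMult γ' else 0 := by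
    unfold pairCount
    rw [hset, finsum_mem_coe_finset, Finset.sum_filter, Finset.sum_product]
    push_cast
    rfl
  rw [hpc]
  change Dc (Zf hRH T) d = ∑ γ ∈ Zf hRH T, _ + _ + _
  rw [add_right_comm, ← Finset.sum_add_distrib, ← Finset.sum_add_distrib]
  unfold Dc
  refine Finset.sum_congr rfl fun γ hγ => ?_
  have : (ordMult γ : ℝ) * ((ordMult γ : ℝ) - 1) + ordMult γ = ∑ γ' ∈ Zf hRH T, if γ = γ' then (ordMult γ : ℝ) * ordMult γ' else 0 := by
    rw [Finset.sum_ite_eq, if_pos hγ]; ring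
  rw [this, ← Finset.sum_add_distrib]
  refine Finset.sum_congr rfl fun γ' hγ' => ?_
  by_cases h : γ = γ'
  · subst h; simp [hd]
  · have : 0 < |γ - γ'| := abs_pos.2 (sub_ne_zero.2 h)
    simp [h, sub_ne_zero.2 h]

theorem prop1_aux (hRH : RiemannHypothesis) (lam : ℝ) (hlam : 0 < lam) (r : ℝ → ℝ) (hr : memA lam r) :
    ∀ ε : ℝ, 0 < ε → ∀ᶠ T : ℝ in atTop,
      (cOf r - ε) * (zetaN T : ℝ) ≤ (∑ᶠ γ ∈ zetaOrds T, (ordMult γ : ℝ) * ((ordMult γ : ℝ) - 1)) + (pairCount T (2 * π * lam / Real.log T) : ℝ) := by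
  intro ε hε
  have hfc := fc_cont hr
  have hnn := hr.2.2.2.2.2
  obtain ⟨A, hA⟩ : ∃ A, A = cOf r + 1 := ⟨_, rfl⟩
  have hA2 : A = fourierCos r 0 + 2 * ∫ α in (0:ℝ)..1, α * fourierCos r α := by rw [hA, cOf]; ring
  have hA0 : 0 ≤ A := by
    rw [hA2]
    have := hnn 0
    have : 0 ≤ ∫ α in (0:ℝ)..1, α * fourierCos r α := intervalIntegral.integral_nonneg (by norm_num) fun x hx => mul_nonneg hx.1 (hnn x)
    linarith
  -- choose κ
  have hcont : Continuous (fun κ : ℝ => ∫ α in (0:ℝ)..κ, α * fourierCos r α) :=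
    intervalIntegral.continuous_primitive (fun a b => Continuous.intervalIntegrable (by fun_prop) _ _) 0
  have hev : ∀ᶠ κ in nhdsWithin (1:ℝ) (Set.Iio 1), (∫ α in (0:ℝ)..1, α * fourierCos r α) - ε/8 < ∫ α in (0:ℝ)..κ, α * fourierCos r α :=
    (hcont.tendsto 1).mono_left nhdsWithin_le_nhds |>.eventually (lt_mem_nhds (by linarith))
  have hev2 : ∀ᶠ κ in nhdsWithin (1:ℝ) (Set.Iio 1), κ ∈ Set.Ioo (0:ℝ) 1 := Ioo_mem_nhdsLT (by norm_num)
  obtain ⟨κ, hκ1, hκ0, hκ⟩ := (hev.and hev2).exists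
  -- choose δ
  obtain ⟨δ, hδ0, hδ1, hδA⟩ : ∃ δ : ℝ, 0 < δ ∧ δ ≤ 1/4 ∧ δ * (4 * (A + 1)) ≤ ε/4 := by
    refine ⟨min (1/4) (ε/4/(4 * (A+1))), by positivity, min_le_left _ _, ?_⟩
    have : min (1/4) (ε/4/(4 * (A+1))) ≤ ε/4/(4 * (A+1)) := min_le_right _ _
    rwa [le_div_iff₀ (by positivity)] at this
  obtain ⟨T1, hT1, hN⟩ := N_up hRH hδ0
  obtain ⟨T2, hT2, hQ⟩ := Q_low hRH hr hκ0 hκ hδ0 (show 0 < ε/4 by positivity)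
  filter_upwards [eventually_ge_atTop T1, eventually_ge_atTop T2] with T h1 h2
  have hT20 : 20 ≤ T := hT1.trans h1
  have hSz := Sz_one hT20
  have hL2 := hSz.L2
  have hL0 : 0 < Real.log T := by linarith
  have hW0 : 0 < Wd T := by have := hSz.W1; linarith
  have hT0 : 0 < T := by linarith
  have hd : 0 ≤ 2 * π * lam / Real.log T := by positivity
  have hD := D_eq hRH T hd
  have hN' := hN T h1
  rw [← zetaN_eq] at hN'
  obtain ⟨N, hNdef⟩ : ∃ N, N = (zetaN T : ℝ) := ⟨_, rfl⟩
  have hN0 : 0 ≤ N := by rw [hNdef]; positivity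
  rw [← hNdef] at hN' hD ⊢
  obtain ⟨D, hDdef⟩ : ∃ D, D = Dc (Zf hRH T) (2 * π * lam / Real.log T) := ⟨_, rfl⟩
  rw [← hDdef] at hD
  have hD0 : 0 ≤ D := by
    rw [hDdef]
    refine Finset.sum_nonneg fun γ _ => Finset.sum_nonneg fun γ' _ => ?_
    split_ifs <;> positivity
  suffices h : (A - ε) * N ≤ D by
    rw [hA] at h
    linarith
  by_cases hneg : A - ε ≤ 0
  · exact (mul_nonpos_of_nonpos_of_nonneg hneg hN0).trans hD0
  push Not at hneg
  obtain ⟨M, hM⟩ : ∃ M, M = T * Real.log T / (2*π) := ⟨_, rfl⟩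
  have hM0 : 0 < M := by rw [hM]; positivity
  rw [← hM] at hN'
  have hlow : (1 - 2*δ) * (A - ε/2) * M ≤ D := by
    have := D_low (Zf hRH T) (d := 2 * π * lam / Real.log T) (a := δ*T) (b := (1-δ)*T) (B := Real.log T * Wd T * √π / (2*π) * (A - ε/2)) hW0 (by nlinarith)
      (fun u hu1 hu2 => by
        refine le_trans ?_ (Q_up hr (Zf hRH T) u (Wd T) hL0)
        refine le_trans ?_ (hQ T u h2 hu1 hu2)
        refine mul_le_mul_of_nonneg_left ?_ (by positivity)
        rw [hA2]; linarith)
    rw [← hDdef] at this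
    have e : ((1-δ)*T - δ*T) * (Real.log T * Wd T * √π / (2*π) * (A - ε/2)) = Wd T * √π * ((1 - 2*δ) * (A - ε/2) * M) := by
      rw [hM]; ring
    rw [e] at this
    exact le_of_mul_le_mul_left this (by positivity)
  have hfin : (A - ε) * (1 + δ) ≤ (1 - 2*δ) * (A - ε/2) := by
    have h8 : 0 ≤ δ * ε := by positivity
    nlinarith
  calc (A - ε) * N ≤ (A - ε) * ((1 + δ) * M) := mul_le_mul_of_nonneg_left hN' hneg.le
    _ = (A - ε) * (1 + δ) * M := by ring
    _ ≤ (1 - 2*δ) * (A - ε/2) * M := mul_le_mul_of_nonneg_right hfin hM0.le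
    _ ≤ D := hlow

end

/-- **Proposition 1.** Assume RH and let `r ∈ 𝒜(λ)` with `λ > 0`. Then for every `ε > 0`
and all sufficiently large `T`,
`Σ_{0<γ_d≤T} m(γ_d)(m(γ_d)-1) + #{(γ,γ') : 0<γ,γ'≤T, 0<|γ-γ'|≤2πλ/log T}
  ≥ (c(λ;r) - ε) N(T)`. -/
theorem prop1 (hRH : RiemannHypothesis) (lam : ℝ) (hlam : 0 < lam)
    (r : ℝ → ℝ) (hr : memA lam r) :
    ∀ ε : ℝ, 0 < ε → ∀ᶠ T : ℝ in atTop,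
      (cOf r - ε) * (zetaN T : ℝ) ≤
        (∑ᶠ γ ∈ zetaOrds T, (ordMult γ : ℝ) * ((ordMult γ : ℝ) - 1)) +
          (pairCount T (2 * π * lam / Real.log T) : ℝ) := by
  exact prop1_aux hRH lam hlam r hr
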